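/- Let n ≥ 1, s ∈ (0,1), a ≥ 0, let Ω ⊂ ℝⁿ be a bounded C² domain, and let λ ∈ ℝ. Suppose φ ∈ C²(Ω) ∩ C(ℝⁿ) solves −Δφ + a(−Δ)ˢφ = λφ in Ω and φ = 0 in Ωᶜ. If the normal derivative ∂φ/∂ν vanishes at every point of ∂Ω, then φ ≡ 0 in ℝⁿ. -/

import Mathlib

open MeasureTheory Real Set Metric Bornology Filter
open scoped RealInnerProductSpace ENNReal NNReal Pointwise

noncomputable section

abbrev En (n : ℕ) : Type := EuclideanSpace ℝ (Fin n)

/-- The normalizing constant `c_{n,s}`. -/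
def cK (n : ℕ) (s : ℝ) : ℝ :=
  s * (2 : ℝ) ^ (2 * s) * Real.Gamma (((n : ℝ) + 2 * s) / 2) /
    (Real.pi ^ ((n : ℝ) / 2) * Real.Gamma (1 - s))

/-- The fractional Laplacian `(-Δ)ˢ u (x)`. -/
def fracLap (n : ℕ) (s : ℝ) (u : En n → ℝ) (x : En n) : ℝ :=
  (cK n s / 2) * ∫ y : En n, (2 * u x - u (x + y) - u (x - y)) / ‖y‖ ^ ((n : ℝ) + 2 * s)

/-- `(-Δ)^{s/2} u (x)`, defined via the non-symmetrized integral. -/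
def fracHalf (n : ℕ) (s : ℝ) (u : En n → ℝ) (x : En n) : ℝ :=
  cK n (s / 2) * ∫ z : En n, (u x - u (x + z)) / ‖z‖ ^ ((n : ℝ) + s)

/-- The squared Gagliardo-type seminorm `[u]_s²`. -/
def seminormSsq (n : ℕ) (s : ℝ) (u : En n → ℝ) : ℝ :=
  (cK n s / 2) * ∫ p : En n × En n, (u p.1 - u p.2) ^ 2 / ‖p.1 - p.2‖ ^ ((n : ℝ) + 2 * s)

/-- The squared seminorm `[u]₁² = ∫_Ω |∇u|²`. -/
def seminorm1sq (n : ℕ) (Ω : Set (En n)) (u : En n → ℝ) : ℝ :=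
  ∫ x in Ω, ‖gradient u x‖ ^ 2

/-- The Laplacian as the trace of the Hessian. -/
def lap (n : ℕ) (u : En n → ℝ) (x : En n) : ℝ :=
  ∑ i : Fin n, fderiv ℝ (fun y => fderiv ℝ u y (EuclideanSpace.single i 1)) x
    (EuclideanSpace.single i 1)

/-- The Hessian `D²u(x)` as a continuous bilinear-type map; `‖hess n u x‖` is its operator
norm. -/
def hess (n : ℕ) (u : En n → ℝ) (x : En n) : En n →L[ℝ] En n →L[ℝ] ℝ :=
  fderiv ℝ (fderiv ℝ u) x

/-- A bounded C² domain `Ω ⊆ ℝⁿ`: a bounded open connected set whose boundary is a C²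
hypersurface, described by a global C² defining function with nonvanishing gradient
on the boundary. -/
structure C2Domain (n : ℕ) where
  carrier : Set (En n)
  phi : En n → ℝ
  phi_smooth : ContDiff ℝ 2 phi
  carrier_eq : carrier = {x | phi x < 0}
  grad_ne : ∀ x ∈ frontier carrier, gradient phi x ≠ 0
  bounded : IsBounded carrier
  connected : IsConnected carrier

/-- The outward unit normal `ν` on `∂Ω`. -/
def C2Domain.nu {n : ℕ} (D : C2Domain n) (x : En n) : En n :=
  ‖gradient D.phi x‖⁻¹ • gradient D.phi x

/-- The normal derivative `∂u/∂ν` at a boundary point (the derivative from inside). -/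
def normalDeriv {n : ℕ} (D : C2Domain n) (u : En n → ℝ) (x : En n) : ℝ :=
  fderivWithin ℝ u (closure D.carrier) x (D.nu x)

/-- `Ω` is strictly star-shaped with respect to `z₀`. -/
def C2Domain.StrictlyStarShapedAt {n : ℕ} (D : C2Domain n) (z₀ : En n) : Prop :=
  z₀ ∈ D.carrier ∧ ∀ x ∈ frontier D.carrier, 0 < ⟪x - z₀, D.nu x⟫

/-- `Ω` is strictly star-shaped. -/
def C2Domain.StrictlyStarShaped {n : ℕ} (D : C2Domain n) : Prop :=
  ∃ z₀, D.StrictlyStarShapedAt z₀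

/-- The Pohozaev boundary term `∫_{∂Ω} (∂u/∂ν)² (x·ν(x)) dS`, with `dS` the
`(n-1)`-dimensional Hausdorff measure on `∂Ω`. -/
def pohozaevBoundary {n : ℕ} (D : C2Domain n) (u : En n → ℝ) : ℝ :=
  ∫ x in frontier D.carrier, (normalDeriv D u x) ^ 2 * ⟪x, D.nu x⟫ ∂ μH[(n : ℝ) - 1]

/-- Condition (★). -/
def StarCond (n : ℕ) (s : ℝ) (Ω : Set (En n)) (u : En n → ℝ) : Prop :=
  ∃ C > 0, ∃ γ ∈ Set.Ioo (0:ℝ) 1, ∀ x ∈ Ω,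
    ‖hess n u x‖ ≤ C * infDist x (frontier Ω) ^ (γ - 1) ∧
    |u x| ≤ C * infDist x (frontier Ω) ∧
    |fracLap n s u x| ≤ C * (1 + (if s < 1/2 then 1 else 0)
      + (if s = 1/2 then |Real.log (infDist x (frontier Ω))| else 0)
      + (if 1/2 < s then infDist x (frontier Ω) ^ (1 - 2*s) else 0))


open scoped Topology

/-- second difference -/
def sdf {n : ℕ} (u : En n → ℝ) (x y : En n) : ℝ := u (x + y) + u (x - y) - 2 * u x

def kap {n : ℕ} (s : ℝ) (y : En n) : ℝ := min (‖y‖ ^ (1 + s)) 1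

def kr (n : ℕ) (s : ℝ) (y : En n) : ℝ := kap s y / ‖y‖ ^ ((n : ℝ) + 2 * s)

def Hs {n : ℕ} (u : En n → ℝ) (x v : En n) : ℝ := fderiv ℝ (fderiv ℝ u) x v v

lemma kap_nonneg {n : ℕ} (s : ℝ) (y : En n) : 0 ≤ kap s y := by
  unfold kap; positivity

lemma kap_le_one {n : ℕ} (s : ℝ) (y : En n) : kap s y ≤ 1 := min_le_right _ _

lemma kr_nonneg (n : ℕ) (s : ℝ) (y : En n) : 0 ≤ kr n s y := by
  unfold kr; have := kap_nonneg s y; positivity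

lemma measurable_kap {n : ℕ} (s : ℝ) : Measurable (fun y : En n => kap s y) := by
  unfold kap; fun_prop

lemma fracLap_eq (n : ℕ) (s : ℝ) (u : En n → ℝ) (x : En n) :
    fracLap n s u x = -(cK n s / 2) * ∫ y : En n, sdf u x y / ‖y‖ ^ ((n : ℝ) + 2 * s) := by
  unfold fracLap sdf
  rw [neg_mul, ← mul_neg, ← integral_neg]
  congr 2
  ext y
  ring

lemma cK_pos (n : ℕ) (s : ℝ) (hs : s ∈ Set.Ioo (0:ℝ) 1) : 0 < cK n s := by
  obtain ⟨h0, h1⟩ := hs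
  unfold cK
  have g1 : 0 < Real.Gamma (((n : ℝ) + 2 * s) / 2) := Real.Gamma_pos_of_pos (by positivity)
  have g2 : 0 < Real.Gamma (1 - s) := Real.Gamma_pos_of_pos (by linarith)
  positivity

lemma kr_integrable (n : ℕ) (hn : 1 ≤ n) (s : ℝ) (hs : s ∈ Set.Ioo (0:ℝ) 1) :
    Integrable (kr n s) := by
  obtain ⟨h0, h1⟩ := hs
  haveI : Nonempty (Fin n) := ⟨⟨0, hn⟩⟩
  let f : ℝ → ℝ := fun t => min (t ^ (1 + s)) 1 / t ^ ((n : ℝ) + 2 * s)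
  have key := (integrable_fun_norm_addHaar (E := En n) (F := ℝ)
    (volume : Measure (En n)) (f := f)).2
  refine key ?_
  have hfr : Module.finrank ℝ (En n) = n := by simp
  rw [hfr]
  have hU : Ioi (0:ℝ) = Ioc 0 1 ∪ Ioi 1 := by
    rw [Ioc_union_Ioi_eq_Ioi]; norm_num
  rw [hU]
  have hpow : ∀ y : ℝ, 0 < y → (y ^ (n - 1) : ℝ) = y ^ ((n : ℝ) - 1) := by
    intro y hy
    rw [← Real.rpow_natCast, Nat.cast_sub hn]; simp
  apply IntegrableOn.union
  · have : IntegrableOn (fun y : ℝ => y ^ (-s)) (Ioc 0 1) := by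
      have := intervalIntegral.intervalIntegrable_rpow' (a := 0) (b := 1) (r := -s) (by linarith)
      rwa [intervalIntegrable_iff_integrableOn_Ioc_of_le (by norm_num)] at this
    refine this.congr_fun ?_ measurableSet_Ioc
    intro y hy
    have hy0 := hy.1
    simp only [f, smul_eq_mul]
    rw [min_eq_left (Real.rpow_le_one hy0.le hy.2 (by linarith)), hpow y hy0,
      ← Real.rpow_sub hy0, ← Real.rpow_add hy0]
    congr 1; ring
  · have : IntegrableOn (fun y : ℝ => y ^ (-1 - 2 * s)) (Ioi 1) :=
      integrableOn_Ioi_rpow_of_lt (by linarith) (by norm_num)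
    refine this.congr_fun ?_ measurableSet_Ioi
    intro y hy
    have hy1 : (1:ℝ) < y := hy
    have hy0 : 0 < y := by linarith
    simp only [f, smul_eq_mul]
    rw [min_eq_right (Real.one_le_rpow hy1.le (by linarith)), hpow y hy0, one_div,
      ← Real.rpow_neg hy0.le, ← Real.rpow_add hy0]
    congr 1; ring

lemma measurable_sdf {n : ℕ} {u : En n → ℝ} (hu : Measurable u) (x : En n) :
    Measurable (sdf u x) := by
  unfold sdf; fun_prop

lemma sdf_div_integrable {n : ℕ} (hn : 1 ≤ n) {s : ℝ} (hs : s ∈ Set.Ioo (0:ℝ) 1)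
    {u : En n → ℝ} (hu : Measurable u) (x : En n) (C : ℝ) (h : ∀ y, |sdf u x y| ≤ C * kap s y) :
    Integrable (fun y : En n => sdf u x y / ‖y‖ ^ ((n : ℝ) + 2 * s)) := by
  refine ((kr_integrable n hn s hs).const_mul C).mono' ?_ ?_
  · exact ((measurable_sdf hu x).div (by fun_prop)).aestronglyMeasurable
  · refine Eventually.of_forall fun y => ?_
    rw [Real.norm_eq_abs, abs_div, abs_of_nonneg (by positivity : 0 ≤ ‖y‖ ^ ((n : ℝ) + 2 * s)),
      kr, ← mul_div_assoc]
    gcongr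
    exact h y

lemma hasDerivAt_line {n : ℕ} {u : En n → ℝ} {x v : En n} {t : ℝ}
    (h : DifferentiableAt ℝ u (x + t • v)) :
    HasDerivAt (fun t : ℝ => u (x + t • v)) (fderiv ℝ u (x + t • v) v) t := by
  have h1 : HasDerivAt (fun t : ℝ => x + t • v) v t := by
    simpa using ((hasDerivAt_id t).smul_const v).const_add x
  exact h.hasFDerivAt.comp_hasDerivAt t h1

lemma contDiffAt_fderiv {n : ℕ} {u : En n → ℝ} {x : En n} (h : ContDiffAt ℝ 2 u x) :
    ContDiffAt ℝ 1 (fderiv ℝ u) x := h.fderiv_right (by norm_num)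

lemma hasDerivAt_line2 {n : ℕ} {u : En n → ℝ} {x v : En n} {t : ℝ}
    (h : ContDiffAt ℝ 2 u (x + t • v)) :
    HasDerivAt (fun t : ℝ => fderiv ℝ u (x + t • v) v) (Hs u (x + t • v) v) t := by
  have h1 : HasDerivAt (fun t : ℝ => x + t • v) v t := by
    simpa using ((hasDerivAt_id t).smul_const v).const_add x
  have h2 : HasFDerivAt (fderiv ℝ u) (fderiv ℝ (fderiv ℝ u) (x + t • v)) (x + t • v) :=
    ((contDiffAt_fderiv h).differentiableAt (by norm_num)).hasFDerivAt
  have h3 := h2.comp_hasDerivAt t h1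
  have h4 := h3.clm_apply (hasDerivAt_const t v)
  simpa [Hs] using h4

lemma lap_eq_sum {n : ℕ} {u : En n → ℝ} {x : En n} (h : ContDiffAt ℝ 2 u x) :
    lap n u x = ∑ i : Fin n, Hs u x (EuclideanSpace.single i 1) := by
  unfold lap
  refine Finset.sum_congr rfl fun i _ => ?_
  have h2 : HasFDerivAt (fderiv ℝ u) (fderiv ℝ (fderiv ℝ u) x) x :=
    ((contDiffAt_fderiv h).differentiableAt (by norm_num)).hasFDerivAt
  have h4 := h2.clm_apply (hasFDerivAt_const (EuclideanSpace.single i (1:ℝ)) x)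
  rw [h4.fderiv]
  simp [Hs]

/-- compute the second derivative along a line -/
lemma Hs_eq_of_line {n : ℕ} {u : En n → ℝ} {x v : En n} (h : ContDiffAt ℝ 2 u x)
    {g1 : ℝ → ℝ} {g2 : ℝ} (h1 : ∀ᶠ t in 𝓝 (0:ℝ), HasDerivAt (fun t : ℝ => u (x + t • v)) (g1 t) t)
    (h2 : HasDerivAt g1 g2 0) : Hs u x v = g2 := by
  have hc : Tendsto (fun t : ℝ => x + t • v) (𝓝 0) (𝓝 x) := by
    have : Continuous (fun t : ℝ => x + t • v) := by fun_prop
    simpa using this.tendsto 0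
  have hd : ∀ᶠ z in 𝓝 x, ContDiffAt ℝ 2 u z := h.eventually (by simp)
  have h3 : g1 =ᶠ[𝓝 0] fun t : ℝ => fderiv ℝ u (x + t • v) v := by
    filter_upwards [h1, hc.eventually hd] with t ht hz
    exact ht.unique (hasDerivAt_line (hz.differentiableAt (by norm_num)))
  have h4 := hasDerivAt_line2 (t := 0) (v := v) (x := x) (u := u) (by simpa using h)
  have h5 := (h2.congr_of_eventuallyEq h3.symm).unique h4
  simpa using h5.symm

lemma sdf_le {n : ℕ} {u : En n → ℝ} {x y : En n} {B : ℝ}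
    (h : ∀ t ∈ Icc (-1:ℝ) 1, ContDiffAt ℝ 2 u (x + t • y))
    (hH : ∀ t ∈ Icc (-1:ℝ) 1, Hs u (x + t • y) y ≤ B) : sdf u x y ≤ B := by
  let g : ℝ → ℝ := fun t => u (x + t • y) - B / 2 * t ^ 2
  have hg1 : ∀ t ∈ Icc (-1:ℝ) 1, HasDerivAt g (fderiv ℝ u (x + t • y) y - B * t) t := by
    intro t ht
    have := (hasDerivAt_line ((h t ht).differentiableAt (by norm_num))).sub
      (((hasDerivAt_pow 2 t).const_mul (B / 2)))
    exact this.congr_deriv (by push_cast; ring)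
  have hcc : ConcaveOn ℝ (Icc (-1:ℝ) 1) g := by
    have hinter : interior (Icc (-1:ℝ) 1) = Ioo (-1) 1 := interior_Icc
    apply concaveOn_of_hasDerivWithinAt2_nonpos (convex_Icc _ _)
      (f' := fun t => fderiv ℝ u (x + t • y) y - B * t)
      (f'' := fun t => Hs u (x + t • y) y - B)
    · exact fun t ht => (hg1 t ht).continuousAt.continuousWithinAt
    · rw [hinter]; exact fun t ht => (hg1 t (Ioo_subset_Icc_self ht)).hasDerivWithinAt
    · rw [hinter]; intro t ht
      have := (hasDerivAt_line2 (h t (Ioo_subset_Icc_self ht))).sub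
        ((hasDerivAt_id t).const_mul B)
      exact (this.congr_deriv (by ring)).hasDerivWithinAt
    · rw [hinter]; intro t ht; simpa using hH t (Ioo_subset_Icc_self ht)
  have := hcc.2 (show (1:ℝ) ∈ Icc (-1:ℝ) 1 by simp) (show (-1:ℝ) ∈ Icc (-1:ℝ) 1 by simp)
    (show (0:ℝ) ≤ 1/2 by norm_num) (show (0:ℝ) ≤ 1/2 by norm_num) (by norm_num)
  simp [g] at this
  unfold sdf
  rw [sub_eq_add_neg x y]
  linarith

lemma sdf_neg {n : ℕ} (u : En n → ℝ) (x y : En n) : sdf (fun z => - u z) x y = - sdf u x y := by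
  unfold sdf; ring

lemma Hs_neg {n : ℕ} (u : En n → ℝ) (x y : En n) : Hs (fun z => - u z) x y = - Hs u x y := by
  have : fderiv ℝ (fun z => - u z) = fun z => - fderiv ℝ u z := by
    ext1 z; exact fderiv_fun_neg
  unfold Hs; rw [this, fderiv_fun_neg]; simp

lemma le_sdf {n : ℕ} {u : En n → ℝ} {x y : En n} {B : ℝ}
    (h : ∀ t ∈ Icc (-1:ℝ) 1, ContDiffAt ℝ 2 u (x + t • y))
    (hH : ∀ t ∈ Icc (-1:ℝ) 1, B ≤ Hs u (x + t • y) y) : B ≤ sdf u x y := by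
  have := sdf_le (u := fun z => - u z) (x := x) (y := y) (B := -B)
    (fun t ht => (h t ht).neg) (fun t ht => by rw [Hs_neg]; linarith [hH t ht])
  rw [sdf_neg] at this; linarith

lemma Hs_smul {n : ℕ} (u : En n → ℝ) (x y : En n) (c : ℝ) : Hs u x (c • y) = c ^ 2 * Hs u x y := by
  unfold Hs; simp; ring

lemma Hs_continuousAt {n : ℕ} {u : En n → ℝ} {x : En n} (h : ContDiffAt ℝ 2 u x) (v : En n) :
    ContinuousAt (fun z => Hs u z v) x := by
  have h1 : ContDiffAt ℝ 0 (fderiv ℝ (fderiv ℝ u)) x :=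
    (contDiffAt_fderiv h).fderiv_right (by norm_num)
  have h2 := h1.continuousAt
  unfold Hs
  fun_prop

lemma tendsto_sdf {n : ℕ} {u : En n → ℝ} {x : En n} (h : ContDiffAt ℝ 2 u x) (v : En n) :
    Tendsto (fun t : ℝ => sdf u x (t • v) / t ^ 2) (𝓝[>] 0) (𝓝 (Hs u x v)) := by
  rw [Metric.tendsto_nhds]
  intro ε hε
  have h1 := (Hs_continuousAt h v)
  have h2 : ∀ᶠ z in 𝓝 x, ContDiffAt ℝ 2 u z ∧ dist (Hs u z v) (Hs u x v) < ε / 2 :=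
    (h.eventually (by simp)).and (Metric.tendsto_nhds.1 h1 (ε / 2) (by linarith))
  obtain ⟨ρ, hρ, hb⟩ := Metric.eventually_nhds_iff.1 h2
  have h3 : ∀ᶠ t in 𝓝[>] (0:ℝ), t * ‖v‖ < ρ := by
    have : Tendsto (fun t : ℝ => t * ‖v‖) (𝓝 0) (𝓝 0) := by
      have : Continuous (fun t : ℝ => t * ‖v‖) := by fun_prop
      simpa using this.tendsto 0
    exact (this.mono_left nhdsWithin_le_nhds).eventually (gt_mem_nhds hρ)
  filter_upwards [h3, self_mem_nhdsWithin] with t ht ht0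
  have ht0 : 0 < t := ht0
  have hn : ∀ r ∈ Icc (-1:ℝ) 1, dist (x + r • t • v) x < ρ := by
    intro r hr
    rw [dist_eq_norm, add_sub_cancel_left, norm_smul, norm_smul, Real.norm_eq_abs, Real.norm_eq_abs,
      abs_of_pos ht0]
    have : |r| ≤ 1 := abs_le.2 hr
    have h0 : 0 ≤ t * ‖v‖ := by positivity
    nlinarith
  have hup : sdf u x (t • v) ≤ t ^ 2 * (Hs u x v + ε / 2) := by
    apply sdf_le
    · exact fun r hr => (hb (hn r hr)).1
    · intro r hr
      rw [Hs_smul]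
      have := (hb (hn r hr)).2
      rw [Real.dist_eq, abs_lt] at this
      gcongr; linarith
  have hlo : t ^ 2 * (Hs u x v - ε / 2) ≤ sdf u x (t • v) := by
    apply le_sdf
    · exact fun r hr => (hb (hn r hr)).1
    · intro r hr
      rw [Hs_smul]
      have := (hb (hn r hr)).2
      rw [Real.dist_eq, abs_lt] at this
      gcongr; linarith
  rw [Real.dist_eq, abs_lt]
  have hp : 0 < t ^ 2 := by positivity
  constructor
  · rw [lt_sub_iff_add_lt, lt_div_iff₀ hp]; nlinarith
  · rw [sub_lt_iff_lt_add, div_lt_iff₀ hp]; nlinarith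

lemma Hs_le_of_sdf {n : ℕ} {u f : En n → ℝ} {x : En n} (hu : ContDiffAt ℝ 2 u x)
    (hf : ContDiffAt ℝ 2 f x) (h : ∀ᶠ y in 𝓝 (0 : En n), sdf u x y ≤ sdf f x y) (v : En n) :
    Hs u x v ≤ Hs f x v := by
  refine le_of_tendsto_of_tendsto (tendsto_sdf hu v) (tendsto_sdf hf v) ?_
  have : Tendsto (fun t : ℝ => t • v) (𝓝[>] 0) (𝓝 0) := by
    have : Continuous (fun t : ℝ => t • v) := by fun_prop
    simpa using (this.tendsto 0).mono_left (nhdsWithin_le_nhds (s := Ioi 0))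
  filter_upwards [this.eventually h] with t ht
  gcongr

lemma lap_le_of_sdf {n : ℕ} {u f : En n → ℝ} {x : En n} (hu : ContDiffAt ℝ 2 u x)
    (hf : ContDiffAt ℝ 2 f x) (h : ∀ᶠ y in 𝓝 (0 : En n), sdf u x y ≤ sdf f x y) :
    lap n u x ≤ lap n f x := by
  rw [lap_eq_sum hu, lap_eq_sum hf]
  exact Finset.sum_le_sum fun i _ => Hs_le_of_sdf hu hf h _

lemma Hs_comp {n : ℕ} {q : En n → ℝ} {x : En n} (hq : ContDiffAt ℝ 2 q x) {Θ Θ1 : ℝ → ℝ} {Θ2 : ℝ}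
    (hc : ContDiffAt ℝ 2 Θ (q x))
    (h1 : ∀ᶠ t in 𝓝 (q x), HasDerivAt Θ (Θ1 t) t) (h2 : HasDerivAt Θ1 Θ2 (q x)) (v : En n) :
    Hs (fun z => Θ (q z)) x v = Θ2 * (fderiv ℝ q x v) ^ 2 + Θ1 (q x) * Hs q x v := by
  have hc0 : Tendsto (fun t : ℝ => x + t • v) (𝓝 0) (𝓝 x) := by
    have : Continuous (fun t : ℝ => x + t • v) := by fun_prop
    simpa using this.tendsto 0
  have hd : ∀ᶠ z in 𝓝 x, ContDiffAt ℝ 2 q z := hq.eventually (by simp)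
  refine Hs_eq_of_line (g1 := fun t => Θ1 (q (x + t • v)) * fderiv ℝ q (x + t • v) v) ?_ ?_ ?_
  · exact hc.comp x hq
  · filter_upwards [hc0.eventually hd, hc0.eventually (hq.continuousAt.eventually h1)] with t a b
    exact b.comp t (hasDerivAt_line (a.differentiableAt (by norm_num)))
  · have e1 := hasDerivAt_line2 (t := 0) (v := v) (x := x) (u := q) (by simpa using hq)
    have e2 := hasDerivAt_line (t := 0) (v := v) (x := x) (u := q)
      (by simpa using hq.differentiableAt (by norm_num))
    have e3 : HasDerivAt (fun t : ℝ => Θ1 (q (x + t • v))) (Θ2 * fderiv ℝ q (x + (0:ℝ) • v) v) 0 := by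
      have h2' : HasDerivAt Θ1 Θ2 (q (x + (0:ℝ) • v)) := by simpa using h2
      exact h2'.comp (0:ℝ) e2
    have e4 := e3.mul e1
    exact e4.congr_deriv (by simp; ring)

lemma Hs_mul {n : ℕ} {f g : En n → ℝ} {x : En n} (hf : ContDiffAt ℝ 2 f x)
    (hg : ContDiffAt ℝ 2 g x) (v : En n) :
    Hs (fun z => f z * g z) x v =
      Hs f x v * g x + 2 * (fderiv ℝ f x v * fderiv ℝ g x v) + f x * Hs g x v := by
  have hc0 : Tendsto (fun t : ℝ => x + t • v) (𝓝 0) (𝓝 x) := by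
    have : Continuous (fun t : ℝ => x + t • v) := by fun_prop
    simpa using this.tendsto 0
  have hdf : ∀ᶠ z in 𝓝 x, ContDiffAt ℝ 2 f z := hf.eventually (by simp)
  have hdg : ∀ᶠ z in 𝓝 x, ContDiffAt ℝ 2 g z := hg.eventually (by simp)
  refine Hs_eq_of_line (g1 := fun t => fderiv ℝ f (x + t • v) v * g (x + t • v) +
    f (x + t • v) * fderiv ℝ g (x + t • v) v) ?_ ?_ ?_
  · exact hf.mul hg
  · filter_upwards [hc0.eventually hdf, hc0.eventually hdg] with t a b
    exact (hasDerivAt_line (a.differentiableAt (by norm_num))).mul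
      (hasDerivAt_line (b.differentiableAt (by norm_num)))
  · have e1 := hasDerivAt_line2 (t := 0) (v := v) (x := x) (u := f) (by simpa using hf)
    have e2 := hasDerivAt_line (t := 0) (v := v) (x := x) (u := f)
      (by simpa using hf.differentiableAt (by norm_num))
    have e3 := hasDerivAt_line2 (t := 0) (v := v) (x := x) (u := g) (by simpa using hg)
    have e4 := hasDerivAt_line (t := 0) (v := v) (x := x) (u := g)
      (by simpa using hg.differentiableAt (by norm_num))
    have := (e1.mul e4).add (e2.mul e3)
    exact this.congr_deriv (by simp; ring)

lemma Hs_add {n : ℕ} {f g : En n → ℝ} {x : En n} (hf : ContDiffAt ℝ 2 f x)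
    (hg : ContDiffAt ℝ 2 g x) (v : En n) :
    Hs (fun z => f z + g z) x v = Hs f x v + Hs g x v := by
  have hc0 : Tendsto (fun t : ℝ => x + t • v) (𝓝 0) (𝓝 x) := by
    have : Continuous (fun t : ℝ => x + t • v) := by fun_prop
    simpa using this.tendsto 0
  have hdf : ∀ᶠ z in 𝓝 x, ContDiffAt ℝ 2 f z := hf.eventually (by simp)
  have hdg : ∀ᶠ z in 𝓝 x, ContDiffAt ℝ 2 g z := hg.eventually (by simp)
  refine Hs_eq_of_line (g1 := fun t => fderiv ℝ f (x + t • v) v + fderiv ℝ g (x + t • v) v) ?_ ?_ ?_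
  · exact hf.add hg
  · filter_upwards [hc0.eventually hdf, hc0.eventually hdg] with t a b
    exact (hasDerivAt_line (a.differentiableAt (by norm_num))).add
      (hasDerivAt_line (b.differentiableAt (by norm_num)))
  · have e1 := hasDerivAt_line2 (t := 0) (v := v) (x := x) (u := f) (by simpa using hf)
    have e3 := hasDerivAt_line2 (t := 0) (v := v) (x := x) (u := g) (by simpa using hg)
    have := e1.add e3
    exact this.congr_deriv (by simp)

lemma Hs_const_mul {n : ℕ} {f : En n → ℝ} {x : En n} (hf : ContDiffAt ℝ 2 f x) (c : ℝ) (v : En n) :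
    Hs (fun z => c * f z) x v = c * Hs f x v := by
  have := Hs_mul (f := fun _ => c) (g := f) (x := x) contDiffAt_const hf v
  rw [this]
  have h0 : Hs (fun _ : En n => c) x v = 0 := by unfold Hs; simp
  simp [h0]

lemma lap_sub {n : ℕ} {f g : En n → ℝ} {x : En n} (hf : ContDiffAt ℝ 2 f x)
    (hg : ContDiffAt ℝ 2 g x) :
    lap n (fun z => f z - g z) x = lap n f x - lap n g x := by
  have hng : ContDiffAt ℝ 2 (fun z => - g z) x := hg.neg
  have e : (fun z => f z - g z) = fun z => f z + (fun z => - g z) z := by ext; ring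
  rw [e, lap_eq_sum (hf.add hng), lap_eq_sum hf, lap_eq_sum hg, ← Finset.sum_sub_distrib]
  refine Finset.sum_congr rfl fun i _ => ?_
  rw [Hs_add hf hng, Hs_neg]; ring

lemma lap_neg {n : ℕ} {f : En n → ℝ} {x : En n} (hf : ContDiffAt ℝ 2 f x) :
    lap n (fun z => - f z) x = - lap n f x := by
  rw [lap_eq_sum hf.neg, lap_eq_sum hf, ← Finset.sum_neg_distrib]
  exact Finset.sum_congr rfl fun i _ => Hs_neg _ _ _

lemma lap_const_mul {n : ℕ} {f : En n → ℝ} {x : En n} (hf : ContDiffAt ℝ 2 f x) (c : ℝ) :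
    lap n (fun z => c * f z) x = c * lap n f x := by
  rw [lap_eq_sum (contDiffAt_const.mul hf), lap_eq_sum hf, Finset.mul_sum]
  exact Finset.sum_congr rfl fun i _ => Hs_const_mul hf _ _

lemma abs_Hs_le {n : ℕ} (u : En n → ℝ) (x v : En n) :
    |Hs u x v| ≤ ‖fderiv ℝ (fderiv ℝ u) x‖ * ‖v‖ ^ 2 := by
  unfold Hs
  rw [← Real.norm_eq_abs]
  calc _ ≤ ‖fderiv ℝ (fderiv ℝ u) x v‖ * ‖v‖ := ContinuousLinearMap.le_opNorm _ _
    _ ≤ (‖fderiv ℝ (fderiv ℝ u) x‖ * ‖v‖) * ‖v‖ := by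
        gcongr; exact ContinuousLinearMap.le_opNorm _ _
    _ = _ := by ring

/-- Packed quantitative data of the domain `{τ > 0}`. -/
structure Dom (n : ℕ) where
  τ : En n → ℝ
  smooth : ContDiff ℝ 2 τ
  R : ℝ
  K : ℝ
  c0 : ℝ
  t0 : ℝ
  hR : 1 ≤ R
  hK : 1 ≤ K
  hc0 : 0 < c0
  ht0 : 0 < t0
  mem_ball : ∀ x, 0 < τ x → ‖x‖ < R
  le_one : ∀ x, τ x ≤ 1
  d1 : ∀ x, ‖x‖ ≤ R + 10 → ‖fderiv ℝ τ x‖ ≤ K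
  d2 : ∀ x, ‖x‖ ≤ R + 10 → ‖fderiv ℝ (fderiv ℝ τ) x‖ ≤ K
  lip : ∀ x y, |max (τ x) 0 - max (τ y) 0| ≤ K * ‖x - y‖
  grad : ∀ x, 0 < τ x → τ x < t0 → c0 ≤ ‖fderiv ℝ τ x‖
  proj : ∀ x, 0 < τ x → τ x < t0 → ∃ z, τ z = 0 ∧ ‖x - z‖ ≤ 2 / c0 * τ x

def Dom.Ω {n : ℕ} (D : Dom n) : Set (En n) := {x | 0 < D.τ x}

lemma taylor1 {n : ℕ} {τ : En n → ℝ} (hs : ContDiff ℝ 2 τ) {r K : ℝ}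
    (h2 : ∀ x, ‖x‖ ≤ r → ‖fderiv ℝ (fderiv ℝ τ) x‖ ≤ K) {x y : En n} (hx : ‖x‖ ≤ r) (hy : ‖y‖ ≤ r) :
    ‖fderiv ℝ τ y - fderiv ℝ τ x‖ ≤ K * ‖y - x‖ := by
  refine Convex.norm_image_sub_le_of_norm_fderiv_le (𝕜 := ℝ) (s := closedBall 0 r) ?_ ?_
    (convex_closedBall _ _) (by simpa using hx) (by simpa using hy)
  · intro z _
    exact (contDiffAt_fderiv hs.contDiffAt).differentiableAt (by norm_num)
  · intro z hz; exact h2 z (by simpa using hz)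

lemma taylor2 {n : ℕ} {τ : En n → ℝ} (hs : ContDiff ℝ 2 τ) {r K : ℝ} (hK : 0 ≤ K)
    (h2 : ∀ x, ‖x‖ ≤ r → ‖fderiv ℝ (fderiv ℝ τ) x‖ ≤ K) {x y : En n} (hx : ‖x‖ ≤ r) (hy : ‖y‖ ≤ r) :
    |τ y - τ x - fderiv ℝ τ x (y - x)| ≤ K * ‖y - x‖ ^ 2 := by
  have := Convex.norm_image_sub_le_of_norm_fderiv_le' (𝕜 := ℝ) (f := τ) (φ := fderiv ℝ τ x)
    (C := K * ‖y - x‖) (s := segment ℝ x y) (x := x) (y := y) ?_ ?_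
    (convex_segment _ _) (left_mem_segment _ _ _) (right_mem_segment _ _ _)
  · rw [← Real.norm_eq_abs]
    linarith
  · intro z _; exact hs.differentiable (by norm_num) z
  · intro z hz
    have hzr : ‖z‖ ≤ r := by
      have := (convex_closedBall (0 : En n) r).segment_subset (x := x) (y := y)
        (by simpa using hx) (by simpa using hy) hz
      simpa using this
    refine (taylor1 hs h2 hx hzr).trans ?_
    gcongr
    obtain ⟨t, ht, rfl⟩ := (segment_eq_image' ℝ x y ▸ hz :)
    simp only [add_sub_cancel_left, norm_smul, Real.norm_eq_abs, abs_of_nonneg ht.1]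
    exact mul_le_of_le_one_left (norm_nonneg _) ht.2

lemma exists_dom {n : ℕ} (D : C2Domain n) : ∃ (E : Dom n) (κ : ℝ), 0 < κ ∧ 
    E.τ = (fun x => - κ * D.phi x) ∧ E.Ω = D.carrier := by
  have hcomp : IsCompact (closure D.carrier) := D.bounded.isCompact_closure
  have hop : IsOpen D.carrier := by
    rw [D.carrier_eq]; exact isOpen_lt D.phi_smooth.continuous continuous_const
  obtain ⟨M, hM⟩ := hcomp.exists_bound_of_continuousOn D.phi_smooth.continuous.continuousOn
  obtain ⟨R0, hR0⟩ := D.bounded.subset_ball 0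
  set R := max R0 1
  have hR : 1 ≤ R := le_max_right _ _
  have hM' : ∀ x ∈ D.carrier, |D.phi x| ≤ |M| + 1 := fun x hx => by
    have := hM x (subset_closure hx)
    rw [Real.norm_eq_abs] at this
    linarith [le_abs_self M]
  set κ := 1 / (|M| + 1)
  have hκ : 0 < κ := by positivity
  set τ : En n → ℝ := fun x => - κ * D.phi x with hτ
  have hs : ContDiff ℝ 2 τ := contDiff_const.mul D.phi_smooth
  have hmem : ∀ x, 0 < τ x ↔ x ∈ D.carrier := by
    intro x; rw [D.carrier_eq]; simp only [hτ, mem_ofPred_eq]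
    constructor <;> intro h <;> nlinarith
  have hle : ∀ x, τ x ≤ 1 := by
    intro x
    by_cases hx : 0 < τ x
    · have := hM' x ((hmem x).1 hx)
      have h3 : τ x ≤ κ * (|M| + 1) := by
        simp only [hτ]; nlinarith [neg_abs_le (D.phi x)]
      have : κ * (|M| + 1) = 1 := by simp only [κ]; field_simp
      linarith
    · linarith
  have hball : ∀ x, 0 < τ x → ‖x‖ < R := fun x hx => by
    have := hR0 ((hmem x).1 hx)
    simp at this; exact lt_of_lt_of_le this (le_max_left _ _)
  have cc : IsCompact (closedBall (0 : En n) (R + 10)) := isCompact_closedBall _ _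
  have cd1 : Continuous (fderiv ℝ τ) := hs.continuous_fderiv (by norm_num)
  have cd2 : Continuous (fderiv ℝ (fderiv ℝ τ)) :=
    (hs.fderiv_right (m := 1) (by norm_num)).continuous_fderiv (by norm_num)
  obtain ⟨K1, hK1⟩ := cc.exists_bound_of_continuousOn cd1.continuousOn
  obtain ⟨K2, hK2⟩ := cc.exists_bound_of_continuousOn (f := fun x => ‖fderiv ℝ (fderiv ℝ τ) x‖) (Continuous.norm (E := En n →L[ℝ] En n →L[ℝ] ℝ) cd2).continuousOn
  set K := max (max K1 K2) 1
  have hK : 1 ≤ K := le_max_right _ _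
  have hd1 : ∀ x, ‖x‖ ≤ R + 10 → ‖fderiv ℝ τ x‖ ≤ K := fun x hx =>
    (hK1 x (by simpa using hx)).trans ((le_max_left _ _).trans (le_max_left _ _))
  have hd2 : ∀ x, ‖x‖ ≤ R + 10 → ‖fderiv ℝ (fderiv ℝ τ) x‖ ≤ K := fun x hx =>
    ((le_abs_self _).trans (hK2 x (by simpa using hx))).trans ((le_max_right _ _).trans (le_max_left _ _))
  have hlip0 : ∀ x y, ‖x‖ ≤ R + 10 → ‖y‖ ≤ R + 10 → |τ x - τ y| ≤ K * ‖x - y‖ := by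
    intro x y hx hy
    exact Convex.norm_image_sub_le_of_norm_fderiv_le (𝕜 := ℝ) (s := closedBall 0 (R + 10))
      (fun z _ => hs.differentiable (by norm_num) z) (fun z hz => hd1 z (by simpa using hz))
      (convex_closedBall _ _) (by simpa using hy) (by simpa using hx)
  have hlip1 : ∀ x y, 0 < τ x → max (τ x) 0 - max (τ y) 0 ≤ K * ‖x - y‖ := by
    intro x y hx
    have hxb := hball x hx
    rw [max_eq_left hx.le]
    by_cases hy : ‖y‖ ≤ R + 10
    · have := hlip0 x y (by linarith) hy
      linarith [le_abs_self (τ x - τ y), le_max_left (τ y) 0]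
    · have h1 : 1 ≤ ‖x - y‖ := by
        have := norm_sub_norm_le y x
        rw [norm_sub_rev] at this
        push Not at hy; linarith
      have := hle x
      nlinarith [le_max_right (τ y) 0]
  have hlip2 : ∀ x y, max (τ x) 0 - max (τ y) 0 ≤ K * ‖x - y‖ := by
    intro x y
    by_cases hx : 0 < τ x
    · exact hlip1 x y hx
    · rw [max_eq_right (not_lt.1 hx)]
      have : 0 ≤ K * ‖x - y‖ := by positivity
      linarith [le_max_right (τ y) 0]
  have hlip : ∀ x y, |max (τ x) 0 - max (τ y) 0| ≤ K * ‖x - y‖ := by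
    intro x y
    rw [abs_le]; constructor
    · have := hlip2 y x; rw [norm_sub_rev] at this; linarith
    · exact hlip2 x y
  -- gradient
  have hcl0 : ∀ x ∈ closure D.carrier, 0 ≤ τ x := by
    intro x hx
    have : closure D.carrier ⊆ {x | 0 ≤ τ x} :=
      closure_minimal (fun x hx => ((hmem x).2 hx).le) (isClosed_le continuous_const hs.continuous)
    exact this hx
  have hpos : ∀ x ∈ closure D.carrier, 0 < max (τ x) ‖fderiv ℝ τ x‖ := by
    intro x hx
    by_cases hx0 : 0 < τ x
    · exact lt_max_of_lt_left hx0
    · refine lt_max_of_lt_right (norm_pos_iff.2 fun h0 => ?_)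
      have hxf : x ∈ frontier D.carrier := by
        rw [hop.frontier_eq]
        exact ⟨hx, fun h => hx0 ((hmem x).2 h)⟩
      apply D.grad_ne x hxf
      have : fderiv ℝ τ x = (-κ) • fderiv ℝ D.phi x := by
        simp only [hτ]
        exact fderiv_const_mul (D.phi_smooth.differentiable (by norm_num) x) _
      rw [this] at h0
      have h1 : fderiv ℝ D.phi x = 0 := by
        rcases smul_eq_zero.1 h0 with h | h
        · linarith
        · exact h
      simp [gradient, h1]
  obtain ⟨x1, hx1, hmin⟩ := hcomp.exists_isMinOn (D.connected.nonempty.closure)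
    (f := fun x => max (τ x) ‖fderiv ℝ τ x‖)
    ((hs.continuous.max cd1.norm).continuousOn)
  set c0 := max (τ x1) ‖fderiv ℝ τ x1‖
  have hc0 : 0 < c0 := hpos x1 hx1
  have hgrad : ∀ x, 0 < τ x → τ x < c0 → c0 ≤ ‖fderiv ℝ τ x‖ := by
    intro x hx hxc
    have : c0 ≤ max (τ x) ‖fderiv ℝ τ x‖ := hmin (subset_closure ((hmem x).1 hx))
    rcases le_max_iff.1 this with h | h
    · linarith
    · exact h
  set t0 := min (min c0 (c0 ^ 2 / (4 * K))) c0
  have ht0 : 0 < t0 := by positivity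
  refine ⟨⟨τ, hs, R, K, c0, t0, hR, hK, hc0, ht0, hball, hle, hd1, hd2, hlip, 
    fun x hx hxt => hgrad x hx (lt_of_lt_of_le hxt (min_le_right _ _)), ?_⟩, κ, hκ, rfl, ?_⟩
  · intro x hx hxt
    have hg := hgrad x hx (lt_of_lt_of_le hxt (min_le_right _ _))
    have hxt2 : τ x < c0 ^ 2 / (4 * K) := lt_of_lt_of_le hxt ((min_le_left _ _).trans (min_le_right _ _))
    have hxt3 : τ x < c0 := lt_of_lt_of_le hxt (min_le_right _ _)
    set g := gradient τ x
    have hgn : ‖g‖ = ‖fderiv ℝ τ x‖ := by simp [g, gradient]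
    have hgp : 0 < ‖g‖ := by rw [hgn]; linarith
    have hgg : fderiv ℝ τ x g = ‖g‖ ^ 2 := by
      have : fderiv ℝ τ x g = inner ℝ g g := by
        simp only [g, gradient]
        rw [InnerProductSpace.toDual_symm_apply]
      rw [this, real_inner_self_eq_norm_sq]
    set T := 2 / c0 * τ x
    have hT : 0 < T := by positivity
    set v := (-(T / ‖g‖)) • g
    have hv : ‖v‖ = T := by
      simp only [v, norm_smul, norm_neg, norm_div, Real.norm_eq_abs, abs_of_pos hT, abs_of_pos hgp]
      field_simp
    have hT2 : T ≤ 2 := by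
      simp only [T]; rw [div_mul_eq_mul_div, div_le_iff₀ hc0]; linarith
    have hxb := hball x hx
    have h1 := taylor2 hs (by linarith) hd2 (x := x) (y := x + v) (by linarith)
      (by have := norm_add_le x v; linarith)
    rw [add_sub_cancel_left, hv] at h1
    have h2 : fderiv ℝ τ x v = - (T * ‖g‖) := by
      simp only [v, map_smul, hgg, smul_eq_mul]; field_simp
    rw [h2] at h1
    have h3 : K * T ^ 2 ≤ τ x := by
      have e : K * T ^ 2 = (K * 4 * τ x / c0 ^ 2) * τ x := by simp only [T]; field_simp; ring
      rw [e]
      apply mul_le_of_le_one_left hx.le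
      rw [div_le_one (by positivity)]
      rw [lt_div_iff₀ (by positivity)] at hxt2
      linarith
    have h4 : 2 * τ x ≤ T * ‖g‖ := by
      have : T * c0 ≤ T * ‖g‖ := by rw [hgn]; gcongr
      have e : T * c0 = 2 * τ x := by simp only [T]; field_simp
      linarith
    have h5 : τ (x + v) ≤ 0 := by linarith [le_abs_self (τ (x + v) - τ x - -(T * ‖g‖))]
    have hcont : ContinuousOn (fun t : ℝ => τ (x + t • v)) (Icc 0 1) := by
      have := hs.continuous
      fun_prop
    have := intermediate_value_Icc' (zero_le_one) hcont
    obtain ⟨t, ht, ht0⟩ := this (show (0:ℝ) ∈ _ by simp; exact ⟨h5, hx.le⟩)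
    refine ⟨x + t • v, ht0, ?_⟩
    rw [sub_add_cancel_left, norm_neg, norm_smul, hv, Real.norm_eq_abs, abs_of_nonneg ht.1]
    exact mul_le_of_le_one_left hT.le ht.2
  · ext x; exact hmem x

/-- functions for which the operator at `x` makes sense -/
structure Nice {n : ℕ} (f : En n → ℝ) (x : En n) : Prop where
  c2 : ContDiffAt ℝ 2 f x
  meas : Measurable f
  bdd : ∃ M, ∀ z, |f z| ≤ M

lemma kap_ge {n : ℕ} {s ρ : ℝ} (hs : 0 < s) (hρ : 0 < ρ) (hρ1 : ρ ≤ 1) {y : En n} (hy : ρ ≤ ‖y‖) :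
    ρ ^ (1 + s) ≤ kap s y := by
  unfold kap
  refine le_min ?_ (Real.rpow_le_one hρ.le hρ1 (by linarith))
  exact Real.rpow_le_rpow hρ.le hy (by linarith)

lemma sq_le_kap {n : ℕ} {s : ℝ} (hs : s ∈ Ioo (0:ℝ) 1) {y : En n} (hy : ‖y‖ ≤ 1) :
    ‖y‖ ^ 2 ≤ kap s y := by
  unfold kap
  refine le_min ?_ (pow_le_one₀ (norm_nonneg _) hy)
  rcases (norm_nonneg y).eq_or_lt with h | h
  · rw [← h]; simp; positivity
  · rw [← Real.rpow_natCast]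
    exact Real.rpow_le_rpow_of_exponent_ge h hy (by push_cast; linarith [hs.2])

lemma kap_of_one_le {n : ℕ} {s : ℝ} (hs : 0 < s) {y : En n} (hy : 1 ≤ ‖y‖) : kap s y = 1 := by
  unfold kap; exact min_eq_right (Real.one_le_rpow hy (by linarith))

lemma abs_sdf_le4 {n : ℕ} {f : En n → ℝ} {M : ℝ} (h : ∀ z, |f z| ≤ M) (x y : En n) :
    |sdf f x y| ≤ 4 * M := by
  have h1 := abs_le.1 (h (x + y)); have h2 := abs_le.1 (h (x - y)); have h3 := abs_le.1 (h x)
  unfold sdf; rw [abs_le]; constructor <;> linarith [h1.1, h1.2]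

/-- quantitative version: C² bound on a ball plus boundedness -/
lemma sdf_bound_ball {n : ℕ} {f : En n → ℝ} {x : En n} {s ρ M B : ℝ} (hs : s ∈ Ioo (0:ℝ) 1)
    (hρ : 0 < ρ) (hρ1 : ρ ≤ 1) (hM : ∀ z, |f z| ≤ M)
    (hc : ∀ z ∈ ball x ρ, ContDiffAt ℝ 2 f z)
    (hB : ∀ z ∈ ball x ρ, ∀ v, |Hs f z v| ≤ B * ‖v‖ ^ 2) (y : En n) :
    |sdf f x y| ≤ (B + 4 * M / ρ ^ (1 + s)) * kap s y := by
  have hM0 : 0 ≤ M := (abs_nonneg _).trans (hM x)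
  have hk := kap_nonneg s y
  have hp : 0 < ρ ^ (1 + s) := by positivity
  have hB0 : 0 ≤ B * ‖y‖ ^ 2 := (abs_nonneg _).trans (hB x (mem_ball_self hρ) y)
  rcases lt_or_ge ‖y‖ ρ with hy | hy
  · have hz : ∀ t ∈ Icc (-1:ℝ) 1, x + t • y ∈ ball x ρ := by
      intro t ht
      rw [mem_ball, dist_eq_norm, add_sub_cancel_left, norm_smul, Real.norm_eq_abs]
      exact lt_of_le_of_lt (mul_le_of_le_one_left (norm_nonneg _) (abs_le.2 ht)) hy
    have h1 := sdf_le (fun t ht => hc _ (hz t ht)) (fun t ht => (abs_le.1 (hB _ (hz t ht) y)).2)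
    have h2 := le_sdf (fun t ht => hc _ (hz t ht)) (fun t ht => (abs_le.1 (hB _ (hz t ht) y)).1)
    have h3 : |sdf f x y| ≤ B * ‖y‖ ^ 2 := abs_le.2 ⟨h2, h1⟩
    have h4 := sq_le_kap hs (hy.le.trans hρ1)
    have h5 : 0 ≤ 4 * M / ρ ^ (1 + s) * kap s y := by positivity
    have h6 : B * ‖y‖ ^ 2 ≤ B * kap s y := by
      rcases eq_or_ne y 0 with h0 | h0
      · simp [h0, kap, Real.zero_rpow (by linarith [hs.1] : 1 + s ≠ 0)]
      · have : 0 ≤ B := by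
          by_contra hb
          have : 0 < ‖y‖ ^ 2 := by positivity
          nlinarith
        gcongr
    rw [add_mul]; linarith
  · have h1 := abs_sdf_le4 hM x y
    have h2 := kap_ge hs.1 hρ hρ1 hy
    have h3 : 4 * M ≤ 4 * M / ρ ^ (1 + s) * kap s y := by
      rw [div_mul_eq_mul_div, le_div_iff₀ hp]; gcongr
    have h4 : 0 ≤ B * kap s y := by
      have hy0 : 0 < ‖y‖ ^ 2 := by have : 0 < ‖y‖ := by linarith
                                   positivity
      have : 0 ≤ B := by
        by_contra hb
        nlinarith
      positivity
    rw [add_mul]; linarith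

lemma Nice.sdf_bound {n : ℕ} {f : En n → ℝ} {x : En n} (h : Nice f x) {s : ℝ}
    (hs : s ∈ Ioo (0:ℝ) 1) : ∃ C, ∀ y, |sdf f x y| ≤ C * kap s y := by
  obtain ⟨M, hM⟩ := h.bdd
  have h1 : ContDiffAt ℝ 0 (fderiv ℝ (fderiv ℝ f)) x :=
    (contDiffAt_fderiv h.c2).fderiv_right (by norm_num)
  have h2 : ∀ᶠ z in 𝓝 x, ‖fderiv ℝ (fderiv ℝ f) z‖ < ‖fderiv ℝ (fderiv ℝ f) x‖ + 1 :=
    (ContinuousAt.norm (E := En n →L[ℝ] En n →L[ℝ] ℝ) h1.continuousAt).eventually (gt_mem_nhds (by linarith))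
  obtain ⟨ρ, hρ, hb⟩ := Metric.eventually_nhds_iff.1 (h2.and (h.c2.eventually (by simp)))
  refine ⟨_, fun y => sdf_bound_ball (ρ := min ρ 1) (B := ‖fderiv ℝ (fderiv ℝ f) x‖ + 1) hs
    (by positivity) (min_le_right _ _) hM ?_ ?_ y⟩
  · intro z hz
    exact (hb (lt_of_lt_of_le hz (min_le_left _ _))).2
  · intro z hz v
    refine (abs_Hs_le f z v).trans ?_
    gcongr
    exact (hb (lt_of_lt_of_le hz (min_le_left _ _))).1.le

lemma Nice.integrable {n : ℕ} {f : En n → ℝ} {x : En n} (h : Nice f x) (hn : 1 ≤ n) {s : ℝ}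
    (hs : s ∈ Ioo (0:ℝ) 1) :
    Integrable (fun y : En n => sdf f x y / ‖y‖ ^ ((n : ℝ) + 2 * s)) := by
  obtain ⟨C, hC⟩ := h.sdf_bound hs
  exact sdf_div_integrable hn hs h.meas x C hC

lemma fracLap_le_of_sdf {n : ℕ} {f g : En n → ℝ} {x : En n} (hf : Nice f x) (hg : Nice g x)
    (hn : 1 ≤ n) {s : ℝ} (hs : s ∈ Ioo (0:ℝ) 1) (h : ∀ y, sdf f x y ≤ sdf g x y) :
    fracLap n s g x ≤ fracLap n s f x := by
  rw [fracLap_eq, fracLap_eq]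
  have hc := cK_pos n s hs
  have := integral_mono (hf.integrable hn hs) (hg.integrable hn hs) (fun y => by
    dsimp only; gcongr; exact h y)
  nlinarith

/-- the total mass of the kernel `kr` times `cK/2` -/
def IK (n : ℕ) (s : ℝ) : ℝ := cK n s / 2 * ∫ y, kr n s y

lemma IK_nonneg {n : ℕ} {s : ℝ} (hs : s ∈ Ioo (0:ℝ) 1) : 0 ≤ IK n s := by
  have := cK_pos n s hs
  have h2 : 0 ≤ ∫ y, kr n s y := integral_nonneg (kr_nonneg n s)
  unfold IK; positivity

lemma fracLap_ge_of_sdf_le {n : ℕ} {f : En n → ℝ} {x : En n} (hf : Nice f x)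
    (hn : 1 ≤ n) {s : ℝ} (hs : s ∈ Ioo (0:ℝ) 1) {C : ℝ} (h : ∀ y, sdf f x y ≤ C * kap s y) :
    - (C * IK n s) ≤ fracLap n s f x := by
  rw [fracLap_eq]
  have hc := cK_pos n s hs
  have := integral_mono (hf.integrable hn hs) ((kr_integrable n hn s hs).const_mul C) (fun y => by
    simp only [kr]; rw [← mul_div_assoc]; gcongr; exact h y)
  rw [integral_const_mul] at this
  unfold IK
  nlinarith

lemma fracLap_le_of_le_sdf {n : ℕ} {f : En n → ℝ} {x : En n} (hf : Nice f x)
    (hn : 1 ≤ n) {s : ℝ} (hs : s ∈ Ioo (0:ℝ) 1) {C : ℝ} (h : ∀ y, - (C * kap s y) ≤ sdf f x y) :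
    fracLap n s f x ≤ C * IK n s := by
  rw [fracLap_eq]
  have hc := cK_pos n s hs
  have := integral_mono ((kr_integrable n hn s hs).const_mul (-C)) (hf.integrable hn hs) (fun y => by
    simp only [kr]; rw [← mul_div_assoc]; gcongr; linarith [h y])
  rw [integral_const_mul] at this
  unfold IK
  nlinarith

lemma Nice.neg {n : ℕ} {f : En n → ℝ} {x : En n} (h : Nice f x) : Nice (fun z => - f z) x :=
  ⟨h.c2.neg, h.meas.neg, by obtain ⟨M, hM⟩ := h.bdd; exact ⟨M, fun z => by simpa using hM z⟩⟩

lemma Nice.const_mul {n : ℕ} {f : En n → ℝ} {x : En n} (h : Nice f x) (c : ℝ) :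
    Nice (fun z => c * f z) x :=
  ⟨contDiffAt_const.mul h.c2, h.meas.const_mul c, by
    obtain ⟨M, hM⟩ := h.bdd
    exact ⟨|c| * M, fun z => by rw [abs_mul]; gcongr; exact hM z⟩⟩

lemma Nice.add {n : ℕ} {f g : En n → ℝ} {x : En n} (h : Nice f x) (hg : Nice g x) :
    Nice (fun z => f z + g z) x :=
  ⟨h.c2.add hg.c2, h.meas.add hg.meas, by
    obtain ⟨M, hM⟩ := h.bdd; obtain ⟨N, hN⟩ := hg.bdd
    exact ⟨M + N, fun z => (abs_add_le _ _).trans (add_le_add (hM z) (hN z))⟩⟩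

lemma fracLap_const_mul {n : ℕ} {s : ℝ} (f : En n → ℝ) (x : En n) (c : ℝ) :
    fracLap n s (fun z => c * f z) x = c * fracLap n s f x := by
  rw [fracLap_eq, fracLap_eq]
  have : ∀ y : En n, sdf (fun z => c * f z) x y / ‖y‖ ^ ((n : ℝ) + 2 * s)
      = c * (sdf f x y / ‖y‖ ^ ((n : ℝ) + 2 * s)) := fun y => by unfold sdf; ring
  simp_rw [this]
  rw [integral_const_mul]; ring

lemma fracLap_neg {n : ℕ} {s : ℝ} (f : En n → ℝ) (x : En n) :
    fracLap n s (fun z => - f z) x = - fracLap n s f x := by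
  have := fracLap_const_mul (s := s) f x (-1)
  simpa using this

lemma fracLap_add {n : ℕ} (hn : 1 ≤ n) {s : ℝ} (hs : s ∈ Ioo (0:ℝ) 1) {f g : En n → ℝ} {x : En n}
    (hf : Nice f x) (hg : Nice g x) :
    fracLap n s (fun z => f z + g z) x = fracLap n s f x + fracLap n s g x := by
  rw [fracLap_eq, fracLap_eq, fracLap_eq, ← mul_add,
    ← integral_add (hf.integrable hn hs) (hg.integrable hn hs)]
  congr 2; ext y; unfold sdf; ring

lemma exists_max {n : ℕ} {f : En n → ℝ} (hc : Continuous f) {R : ℝ} (h0 : ∀ x, R ≤ ‖x‖ → f x ≤ 0)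
    {x : En n} (hx : 0 < f x) : ∃ z, 0 < f z ∧ ∀ y, f y ≤ f z := by
  have hxR : x ∈ closedBall (0 : En n) R := by
    by_contra h
    simp at h
    linarith [h0 x h.le]
  obtain ⟨z, hz, hmax⟩ := (isCompact_closedBall (0 : En n) R).exists_isMaxOn ⟨x, hxR⟩ hc.continuousOn
  have hxz : f x ≤ f z := hmax hxR
  refine ⟨z, by linarith, fun y => ?_⟩
  by_cases hy : y ∈ closedBall (0 : En n) R
  · exact hmax hy
  · simp at hy
    linarith [h0 y hy.le]

lemma sum_sq_single {n : ℕ} (L : En n →L[ℝ] ℝ) :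
    ∑ i : Fin n, (L (EuclideanSpace.single i 1)) ^ 2 = ‖L‖ ^ 2 := by
  set g := (InnerProductSpace.toDual ℝ (En n)).symm L with hg
  have h1 : ∀ v, L v = inner ℝ g v := fun v => by
    rw [hg, InnerProductSpace.toDual_symm_apply]
  have h2 : ‖g‖ = ‖L‖ := by simp [g]
  rw [← h2, EuclideanSpace.norm_sq_eq]
  refine Finset.sum_congr rfl fun i _ => ?_
  rw [h1]
  simp [EuclideanSpace.inner_single_right]

structure Sol {n : ℕ} (D : Dom n) (s a lam : ℝ) (u : En n → ℝ) : Prop where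
  hn : 1 ≤ n
  hs : s ∈ Ioo (0:ℝ) 1
  ha : 0 ≤ a
  cont : Continuous u
  c2 : ∀ x, 0 < D.τ x → ContDiffAt ℝ 2 u x
  eq : ∀ x, 0 < D.τ x → - lap n u x + a * fracLap n s u x = lam * u x
  zero : ∀ x, D.τ x ≤ 0 → u x = 0

lemma Sol.neg {n : ℕ} {D : Dom n} {s a lam : ℝ} {u : En n → ℝ} (h : Sol D s a lam u) :
    Sol D s a lam (fun z => - u z) where
  hn := h.hn
  hs := h.hs
  ha := h.ha
  cont := h.cont.neg
  c2 := fun x hx => (h.c2 x hx).neg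
  eq := fun x hx => by
    rw [lap_neg (h.c2 x hx), fracLap_neg]; linarith [h.eq x hx]
  zero := fun x hx => by rw [h.zero x hx]; simp

lemma Sol.bdd {n : ℕ} {D : Dom n} {s a lam : ℝ} {u : En n → ℝ} (h : Sol D s a lam u) :
    ∃ M, 0 < M ∧ ∀ z, |u z| ≤ M := by
  obtain ⟨M, hM⟩ := (isCompact_closedBall (0 : En n) D.R).exists_bound_of_continuousOn
    h.cont.continuousOn
  refine ⟨|M| + 1, by positivity, fun z => ?_⟩
  by_cases hz : z ∈ closedBall (0 : En n) D.R
  · have := hM z hz; rw [Real.norm_eq_abs] at this; linarith [le_abs_self M]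
  · simp at hz
    rw [h.zero z, abs_zero]; positivity
    by_contra h2
    linarith [D.mem_ball z (not_le.1 h2)]

lemma Sol.nice {n : ℕ} {D : Dom n} {s a lam : ℝ} {u : En n → ℝ} (h : Sol D s a lam u) {x : En n}
    (hx : 0 < D.τ x) : Nice u x :=
  ⟨h.c2 x hx, h.cont.measurable, by obtain ⟨M, _, hM⟩ := h.bdd; exact ⟨M, hM⟩⟩

lemma Sol.zero_far {n : ℕ} {D : Dom n} {s a lam : ℝ} {u : En n → ℝ} (h : Sol D s a lam u) {x : En n}
    (hx : D.R ≤ ‖x‖) : u x = 0 := by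
  apply h.zero
  by_contra h2
  linarith [D.mem_ball x (not_le.1 h2)]

def Psi (γ t : ℝ) : ℝ := t - t ^ (1 + γ) / 4

def Dom.W {n : ℕ} (D : Dom n) (s : ℝ) (x : En n) : ℝ := Psi ((1 - s) / 2) (max (D.τ x) 0)

lemma Psi_deriv {γ t : ℝ} (hγ : 0 < γ) : HasDerivAt (Psi γ) (1 - (1 + γ) * t ^ γ / 4) t := by
  have := (hasDerivAt_id t).sub ((Real.hasDerivAt_rpow_const (x := t) (p := 1 + γ)
    (Or.inr (by linarith))).div_const 4)
  exact this.congr_deriv (by simp)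

lemma Psi_deriv2 {γ t : ℝ} (ht : 0 < t) :
    HasDerivAt (fun t => 1 - (1 + γ) * t ^ γ / 4) (- ((1 + γ) * γ / 4 * t ^ (γ - 1))) t := by
  have := (((Real.hasDerivAt_rpow_const (x := t) (p := γ) (Or.inl ht.ne')).const_mul
    (1 + γ)).div_const 4).const_sub 1
  exact this.congr_deriv (by ring)

lemma Psi_le {γ t : ℝ} (ht : 0 ≤ t) : Psi γ t ≤ t := by
  unfold Psi; have : 0 ≤ t ^ (1 + γ) := by positivity
  linarith

lemma le_Psi {γ t : ℝ} (hγ : 0 < γ) (ht : 0 ≤ t) (ht1 : t ≤ 1) : 3 / 4 * t ≤ Psi γ t := by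
  unfold Psi
  have : t ^ (1 + γ) ≤ t := by
    rcases ht.eq_or_lt with h | h
    · rw [← h, Real.zero_rpow (by linarith)]
    · calc t ^ (1 + γ) ≤ t ^ (1:ℝ) := Real.rpow_le_rpow_of_exponent_ge h ht1 (by linarith)
        _ = t := Real.rpow_one t
  linarith

lemma Psi_lip {γ t t' : ℝ} (hγ : 0 < γ) (hγ1 : γ ≤ 1) (ht : t ∈ Icc (0:ℝ) 1) (ht' : t' ∈ Icc (0:ℝ) 1) :
    |Psi γ t' - Psi γ t| ≤ |t' - t| := by
  have := Convex.norm_image_sub_le_of_norm_hasDerivWithin_le (f := Psi γ)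
    (f' := fun t => 1 - (1 + γ) * t ^ γ / 4) (s := Icc (0:ℝ) 1) (C := 1) (x := t) (y := t')
    (fun x hx => (Psi_deriv hγ).hasDerivWithinAt) ?_ (convex_Icc _ _) ht ht'
  · simpa using this
  · intro x hx
    have h1 : 0 ≤ x ^ γ := Real.rpow_nonneg hx.1 _
    have h2 : x ^ γ ≤ 1 := Real.rpow_le_one hx.1 hx.2 hγ.le
    rw [Real.norm_eq_abs, abs_le]; constructor <;> nlinarith

lemma Psi_cd {γ t : ℝ} (ht : 0 < t) : ContDiffAt ℝ 2 (Psi γ) t := by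
  unfold Psi
  exact contDiffAt_id.sub ((Real.contDiffAt_rpow_const_of_ne ht.ne').div_const 4)

section
variable {n : ℕ} (D : Dom n) {s : ℝ}

lemma Dom.tp_mem (x : En n) : max (D.τ x) 0 ∈ Icc (0:ℝ) 1 :=
  ⟨le_max_right _ _, max_le (D.le_one x) (by norm_num)⟩

lemma Dom.W_le (x : En n) : D.W s x ≤ max (D.τ x) 0 := Psi_le (D.tp_mem x).1

lemma Dom.le_W (hs : s ∈ Ioo (0:ℝ) 1) (x : En n) : 3 / 4 * max (D.τ x) 0 ≤ D.W s x :=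
  le_Psi (by linarith [hs.2]) (D.tp_mem x).1 (D.tp_mem x).2

lemma Dom.W_nonneg (hs : s ∈ Ioo (0:ℝ) 1) (x : En n) : 0 ≤ D.W s x :=
  le_trans (by have := (D.tp_mem x).1; positivity) (D.le_W hs x)

lemma Dom.W_le_one (x : En n) : D.W s x ≤ 1 := (D.W_le x).trans (D.tp_mem x).2

lemma Dom.W_zero (hs : s ∈ Ioo (0:ℝ) 1) {x : En n} (hx : D.τ x ≤ 0) : D.W s x = 0 := by
  have h1 := D.W_le (s := s) x
  rw [max_eq_right hx] at h1
  exact le_antisymm h1 (D.W_nonneg hs x)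

lemma Dom.W_pos (hs : s ∈ Ioo (0:ℝ) 1) {x : En n} (hx : 0 < D.τ x) : 3 / 4 * D.τ x ≤ D.W s x := by
  have := D.le_W hs x
  rwa [max_eq_left hx.le] at this

lemma Dom.W_lip (hs : s ∈ Ioo (0:ℝ) 1) (x y : En n) : |D.W s x - D.W s y| ≤ D.K * ‖x - y‖ :=
  (Psi_lip (by linarith [hs.2]) (by linarith [hs.1]) (D.tp_mem y) (D.tp_mem x)).trans (D.lip x y)

lemma Dom.W_cont (hs : s ∈ Ioo (0:ℝ) 1) : Continuous (D.W s) := by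
  have hK := D.hK
  have : LipschitzWith ⟨D.K, by linarith⟩ (D.W s) :=
    LipschitzWith.of_dist_le_mul fun x y => by
      rw [Real.dist_eq, dist_eq_norm]; exact D.W_lip hs x y
  exact this.continuous

lemma Dom.τ_cont : Continuous D.τ := D.smooth.continuous

lemma Dom.W_eventuallyEq {x : En n} (hx : 0 < D.τ x) :
    D.W s =ᶠ[𝓝 x] fun z => Psi ((1 - s) / 2) (D.τ z) := by
  filter_upwards [D.τ_cont.continuousAt.eventually (lt_mem_nhds hx)] with z hz
  unfold Dom.W; rw [max_eq_left hz.le]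

lemma Dom.W_cd {x : En n} (hx : 0 < D.τ x) : ContDiffAt ℝ 2 (D.W s) x := by
  refine ContDiffAt.congr_of_eventuallyEq ?_ (D.W_eventuallyEq hx)
  exact (Psi_cd hx).comp x D.smooth.contDiffAt

lemma Dom.W_nice (hs : s ∈ Ioo (0:ℝ) 1) {x : En n} (hx : 0 < D.τ x) : Nice (D.W s) x :=
  ⟨D.W_cd hx, (D.W_cont hs).measurable, 1, fun z => by
    rw [abs_of_nonneg (D.W_nonneg hs z)]; exact D.W_le_one z⟩

lemma Hs_congr {f g : En n → ℝ} {x : En n} (h : f =ᶠ[𝓝 x] g) (v : En n) : Hs f x v = Hs g x v := by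
  unfold Hs; rw [(h.fderiv).fderiv_eq]

lemma Dom.W_Hs (hs : s ∈ Ioo (0:ℝ) 1) {x : En n} (hx : 0 < D.τ x) (v : En n) :
    Hs (D.W s) x v = - ((1 + (1 - s) / 2) * ((1 - s) / 2) / 4 * D.τ x ^ ((1 - s) / 2 - 1)) *
      (fderiv ℝ D.τ x v) ^ 2 + (1 - (1 + (1 - s) / 2) * D.τ x ^ ((1 - s) / 2) / 4) * Hs D.τ x v := by
  rw [Hs_congr (D.W_eventuallyEq hx)]
  exact Hs_comp D.smooth.contDiffAt (Psi_cd hx)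
    (Eventually.of_forall fun t => Psi_deriv (by linarith [hs.2])) (Psi_deriv2 hx) v

lemma Dom.Hs_τ {x : En n} (hx : ‖x‖ ≤ D.R + 10) (v : En n) : |Hs D.τ x v| ≤ D.K * ‖v‖ ^ 2 := by
  refine (abs_Hs_le _ _ _).trans ?_
  gcongr; exact D.d2 x hx

lemma Dom.W_Hs_le0 (hs : s ∈ Ioo (0:ℝ) 1) {x : En n} (hx : 0 < D.τ x) (v : En n) :
    Hs (D.W s) x v ≤ - ((1 - s) / 8 * D.τ x ^ ((1 - s) / 2 - 1)) *
      (fderiv ℝ D.τ x v) ^ 2 + D.K * ‖v‖ ^ 2 := by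
  rw [D.W_Hs hs hx]
  have h0 : 0 < D.τ x ^ ((1 - s) / 2 - 1) := by positivity
  have h1 : 0 ≤ D.τ x ^ ((1 - s) / 2) := by positivity
  have h2 : D.τ x ^ ((1 - s) / 2) ≤ 1 := Real.rpow_le_one hx.le (D.le_one x) (by linarith [hs.2])
  have h3 := D.Hs_τ (by linarith [D.mem_ball x hx] : ‖x‖ ≤ D.R + 10) v
  obtain ⟨hs0, hs1⟩ := hs
  have h4 : (1 - (1 + (1 - s) / 2) * D.τ x ^ ((1 - s) / 2) / 4) * Hs D.τ x v ≤ D.K * ‖v‖ ^ 2 := by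
    refine (le_abs_self _).trans ?_
    rw [abs_mul]
    refine (mul_le_of_le_one_left (abs_nonneg _) ?_).trans h3
    rw [abs_le]; constructor <;> nlinarith
  have h5 : (1 - s) / 8 * D.τ x ^ ((1 - s) / 2 - 1) ≤
     (1 + (1 - s) / 2) * ((1 - s) / 2) / 4 * D.τ x ^ ((1 - s) / 2 - 1) := by
    exact mul_le_mul_of_nonneg_right (by nlinarith) h0.le
  have h6 := mul_le_mul_of_nonneg_right h5 (sq_nonneg (fderiv ℝ D.τ x v))
  linarith

lemma Dom.W_Hs_le (hs : s ∈ Ioo (0:ℝ) 1) {x : En n} (hx : 0 < D.τ x) (v : En n) :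
    Hs (D.W s) x v ≤ D.K * ‖v‖ ^ 2 := by
  have := D.W_Hs_le0 hs hx v
  have h0 : 0 ≤ ((1 - s) / 8 * D.τ x ^ ((1 - s) / 2 - 1)) * (fderiv ℝ D.τ x v) ^ 2 := by
    have : 0 ≤ 1 - s := by linarith [hs.2]
    positivity
  linarith

/-- points close to an interior point stay interior -/
lemma Dom.inner_mem {x y : En n} (hx : 0 < D.τ x) (hy : ‖y - x‖ ≤ D.τ x / (2 * D.K)) :
    D.τ x / 2 ≤ D.τ y := by
  have h := D.lip x y
  have hK := D.hK
  rw [norm_sub_rev] at h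
  have h1 : D.K * ‖y - x‖ ≤ D.τ x / 2 := by
    calc D.K * ‖y - x‖ ≤ D.K * (D.τ x / (2 * D.K)) := by gcongr
      _ = D.τ x / 2 := by field_simp
  rw [max_eq_left hx.le] at h
  have h2 := (abs_le.1 h).2
  have h3 : 0 < max (D.τ y) 0 := by linarith
  have h4 : 0 < D.τ y := by simpa using h3
  rw [max_eq_left h4.le] at h2
  linarith

lemma line_norm {x y : En n} {t : ℝ} (ht : t ∈ Icc (-1:ℝ) 1) : ‖x + t • y - x‖ ≤ ‖y‖ := by
  rw [add_sub_cancel_left, norm_smul, Real.norm_eq_abs]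
  exact mul_le_of_le_one_left (norm_nonneg _) (abs_le.2 ht)

lemma Dom.W_sdf_le (hs : s ∈ Ioo (0:ℝ) 1) {x : En n} (hx : 0 < D.τ x) (y : En n) :
    sdf (D.W s) x y ≤ 4 * D.K ^ 2 * D.τ x ^ (-s) * kap s y := by
  have hK := D.hK
  have hk := kap_nonneg s y
  have h1 : 1 ≤ D.τ x ^ (-s) :=
    Real.one_le_rpow_of_pos_of_le_one_of_nonpos hx (D.le_one x) (by linarith [hs.1])
  have hK2 : D.K ≤ 4 * D.K ^ 2 := by nlinarith
  rcases le_or_gt ‖y‖ (D.τ x / (2 * D.K)) with h | h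
  · have hy1 : ‖y‖ ≤ 1 := h.trans (by
      rw [div_le_one (by positivity)]; linarith [D.le_one x])
    have hz : ∀ t ∈ Icc (-1:ℝ) 1, 0 < D.τ (x + t • y) := fun t ht => by
      have := D.inner_mem hx ((line_norm ht).trans h); linarith
    have := sdf_le (fun t ht => D.W_cd (s := s) (hz t ht)) (fun t ht => D.W_Hs_le hs (hz t ht) y)
    refine this.trans ?_
    have h2 := sq_le_kap hs hy1
    calc D.K * ‖y‖ ^ 2 ≤ 4 * D.K ^ 2 * 1 * kap s y := by rw [mul_one]; gcongr
      _ ≤ _ := by gcongr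
  · rcases le_or_gt ‖y‖ 1 with hy | hy
    · have hy0 : 0 < ‖y‖ := lt_of_le_of_lt (by positivity) h
      have e1 := D.W_lip hs (x + y) x
      have e2 := D.W_lip hs (x - y) x
      rw [add_sub_cancel_left] at e1
      rw [sub_sub_cancel_left, norm_neg] at e2
      have e3 : sdf (D.W s) x y ≤ 2 * D.K * ‖y‖ := by
        unfold sdf; linarith [(abs_le.1 e1).2, (abs_le.1 e2).2]
      refine e3.trans ?_
      have hkap : kap s y = ‖y‖ ^ (1 + s) := by
        unfold kap; exact min_eq_left (Real.rpow_le_one hy0.le hy (by linarith [hs.1]))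
      rw [hkap, Real.rpow_add hy0, Real.rpow_one]
      have e4 : 1 ≤ (2 * D.K) * (D.τ x ^ (-s) * ‖y‖ ^ s) := by
        have : D.τ x ≤ 2 * D.K * ‖y‖ := by
          rw [div_lt_iff₀ (by positivity)] at h; linarith
        have e5 : D.τ x ^ s ≤ (2 * D.K * ‖y‖) ^ s := Real.rpow_le_rpow hx.le this hs.1.le
        rw [Real.mul_rpow (by positivity) (by positivity)] at e5
        have e6 : (2 * D.K) ^ s ≤ 2 * D.K := by
          calc (2 * D.K) ^ s ≤ (2 * D.K) ^ (1:ℝ) :=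
                Real.rpow_le_rpow_of_exponent_le (by linarith) hs.2.le
            _ = _ := Real.rpow_one _
        have e7 : D.τ x ^ s * D.τ x ^ (-s) = 1 := by
          rw [← Real.rpow_add hx]; simp
        have e8 : 0 < D.τ x ^ (-s) := by positivity
        have e9 : 0 < ‖y‖ ^ s := by positivity
        calc 1 = D.τ x ^ s * D.τ x ^ (-s) := e7.symm
          _ ≤ ((2 * D.K) ^ s * ‖y‖ ^ s) * D.τ x ^ (-s) := by gcongr
          _ ≤ ((2 * D.K) * ‖y‖ ^ s) * D.τ x ^ (-s) := by gcongr
          _ = _ := by ring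
      calc 2 * D.K * ‖y‖ = 2 * D.K * ‖y‖ * 1 := by ring
        _ ≤ 2 * D.K * ‖y‖ * ((2 * D.K) * (D.τ x ^ (-s) * ‖y‖ ^ s)) := by gcongr
        _ = _ := by ring
    · rw [kap_of_one_le hs.1 hy.le]
      have e1 := D.W_le_one (s := s) (x + y)
      have e2 := D.W_le_one (s := s) (x - y)
      have e3 := D.W_nonneg hs x
      have e4 : sdf (D.W s) x y ≤ 2 := by unfold sdf; linarith
      have : 4 * 1 * 1 ≤ 4 * D.K ^ 2 * D.τ x ^ (-s) := by gcongr; nlinarith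
      linarith

lemma Dom.W_lap (hs : s ∈ Ioo (0:ℝ) 1) {x : En n} (hx : 0 < D.τ x) (hx0 : D.τ x < D.t0) :
    lap n (D.W s) x ≤ - ((1 - s) / 8 * D.τ x ^ ((1 - s) / 2 - 1)) * D.c0 ^ 2 + n * D.K := by
  rw [lap_eq_sum (D.W_cd hx)]
  have h1 : ∑ i : Fin n, Hs (D.W s) x (EuclideanSpace.single i 1) ≤
      ∑ i : Fin n, (- ((1 - s) / 8 * D.τ x ^ ((1 - s) / 2 - 1)) *
      (fderiv ℝ D.τ x (EuclideanSpace.single i 1)) ^ 2 + D.K) := by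
    refine Finset.sum_le_sum fun i _ => (D.W_Hs_le0 hs hx _).trans (by simp)
  refine h1.trans ?_
  rw [Finset.sum_add_distrib, ← Finset.mul_sum, sum_sq_single]
  have h2 := D.grad x hx hx0
  have h3 : D.c0 ^ 2 ≤ ‖fderiv ℝ D.τ x‖ ^ 2 := pow_le_pow_left₀ D.hc0.le h2 2
  have h0 : 0 ≤ ((1 - s) / 8 * D.τ x ^ ((1 - s) / 2 - 1)) := by
    have : 0 ≤ 1 - s := by linarith [hs.2]
    positivity
  simp only [Finset.sum_const, Finset.card_univ, Fintype.card_fin, nsmul_eq_mul]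
  nlinarith

lemma Dom.W_op (hn : 1 ≤ n) (hs : s ∈ Ioo (0:ℝ) 1) {a : ℝ} (ha : 0 ≤ a) (B : ℝ) :
    ∃ t1, 0 < t1 ∧ t1 ≤ D.t0 ∧ ∀ x, 0 < D.τ x → D.τ x < t1 →
      B ≤ - lap n (D.W s) x + a * fracLap n s (D.W s) x := by
  have hc0 := D.hc0
  set A1 := (1 - s) / 8 * D.c0 ^ 2
  set A2 := a * (4 * D.K ^ 2 * IK n s)
  have hA1 : 0 < A1 := by have : 0 < 1 - s := by linarith [hs.2]
                          positivity
  have hlim : Tendsto (fun t : ℝ => t ^ ((1 - s) / 2 - 1) * (A1 - A2 * t ^ ((1 - s) / 2)))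
      (𝓝[>] 0) atTop := by
    apply Tendsto.atTop_mul_pos hA1
    · exact tendsto_rpow_neg_nhdsGT_zero (by linarith [hs.1])
    · have h1 : ContinuousAt (fun t : ℝ => t ^ ((1 - s) / 2)) 0 :=
        Real.continuousAt_rpow_const _ _ (Or.inr (by linarith [hs.2]))
      have h2 : Tendsto (fun t : ℝ => A1 - A2 * t ^ ((1 - s) / 2)) (𝓝 0)
          (𝓝 (A1 - A2 * 0 ^ ((1 - s) / 2))) := (h1.tendsto.const_mul A2).const_sub A1
      rw [Real.zero_rpow (by linarith [hs.2])] at h2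
      simp at h2
      exact h2.mono_left nhdsWithin_le_nhds
  have h1 := hlim.eventually_ge_atTop (B + n * D.K)
  obtain ⟨t1, ht1, h2⟩ := mem_nhdsGT_iff_exists_Ioo_subset.1 h1
  refine ⟨min t1 D.t0, lt_min ht1 D.ht0, min_le_right _ _, fun x hx hxt => ?_⟩
  have h3 := h2 ⟨hx, lt_of_lt_of_le hxt (min_le_left _ _)⟩
  have h4 := D.W_lap hs hx (lt_of_lt_of_le hxt (min_le_right _ _))
  have h5 := fracLap_ge_of_sdf_le (D.W_nice hs hx) hn hs (D.W_sdf_le hs hx)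
  have h6 := mul_le_mul_of_nonneg_left h5 ha
  have e : D.τ x ^ ((1 - s) / 2 - 1) * D.τ x ^ ((1 - s) / 2) = D.τ x ^ (-s) := by
    rw [← Real.rpow_add hx]; congr 1; ring
  have h3' : B + n * D.K ≤ D.τ x ^ ((1 - s) / 2 - 1) * (A1 - A2 * D.τ x ^ ((1 - s) / 2)) := h3
  have e2 : D.τ x ^ ((1 - s) / 2 - 1) * (A1 - A2 * D.τ x ^ ((1 - s) / 2)) =
     (1 - s) / 8 * D.τ x ^ ((1 - s) / 2 - 1) * D.c0 ^ 2 - a * (4 * D.K ^ 2 * D.τ x ^ (-s) * IK n s) := by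
    rw [← e]; simp only [A1, A2]; ring
  rw [e2] at h3'
  linarith

end

/-- growth bound `u ≤ C τ⁺` -/
lemma Sol.le_tau {n : ℕ} {D : Dom n} {s a lam : ℝ} {u : En n → ℝ} (h : Sol D s a lam u) :
    ∃ C, 0 < C ∧ ∀ x, u x ≤ C * max (D.τ x) 0 := by
  obtain ⟨M, hM0, hM⟩ := h.bdd
  obtain ⟨t1, ht1, ht10, hW⟩ := D.W_op h.hn h.hs h.ha (|lam| * M + 1)
  set A := max 1 (M / (3 / 4 * t1))
  have hA1 : 1 ≤ A := le_max_left _ _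
  refine ⟨A, by linarith, fun x0 => ?_⟩
  suffices hsuf : u x0 ≤ A * D.W s x0 from hsuf.trans (by gcongr; exact D.W_le x0)
  by_contra hcon
  push Not at hcon
  obtain ⟨z, hz, hmax⟩ := exists_max (f := fun x => u x - A * D.W s x)
    (h.cont.sub (continuous_const.mul (D.W_cont h.hs))) (R := D.R)
    (fun x hx => by
      rw [h.zero_far hx]
      have := D.W_nonneg h.hs x
      have : 0 ≤ A * D.W s x := by positivity
      linarith) (x := x0) (by linarith)
  have hzΩ : 0 < D.τ z := by
    by_contra hc
    rw [h.zero z (not_lt.1 hc), D.W_zero h.hs (not_lt.1 hc)] at hz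
    simp at hz
  have hzt : D.τ z < t1 := by
    by_contra hc
    have h1 := D.W_pos h.hs hzΩ
    have h2 : M ≤ A * D.W s z := by
      calc M = M / (3 / 4 * t1) * (3 / 4 * t1) := by field_simp
        _ ≤ A * (3 / 4 * t1) := by gcongr; exact le_max_right _ _
        _ ≤ A * D.W s z := by gcongr; linarith [not_lt.1 hc]
    linarith [(abs_le.1 (hM z)).2]
  have hWn := (D.W_nice h.hs hzΩ).const_mul A
  have hsd : ∀ y, sdf u z y ≤ sdf (fun x => A * D.W s x) z y := by
    intro y
    have e1 := hmax (z + y); have e2 := hmax (z - y)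
    simp only [sdf]; linarith
  have h1 := lap_le_of_sdf (h.c2 z hzΩ) hWn.c2 (Eventually.of_forall hsd)
  have h2 := fracLap_le_of_sdf (h.nice hzΩ) hWn h.hn h.hs hsd
  rw [lap_const_mul (D.W_cd hzΩ)] at h1
  rw [fracLap_const_mul] at h2
  have h3 := hW z hzΩ hzt
  have h4 := h.eq z hzΩ
  have h5 := mul_le_mul_of_nonneg_left h2 h.ha
  have h6 : lam * u z ≤ |lam| * M := by
    refine (le_abs_self _).trans ?_
    rw [abs_mul]; gcongr; exact hM z
  have h7 : 0 ≤ |lam| * M := by positivity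
  nlinarith

lemma Sol.abs_le_tau {n : ℕ} {D : Dom n} {s a lam : ℝ} {u : En n → ℝ} (h : Sol D s a lam u) :
    ∃ C, 0 < C ∧ ∀ x, |u x| ≤ C * max (D.τ x) 0 := by
  obtain ⟨C, hC, h1⟩ := h.le_tau
  obtain ⟨C', hC', h2⟩ := h.neg.le_tau
  refine ⟨max C C', lt_max_of_lt_left hC, fun x => ?_⟩
  have hx := (D.tp_mem x).1
  rw [abs_le]
  have e1 : C * max (D.τ x) 0 ≤ max C C' * max (D.τ x) 0 := by gcongr; exact le_max_left _ _
  have e2 : C' * max (D.τ x) 0 ≤ max C C' * max (D.τ x) 0 := by gcongr; exact le_max_right _ _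
  have := h2 x
  constructor <;> linarith [h1 x]

lemma sum_single_smul {n : ℕ} (e : En n) :
    ∑ i : Fin n, (inner ℝ (EuclideanSpace.single i (1:ℝ)) e : ℝ) • (EuclideanSpace.single i (1:ℝ) : En n) = e := by
  have := (EuclideanSpace.basisFun (Fin n) ℝ).sum_repr' e
  simpa using this

lemma fracLap_le_of_sdf2 {n : ℕ} {f g : En n → ℝ} {x x' : En n} (hf : Nice f x) (hg : Nice g x')
    (hn : 1 ≤ n) {s : ℝ} (hs : s ∈ Ioo (0:ℝ) 1) (h : ∀ y, sdf f x y ≤ sdf g x' y) :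
    fracLap n s g x' ≤ fracLap n s f x := by
  rw [fracLap_eq, fracLap_eq]
  have hc := cK_pos n s hs
  have := integral_mono (hf.integrable hn hs) (hg.integrable hn hs) (fun y => by
    dsimp only; gcongr; exact h y)
  nlinarith

lemma trace_reflect {n : ℕ} (B : En n →L[ℝ] En n →L[ℝ] ℝ) {e : En n} (he : ‖e‖ = 1) :
    ∑ i : Fin n, B (EuclideanSpace.single i 1 - (2 * (inner ℝ (EuclideanSpace.single i (1:ℝ)) e : ℝ)) • e)
      (EuclideanSpace.single i 1 - (2 * (inner ℝ (EuclideanSpace.single i (1:ℝ)) e : ℝ)) • e) =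
    ∑ i : Fin n, B (EuclideanSpace.single i 1) (EuclideanSpace.single i 1) := by
  set c : Fin n → ℝ := fun i => inner ℝ (EuclideanSpace.single i (1:ℝ)) e
  have h0 : ∀ L : En n →L[ℝ] ℝ, ∑ i, c i * L (EuclideanSpace.single i 1) = L e := by
    intro L
    conv_rhs => rw [← sum_single_smul e]
    rw [map_sum]
    refine Finset.sum_congr rfl fun i _ => ?_
    rw [map_smul]; rfl
  have h1 : ∑ i, c i * B (EuclideanSpace.single i 1) e = B e e := h0 (B.flip e)
  have h2 : ∑ i, c i * B e (EuclideanSpace.single i 1) = B e e := h0 (B e)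
  have h3 : ∑ i, (c i) ^ 2 = 1 := by
    have : ∑ i, (e i) ^ 2 = 1 := by
      have := EuclideanSpace.norm_sq_eq e
      rw [he] at this; simpa using this.symm
    simpa [c, EuclideanSpace.inner_single_left] using this
  have h4 : ∀ i, B (EuclideanSpace.single i 1 - (2 * c i) • e) (EuclideanSpace.single i 1 - (2 * c i) • e)
      = B (EuclideanSpace.single i 1) (EuclideanSpace.single i 1)
        - 2 * (c i * B (EuclideanSpace.single i 1) e) - 2 * (c i * B e (EuclideanSpace.single i 1))
        + 4 * B e e * (c i) ^ 2 := by
    intro i; simp; ring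
  rw [Finset.sum_congr rfl (fun i _ => h4 i), Finset.sum_add_distrib, Finset.sum_sub_distrib,
    Finset.sum_sub_distrib, ← Finset.mul_sum, ← Finset.mul_sum, ← Finset.mul_sum, h1, h2, h3]
  ring

set_option maxHeartbeats 1000000 in
lemma Sol.lipschitz {n : ℕ} {D : Dom n} {s a lam : ℝ} {u : En n → ℝ} (h : Sol D s a lam u) :
    ∃ C, 1 ≤ C ∧ ∀ x y, |u x - u y| ≤ C * ‖x - y‖ := by
  obtain ⟨M, hM0, hM⟩ := h.bdd
  obtain ⟨C, hC0, hC⟩ := h.abs_le_tau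
  have hK := D.hK
  set L := 2 * M + C * D.K + |lam| * M + 1 with hL
  have hlM : 0 ≤ |lam| * M := by positivity
  have hCK : 0 < C * D.K := by positivity
  have hLpos : 1 ≤ L := by linarith
  have hCtau : ∀ x y, D.τ x ≤ 0 → |u y| ≤ C * D.K * ‖x - y‖ := by
    intro x y hx
    have h1 := hC y
    have h2 := D.lip x y
    rw [max_eq_right hx, zero_sub, abs_neg, abs_of_nonneg (D.tp_mem y).1] at h2
    calc |u y| ≤ C * max (D.τ y) 0 := h1
      _ ≤ C * (D.K * ‖x - y‖) := by gcongr
      _ = _ := by ring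
  have key : ∀ x y, ‖x - y‖ ≤ 1 → u x - u y ≤ L * (2 * ‖x - y‖ - ‖x - y‖ ^ 2) := by
    by_contra hcon
    push Not at hcon
    obtain ⟨x1, y1, hxy1, hpos1⟩ := hcon
    let Φ : En n × En n → ℝ := fun p => u p.1 - u p.2 - L * (2 * ‖p.1 - p.2‖ - ‖p.1 - p.2‖ ^ 2)
    have hΦc : Continuous Φ := by
      have := h.cont
      fun_prop
    let S : Set (En n × En n) := (closedBall 0 (D.R + 2) ×ˢ closedBall 0 (D.R + 2)) ∩
      {p | ‖p.1 - p.2‖ ≤ 1}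
    have hS : IsCompact S := ((isCompact_closedBall _ _).prod (isCompact_closedBall _ _)).inter_right
      (isClosed_le (by fun_prop) continuous_const)
    have hout : ∀ p : En n × En n, ‖p.1 - p.2‖ ≤ 1 → 0 < Φ p → p ∈ S := by
      intro p hp hpp
      by_contra hpS
      have : D.R ≤ ‖p.1‖ ∧ D.R ≤ ‖p.2‖ := by
        have e1 := norm_sub_norm_le p.1 p.2
        have e2 := norm_sub_norm_le p.2 p.1
        rw [norm_sub_rev p.2 p.1] at e2
        by_contra hc
        apply hpS
        refine ⟨⟨?_, ?_⟩, hp⟩ <;> simp only [mem_closedBall, dist_zero_right]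
        · by_contra hb; exact hc ⟨by linarith, by linarith⟩
        · by_contra hb; exact hc ⟨by linarith, by linarith⟩
      simp only [Φ] at hpp
      rw [h.zero_far this.1, h.zero_far this.2] at hpp
      have : 0 ≤ L * (2 * ‖p.1 - p.2‖ - ‖p.1 - p.2‖ ^ 2) := by
        have := norm_nonneg (p.1 - p.2)
        have : 0 ≤ (2 * ‖p.1 - p.2‖ - ‖p.1 - p.2‖ ^ 2) := by nlinarith
        positivity
      linarith
    have hpos1' : 0 < Φ (x1, y1) := by simp only [Φ]; linarith
    have hS1 : (x1, y1) ∈ S := hout (x1, y1) hxy1 hpos1'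
    obtain ⟨⟨x, y⟩, hxyS, hmax⟩ := hS.exists_isMaxOn ⟨(x1, y1), hS1⟩ hΦc.continuousOn
    rw [isMaxOn_iff] at hmax
    have hΦpos : 0 < Φ (x, y) := lt_of_lt_of_le hpos1' (hmax (x1, y1) hS1)
    have hmax' : ∀ x' y', ‖x' - y'‖ ≤ 1 → Φ (x', y') ≤ Φ (x, y) := by
      intro x' y' hp
      rcases le_or_gt (Φ (x', y')) 0 with h0 | h0
      · linarith
      · exact hmax (x', y') (hout (x', y') hp h0)
    set p := ‖x - y‖ with hp
    have hp1 : p ≤ 1 := hxyS.2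
    have hp0 : 0 ≤ p := norm_nonneg _
    have hΦ : Φ (x, y) = u x - u y - L * (2 * p - p ^ 2) := rfl
    have hgp : p ≤ 2 * p - p ^ 2 := by nlinarith
    have hLg : L * p ≤ L * (2 * p - p ^ 2) := by gcongr
    have hux := abs_le.1 (hM x)
    have huy := abs_le.1 (hM y)
    have hplt : p < 1 := by
      by_contra hc
      have : p = 1 := le_antisymm hp1 (not_lt.1 hc)
      rw [hΦ, this] at hΦpos
      linarith
    have hppos : 0 < p := by
      rcases hp0.eq_or_lt with h0 | h0
      · have : x = y := by rw [← sub_eq_zero, ← norm_eq_zero, ← hp, h0]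
        rw [hΦ, ← h0, this] at hΦpos
        simp at hΦpos
      · exact h0
    have hxΩ : 0 < D.τ x := by
      by_contra hc
      have e1 := hCtau x y (not_lt.1 hc)
      rw [hΦ, h.zero x (not_lt.1 hc)] at hΦpos
      have e2 := (abs_le.1 e1).1
      rw [← hp] at e2
      nlinarith
    have hyΩ : 0 < D.τ y := by
      by_contra hc
      have e1 := hCtau y x (not_lt.1 hc)
      rw [hΦ, h.zero y (not_lt.1 hc)] at hΦpos
      have e2 := (abs_le.1 e1).2
      rw [norm_sub_rev, ← hp] at e2
      nlinarith
    -- synchronous coupling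
    have hsync : ∀ z, sdf u x z ≤ sdf u y z := by
      intro z
      have e1 := hmax' (x + z) (y + z) (by rw [add_sub_add_right_eq_sub]; exact hp1)
      have e2 := hmax' (x - z) (y - z) (by rw [sub_sub_sub_cancel_right]; exact hp1)
      simp only [Φ, add_sub_add_right_eq_sub, sub_sub_sub_cancel_right] at e1 e2
      unfold sdf; linarith
    have hfl := fracLap_le_of_sdf2 (h.nice hxΩ) (h.nice hyΩ) h.hn h.hs hsync
    -- reflection coupling
    set e := p⁻¹ • (x - y) with he
    have hen : ‖e‖ = 1 := by
      rw [he, norm_smul, ← hp, norm_inv, Real.norm_eq_abs, abs_of_pos hppos]; field_simp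
    have hxye : x - y = p • e := by rw [he, smul_smul]; field_simp; simp
    have hrefl : ∀ v : En n, Hs u x v - Hs u y (v - (2 * (inner ℝ v e : ℝ)) • e) ≤ - 8 * L * (inner ℝ v e : ℝ) ^ 2 := by
      intro v
      set c : ℝ := inner ℝ v e
      set w := v - (2 * c) • e
      have e1 := (tendsto_sdf (h.c2 x hxΩ) v).sub (tendsto_sdf (h.c2 y hyΩ) w)
      refine le_of_tendsto e1 ?_
      have hs1 : ∀ᶠ t in 𝓝[>] (0:ℝ), |2 * t * c| < min p (1 - p) := by
        have : Tendsto (fun t : ℝ => |2 * t * c|) (𝓝 0) (𝓝 0) := by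
          have : Continuous (fun t : ℝ => |2 * t * c|) := by fun_prop
          simpa using this.tendsto 0
        exact (this.mono_left nhdsWithin_le_nhds).eventually
          (gt_mem_nhds (lt_min hppos (by linarith)))
      filter_upwards [hs1, self_mem_nhdsWithin] with t ht ht0
      have ht0 : 0 < t := ht0
      have ht2 : 0 < t ^ 2 := by positivity
      have hc1 := abs_lt.1 (lt_of_lt_of_le ht (min_le_left _ _))
      have hc2 := abs_lt.1 (lt_of_lt_of_le ht (min_le_right _ _))
      have hnp : ‖(x + t • v) - (y + t • w)‖ = p + 2 * t * c := by
        have : (x + t • v) - (y + t • w) = (p + 2 * t * c) • e := by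
          have : (x + t • v) - (y + t • w) = (x - y) + (2 * t * c) • e := by
            simp only [w]; module
          rw [this, hxye]; module
        rw [this, norm_smul, hen, mul_one, Real.norm_eq_abs, abs_of_pos (by linarith)]
      have hnm : ‖(x - t • v) - (y - t • w)‖ = p - 2 * t * c := by
        have : (x - t • v) - (y - t • w) = (p - 2 * t * c) • e := by
          have : (x - t • v) - (y - t • w) = (x - y) - (2 * t * c) • e := by
            simp only [w]; module
          rw [this, hxye]; module
        rw [this, norm_smul, hen, mul_one, Real.norm_eq_abs, abs_of_pos (by linarith)]
      have f1 := hmax' (x + t • v) (y + t • w) (by rw [hnp]; linarith)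
      have f2 := hmax' (x - t • v) (y - t • w) (by rw [hnm]; linarith)
      rw [hΦ] at f1 f2
      simp only [Φ, hnp, hnm] at f1 f2
      rw [← sub_div, div_le_iff₀ ht2]
      unfold sdf
      nlinarith
    have hlap : lap n u x - lap n u y ≤ - 8 * L := by
      rw [lap_eq_sum (h.c2 x hxΩ), lap_eq_sum (h.c2 y hyΩ)]
      have e1 := trace_reflect (fderiv ℝ (fderiv ℝ u) y) hen
      have e2 : ∑ i : Fin n, Hs u y (EuclideanSpace.single i 1) =
        ∑ i : Fin n, Hs u y (EuclideanSpace.single i 1 - (2 * (inner ℝ (EuclideanSpace.single i (1:ℝ)) e : ℝ)) • e) := by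
        unfold Hs; exact e1.symm
      rw [e2, ← Finset.sum_sub_distrib]
      refine (Finset.sum_le_sum fun i _ => hrefl _).trans ?_
      rw [← Finset.mul_sum]
      have h3 : ∑ i : Fin n, (inner ℝ (EuclideanSpace.single i (1:ℝ)) e : ℝ) ^ 2 = 1 := by
        have : ∑ i, (e i) ^ 2 = 1 := by
          have := EuclideanSpace.norm_sq_eq e
          rw [hen] at this; simpa using this.symm
        simpa [EuclideanSpace.inner_single_left] using this
      rw [h3]; linarith
    have q1 := h.eq x hxΩ
    have q2 := h.eq y hyΩ
    have q3 := mul_le_mul_of_nonneg_left hfl h.ha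
    have q4 : lam * (u x - u y) ≤ |lam| * (2 * M) := by
      refine (le_abs_self _).trans ?_
      rw [abs_mul]; gcongr
      rw [abs_le]; constructor <;> linarith
    nlinarith
  have key2 : ∀ x y, u x - u y ≤ 2 * L * ‖x - y‖ := by
    intro x y
    rcases le_or_gt ‖x - y‖ 1 with h1 | h1
    · refine (key x y h1).trans ?_
      nlinarith [norm_nonneg (x - y), sq_nonneg ‖x - y‖]
    · have hux := abs_le.1 (hM x)
      have huy := abs_le.1 (hM y)
      nlinarith
  refine ⟨2 * L, by linarith, fun x y => ?_⟩
  rw [abs_le]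
  have := key2 y x
  rw [norm_sub_rev] at this
  constructor <;> linarith [key2 x y]

/-- the bent-ball function -/
def qf {n : ℕ} (D : Dom n) (x' y : En n) (r : ℝ) (x : En n) : ℝ :=
  ‖x - x' - (D.τ x / D.τ y) • (y - x')‖ ^ 2 / r ^ 2 + (D.τ x / D.τ y - 1) ^ 2 - 1

structure QH {n : ℕ} (D : Dom n) (x' y : En n) (r k : ℝ) : Prop where
  r0 : 0 < r
  r1 : r ≤ 1 / 2
  hx' : D.τ x' = 0
  nx' : ‖x'‖ ≤ D.R + 1
  hy : ‖y - x'‖ ≤ 2 * r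
  h0 : 0 < D.τ y
  hk : 10 * D.K * r ≤ k * D.τ y
  k1 : 1 ≤ k

section
variable {n : ℕ} {D : Dom n} {x' y : En n} {r k : ℝ}

lemma QH.ball (H : QH D x' y r k) {x : En n} (hx : ‖x - x'‖ ≤ 10 * r) : ‖x‖ ≤ D.R + 10 := by
  have := norm_sub_norm_le x x'
  linarith [H.r1, H.nx']

lemma qf_contDiff : ContDiff ℝ 2 (qf D x' y r) := by
  have := D.smooth
  unfold qf
  have h1 : ContDiff ℝ 2 (fun x => x - x' - (D.τ x / D.τ y) • (y - x')) := by fun_prop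
  have h2 := h1.norm_sq ℝ
  fun_prop

lemma qf_line (x v : En n) (t : ℝ) : HasDerivAt (fun t : ℝ => qf D x' y r (x + t • v))
    (2 * (inner ℝ (x + t • v - x' - (D.τ (x + t • v) / D.τ y) • (y - x'))
      (v - (fderiv ℝ D.τ (x + t • v) v / D.τ y) • (y - x')) : ℝ) / r ^ 2 +
      2 * (D.τ (x + t • v) / D.τ y - 1) * (fderiv ℝ D.τ (x + t • v) v / D.τ y)) t := by
  have h1 := (hasDerivAt_line (x := x) (v := v) (t := t)
    (D.smooth.differentiable (by norm_num) _)).div_const (D.τ y)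
  have h0 : HasDerivAt (fun t : ℝ => x + t • v - x') v t := by
    simpa using (((hasDerivAt_id t).smul_const v).const_add x).sub_const x'
  have h2 := h0.sub (h1.smul_const (y - x'))
  have h3 := (h2.norm_sq.div_const (r ^ 2)).add ((h1.sub_const 1).pow 2)
  have h4 := h3.sub_const 1
  exact h4.congr_deriv (by simp)

lemma qf_fderiv (x v : En n) : fderiv ℝ (qf D x' y r) x v =
    2 * (inner ℝ (x - x' - (D.τ x / D.τ y) • (y - x'))
      (v - (fderiv ℝ D.τ x v / D.τ y) • (y - x')) : ℝ) / r ^ 2 +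
      2 * (D.τ x / D.τ y - 1) * (fderiv ℝ D.τ x v / D.τ y) := by
  have h1 := qf_line (D := D) (x' := x') (y := y) (r := r) x v 0
  have h2 := hasDerivAt_line (x := x) (v := v) (t := 0) (u := qf D x' y r)
    (qf_contDiff.differentiable (by norm_num) _)
  have := h2.unique h1
  simpa using this

lemma qf_Hs (x v : En n) : Hs (qf D x' y r) x v =
    2 * (‖v - (fderiv ℝ D.τ x v / D.τ y) • (y - x')‖ ^ 2 -
      (Hs D.τ x v / D.τ y) * (inner ℝ (x - x' - (D.τ x / D.τ y) • (y - x')) (y - x') : ℝ)) / r ^ 2 +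
      2 * (fderiv ℝ D.τ x v / D.τ y) ^ 2 +
      2 * (D.τ x / D.τ y - 1) * (Hs D.τ x v / D.τ y) := by
  refine Hs_eq_of_line qf_contDiff.contDiffAt (Eventually.of_forall (qf_line x v)) ?_
  have h1 := (hasDerivAt_line (x := x) (v := v) (t := 0)
    (D.smooth.differentiable (by norm_num) _)).div_const (D.τ y)
  have h0 : HasDerivAt (fun t : ℝ => x + t • v - x') v 0 := by
    simpa using (((hasDerivAt_id (0:ℝ)).smul_const v).const_add x).sub_const x'
  have h2 := h0.sub (h1.smul_const (y - x'))
  have h3 := (hasDerivAt_line2 (x := x) (v := v) (t := 0) (u := D.τ)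
    D.smooth.contDiffAt).div_const (D.τ y)
  have h4 := (h3.smul_const (y - x')).const_sub v
  have h5 := ((h2.inner ℝ h4).const_mul 2).div_const (r ^ 2)
  have h6 := ((h1.sub_const 1).const_mul 2).mul h3
  have h7 := h5.add h6
  refine h7.congr_deriv ?_
  simp only [zero_smul, add_zero, inner_neg_right, inner_smul_right, Pi.sub_apply,
    real_inner_self_eq_norm_sq]
  ring

lemma qf_nonpos (H : QH D x' y r k) {x : En n} (hq : qf D x' y r x ≤ 0) :
    ‖x - x' - (D.τ x / D.τ y) • (y - x')‖ ≤ r ∧ |D.τ x / D.τ y - 1| ≤ 1 ∧ ‖x - x'‖ ≤ 5 * r := by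
  have hr := H.r0
  have hr2 : 0 < r ^ 2 := by positivity
  unfold qf at hq
  set Z := ‖x - x' - (D.τ x / D.τ y) • (y - x')‖
  set l := D.τ x / D.τ y
  have hZ0 : 0 ≤ Z := norm_nonneg _
  have h1 : Z ^ 2 / r ^ 2 ≤ 1 := by nlinarith [sq_nonneg (l - 1)]
  have h2 : (l - 1) ^ 2 ≤ 1 := by
    have : 0 ≤ Z ^ 2 / r ^ 2 := by positivity
    linarith
  rw [div_le_one hr2] at h1
  have h3 : Z ≤ r := by nlinarith
  have h4 : |l - 1| ≤ 1 := by
    rw [← sq_abs] at h2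
    nlinarith [abs_nonneg (l - 1)]
  refine ⟨h3, h4, ?_⟩
  have h5 := abs_le.1 h4
  have e : x - x' = (x - x' - l • (y - x')) + l • (y - x') := by abel
  rw [e]
  refine (norm_add_le _ _).trans ?_
  rw [norm_smul, Real.norm_eq_abs]
  have h6 : |l| ≤ 2 := abs_le.2 ⟨by linarith, by linarith⟩
  have h7 : |l| * ‖y - x'‖ ≤ 2 * (2 * r) := by
    have := H.hy
    gcongr
  linarith

lemma qf_ge (x : En n) : -1 ≤ qf D x' y r x := by
  unfold qf; have : 0 ≤ ‖x - x' - (D.τ x / D.τ y) • (y - x')‖ ^ 2 / r ^ 2 := by positivity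
  nlinarith [sq_nonneg (D.τ x / D.τ y - 1)]

lemma qf_dist (H : QH D x' y r k) (x : En n) : ‖x - y‖ ^ 2 ≤ 5 * r ^ 2 * (qf D x' y r x + 1) := by
  have hr := H.r0
  have hr2 : 0 < r ^ 2 := by positivity
  unfold qf
  set l := D.τ x / D.τ y
  set Z := ‖x - x' - l • (y - x')‖
  have e : x - y = (x - x' - l • (y - x')) + (l - 1) • (y - x') := by module
  have h1 : ‖x - y‖ ≤ Z + 2 * r * |l - 1| := by
    rw [e]
    refine (norm_add_le _ _).trans ?_
    rw [norm_smul, Real.norm_eq_abs]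
    have := H.hy
    nlinarith [abs_nonneg (l - 1)]
  have h2 : ‖x - y‖ ^ 2 ≤ (Z + 2 * r * |l - 1|) ^ 2 := pow_le_pow_left₀ (norm_nonneg _) h1 2
  have h3 : 5 * r ^ 2 * (Z ^ 2 / r ^ 2 + (l - 1) ^ 2 - 1 + 1) = 5 * Z ^ 2 + 5 * r ^ 2 * (l - 1) ^ 2 := by
    field_simp; ring
  rw [h3]
  have h4 := sq_abs (l - 1)
  have h5 : (r * (l - 1)) ^ 2 = (r * |l - 1|) ^ 2 := by rw [mul_pow, mul_pow, h4]
  nlinarith [sq_nonneg (2 * Z - r * |l - 1|)]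

lemma qf_Hs_le (H : QH D x' y r k) {x : En n} (hx : ‖x - x'‖ ≤ 10 * r) (v : En n) :
    |Hs (qf D x' y r) x v| ≤ 100 * k ^ 2 / r ^ 2 * ‖v‖ ^ 2 := by
  have hr := H.r0
  have hr1 := H.r1
  have hk1 := H.k1
  have hh := H.h0
  have hK := D.hK
  have hxb := H.ball hx
  have hr2 : 0 < r ^ 2 := by positivity
  have hKh : D.K / D.τ y ≤ k / (10 * r) := by
    rw [div_le_div_iff₀ hh (by positivity)]; linarith [H.hk]
  -- ell bound
  have hl : |D.τ x / D.τ y| ≤ k := by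
    have e1 : |D.τ x - D.τ x'| ≤ D.K * ‖x - x'‖ :=
      Convex.norm_image_sub_le_of_norm_fderiv_le (𝕜 := ℝ) (s := closedBall 0 (D.R + 10))
      (fun z _ => D.smooth.differentiable (by norm_num) z) (fun z hz => D.d1 z (by simpa using hz))
      (convex_closedBall _ _) (by simp; linarith [H.nx']) (by simpa using hxb)
    rw [H.hx', sub_zero] at e1
    rw [abs_div, abs_of_pos hh, div_le_iff₀ hh]
    calc |D.τ x| ≤ D.K * ‖x - x'‖ := e1
      _ ≤ D.K * (10 * r) := by gcongr
      _ = 10 * D.K * r := by ring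
      _ ≤ _ := H.hk
  have hDl : |fderiv ℝ D.τ x v / D.τ y| ≤ k / (10 * r) * ‖v‖ := by
    rw [abs_div, abs_of_pos hh]
    calc |fderiv ℝ D.τ x v| / D.τ y ≤ (D.K * ‖v‖) / D.τ y := by
          gcongr
          exact ((fderiv ℝ D.τ x).le_opNorm v).trans (by gcongr; exact D.d1 x hxb)
      _ = D.K / D.τ y * ‖v‖ := by ring
      _ ≤ _ := by gcongr
  have hHl : |Hs D.τ x v / D.τ y| ≤ k / (10 * r) * ‖v‖ ^ 2 := by
    rw [abs_div, abs_of_pos hh]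
    calc |Hs D.τ x v| / D.τ y ≤ (D.K * ‖v‖ ^ 2) / D.τ y := by
          gcongr
          exact D.Hs_τ hxb v
      _ = D.K / D.τ y * ‖v‖ ^ 2 := by ring
      _ ≤ _ := by gcongr
  rw [qf_Hs]
  set l := D.τ x / D.τ y
  set dl := fderiv ℝ D.τ x v / D.τ y
  set hl2 := Hs D.τ x v / D.τ y
  set e := y - x'
  have he : ‖e‖ ≤ 2 * r := H.hy
  set V := ‖v‖
  have hV : 0 ≤ V := norm_nonneg _
  have b1 : ‖v - dl • e‖ ≤ 2 * k * V := by
    refine (norm_sub_le _ _).trans ?_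
    rw [norm_smul, Real.norm_eq_abs]
    calc V + |dl| * ‖e‖ ≤ V + (k / (10 * r) * V) * (2 * r) := by gcongr
      _ = V + k / 5 * V := by field_simp; ring
      _ ≤ 2 * k * V := by nlinarith
  have b2 : ‖x - x' - l • e‖ ≤ 12 * k * r := by
    refine (norm_sub_le _ _).trans ?_
    rw [norm_smul, Real.norm_eq_abs]
    calc ‖x - x'‖ + |l| * ‖e‖ ≤ 10 * r + k * (2 * r) := by gcongr
      _ ≤ 12 * k * r := by nlinarith
  have b3 : |(inner ℝ (x - x' - l • e) e : ℝ)| ≤ 12 * k * r * (2 * r) := by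
    refine (abs_real_inner_le_norm _ _).trans ?_
    gcongr
  have b4 : |2 * (‖v - dl • e‖ ^ 2 - hl2 * (inner ℝ (x - x' - l • e) e : ℝ)) / r ^ 2| ≤
      20 * k ^ 2 / r ^ 2 * V ^ 2 := by
    rw [abs_div, abs_of_pos hr2, show 20 * k ^ 2 / r ^ 2 * V ^ 2 = (20 * k ^ 2 * V ^ 2) / r ^ 2 by ring]
    refine div_le_div_of_nonneg_right ?_ hr2.le
    rw [abs_mul, abs_two]
    have c1 : |‖v - dl • e‖ ^ 2 - hl2 * (inner ℝ (x - x' - l • e) e : ℝ)| ≤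
        (2 * k * V) ^ 2 + (k / (10 * r) * V ^ 2) * (12 * k * r * (2 * r)) := by
      refine (abs_sub _ _).trans ?_
      rw [abs_mul, abs_of_nonneg (by positivity : 0 ≤ ‖v - dl • e‖ ^ 2)]
      gcongr
    have c2 : (k / (10 * r) * V ^ 2) * (12 * k * r * (2 * r)) = 2.4 * k ^ 2 * V ^ 2 * r := by
      field_simp; ring
    rw [c2] at c1
    have c3 : 2.4 * k ^ 2 * V ^ 2 * r ≤ 2.4 * k ^ 2 * V ^ 2 * 1 := by gcongr; linarith
    nlinarith [sq_nonneg (k * V)]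
  have b5 : |2 * dl ^ 2| ≤ k ^ 2 / r ^ 2 * V ^ 2 := by
    rw [abs_mul, abs_two, abs_pow]
    calc 2 * |dl| ^ 2 ≤ 2 * (k / (10 * r) * V) ^ 2 := by gcongr
      _ = (2 / 100) * (k ^ 2 / r ^ 2 * V ^ 2) := by field_simp; ring
      _ ≤ 1 * (k ^ 2 / r ^ 2 * V ^ 2) := by gcongr; norm_num
      _ = _ := one_mul _
  have b6 : |2 * (l - 1) * hl2| ≤ 4 * k ^ 2 / r ^ 2 * V ^ 2 := by
    rw [abs_mul, abs_mul, abs_two]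
    have : |l - 1| ≤ 2 * k := by
      refine (abs_sub _ _).trans ?_
      rw [abs_one]; linarith
    calc 2 * |l - 1| * |hl2| ≤ 2 * (2 * k) * (k / (10 * r) * V ^ 2) := by gcongr
      _ = 4 * k ^ 2 / r ^ 2 * V ^ 2 * (r / 10) := by field_simp; ring
      _ ≤ 4 * k ^ 2 / r ^ 2 * V ^ 2 * 1 := by gcongr; linarith
      _ = _ := mul_one _
  refine (abs_add_le _ _).trans ?_
  refine (add_le_add (abs_add_le _ _) le_rfl).trans ?_
  have b7 : 0 ≤ k ^ 2 / r ^ 2 * V ^ 2 := by positivity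
  have e1 : 20 * k ^ 2 / r ^ 2 * V ^ 2 = 20 * (k ^ 2 / r ^ 2 * V ^ 2) := by ring
  have e2 : 4 * k ^ 2 / r ^ 2 * V ^ 2 = 4 * (k ^ 2 / r ^ 2 * V ^ 2) := by ring
  have e3 : 100 * k ^ 2 / r ^ 2 * V ^ 2 = 100 * (k ^ 2 / r ^ 2 * V ^ 2) := by ring
  linarith

lemma qf_grad (H : QH D x' y r k) {x : En n} (hq : qf D x' y r x ≤ 0) :
    2 * (qf D x' y r x + 1) - 72 * k * r ≤ fderiv ℝ (qf D x' y r) x (x - y) := by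
  obtain ⟨hZ, hl, hx⟩ := qf_nonpos H hq
  have hr := H.r0
  have hr1 := H.r1
  have hk1 := H.k1
  have hh := H.h0
  have hK := D.hK
  have hxb := H.ball (x := x) (by linarith)
  have hx'b : ‖x'‖ ≤ D.R + 10 := by linarith [H.nx']
  have hyb := H.ball (x := y) (by linarith [H.hy])
  have hr2 : 0 < r ^ 2 := by positivity
  -- approximate derivative identities
  have t1 := taylor2 D.smooth (by linarith) D.d2 hxb hx'b
  have t2 := taylor2 D.smooth (by linarith) D.d2 hxb hyb
  rw [H.hx'] at t1
  have n1 : ‖x' - x‖ ≤ 5 * r := by rw [norm_sub_rev]; exact hx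
  have n2 : ‖y - x‖ ≤ 7 * r := by
    have : y - x = (y - x') - (x - x') := by abel
    rw [this]; refine (norm_sub_le _ _).trans ?_; linarith [H.hy]
  have n1' : D.K * ‖x' - x‖ ^ 2 ≤ D.K * (5 * r) ^ 2 := by gcongr
  have n2' : D.K * ‖y - x‖ ^ 2 ≤ D.K * (7 * r) ^ 2 := by gcongr
  -- Dτ x (x - y) = τ x - τ y + O(49 K r²)
  have a1 : |fderiv ℝ D.τ x (x - y) / D.τ y - (D.τ x / D.τ y - 1)| ≤ 4.9 * k * r := by
    have : fderiv ℝ D.τ x (x - y) / D.τ y - (D.τ x / D.τ y - 1) =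
       (D.τ y - D.τ x - fderiv ℝ D.τ x (y - x)) / D.τ y := by
      have e : x - y = -(y - x) := by abel
      rw [e, map_neg]; field_simp; ring
    rw [this, abs_div, abs_of_pos hh, div_le_iff₀ hh]
    calc _ ≤ D.K * (7 * r) ^ 2 := t2.trans n2'
      _ = 4.9 * r * (10 * D.K * r) := by ring
      _ ≤ 4.9 * r * (k * D.τ y) := mul_le_mul_of_nonneg_left H.hk (by positivity)
      _ = _ := by ring
  rw [qf_fderiv]
  unfold qf
  set l := D.τ x / D.τ y
  set dl := fderiv ℝ D.τ x (x - y) / D.τ y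
  set e := y - x'
  set ζ := x - x' - l • e with hζ
  have hxy : x - y = ζ + (l - 1) • e := by simp only [hζ, e]; module
  have hv : x - y - dl • e = ζ - (dl - (l - 1)) • e := by rw [hxy]; module
  rw [hv, inner_sub_right, inner_smul_right, real_inner_self_eq_norm_sq]
  set θ := dl - (l - 1)
  have hin : |(inner ℝ ζ e : ℝ)| ≤ r * (2 * r) := by
    refine (abs_real_inner_le_norm _ _).trans ?_
    have := H.hy
    gcongr
  have hin2 : |θ * (inner ℝ ζ e : ℝ)| ≤ 4.9 * k * r * (r * (2 * r)) := by
    rw [abs_mul]; gcongr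
  have hl2 : |(l - 1) * θ| ≤ 1 * (4.9 * k * r) := by
    rw [abs_mul]; gcongr
  have hdl : dl = θ + (l - 1) := by simp only [θ]; ring
  have e1 : 2 * (‖ζ‖ ^ 2 - θ * (inner ℝ ζ e : ℝ)) / r ^ 2 + 2 * (l - 1) * dl =
     2 * (‖ζ‖ ^ 2 / r ^ 2 + (l - 1) ^ 2 - 1 + 1) - 2 * (θ * (inner ℝ ζ e : ℝ)) / r ^ 2 + 2 * ((l - 1) * θ) := by
    rw [hdl]; ring
  rw [e1]
  have e2 : 2 * (θ * (inner ℝ ζ e : ℝ)) / r ^ 2 ≤ 2 * (4.9 * k * r * (r * (2 * r))) / r ^ 2 := by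
    exact div_le_div_of_nonneg_right (by linarith [(abs_le.1 hin2).2]) hr2.le
  have e3 : 2 * (4.9 * k * r * (r * (2 * r))) / r ^ 2 = 19.6 * k * r := by field_simp; ring
  rw [e3] at e2
  have e4 := (abs_le.1 hl2).1
  have : 0 ≤ k * r := by positivity
  linarith

end

def Vf {n : ℕ} (D : Dom n) (x' y : En n) (r η α : ℝ) (x : En n) : ℝ :=
  η * r * exp (-α) * (exp (-(α * qf D x' y r x)) - 1)

section
variable {n : ℕ} {D : Dom n} {x' y : En n} {r k η α : ℝ}

lemma Vf_contDiff : ContDiff ℝ 2 (Vf D x' y r η α) := by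
  have := qf_contDiff (D := D) (x' := x') (y := y) (r := r)
  unfold Vf
  fun_prop

lemma Vf_Hs (x v : En n) : Hs (Vf D x' y r η α) x v =
    η * r * exp (-(α * (1 + qf D x' y r x))) * (α ^ 2 * (fderiv ℝ (qf D x' y r) x v) ^ 2 -
      α * Hs (qf D x' y r) x v) := by
  have h0 : ∀ t : ℝ, HasDerivAt (fun t => exp (-(α * t))) (-α * exp (-(α * t))) t := by
    intro t
    have : HasDerivAt (fun t => -(α * t)) (-α) t := by
      exact (((hasDerivAt_id t).const_mul α).neg).congr_deriv (by simp)
    exact this.exp.congr_deriv (by ring)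
  have h1 : ∀ t : ℝ, HasDerivAt (fun t => η * r * exp (-α) * (exp (-(α * t)) - 1))
     (η * r * exp (-α) * (-α * exp (-(α * t)))) t := fun t =>
    ((h0 t).sub_const 1).const_mul _
  have h2 : ∀ t : ℝ, HasDerivAt (fun t => η * r * exp (-α) * (-α * exp (-(α * t))))
     (η * r * exp (-α) * (-α * (-α * exp (-(α * t))))) t := fun t =>
    ((h0 t).const_mul _).const_mul _
  have := Hs_comp (q := qf D x' y r) (x := x) qf_contDiff.contDiffAt
    (Θ := fun t => η * r * exp (-α) * (exp (-(α * t)) - 1))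
    (by fun_prop) (Eventually.of_forall h1) (h2 _) v
  refine Eq.trans this ?_
  have e : exp (-(α * (1 + qf D x' y r x))) = exp (-α) * exp (-(α * qf D x' y r x)) := by
    rw [← exp_add]; congr 1; ring
  rw [e]; ring

lemma Vf_le (H : QH D x' y r k) (hη : 0 < η) (hα : 0 < α) (x : En n) : Vf D x' y r η α x ≤ η * r := by
  unfold Vf
  have hr := H.r0
  have h1 := qf_ge (D := D) (x' := x') (y := y) (r := r) x
  have h2 : exp (-α) * (exp (-(α * qf D x' y r x)) - 1) ≤ 1 := by
    rw [mul_sub, ← exp_add]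
    have : exp (-α + -(α * qf D x' y r x)) ≤ 1 := by
      rw [exp_le_one_iff]; nlinarith
    have := exp_pos (-α)
    linarith
  have h3 : 0 ≤ η * r := by positivity
  calc _ = η * r * (exp (-α) * (exp (-(α * qf D x' y r x)) - 1)) := by ring
    _ ≤ η * r * 1 := by gcongr
    _ = _ := mul_one _

lemma Vf_pos (H : QH D x' y r k) (hη : 0 < η) (hα : 0 < α) {x : En n} :
    0 < Vf D x' y r η α x ↔ qf D x' y r x < 0 := by
  unfold Vf
  have hr := H.r0
  have h3 : 0 < η * r * exp (-α) := by positivity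
  rw [mul_pos_iff_of_pos_left h3, sub_pos, one_lt_exp_iff]
  constructor
  · intro h; nlinarith
  · intro h; nlinarith

lemma Vf_Hs_ge (H : QH D x' y r k) (hη : 0 < η) (hα : 0 < α) {x : En n}
    (hx : ‖x - x'‖ ≤ 10 * r) (v : En n) :
    - (η * α * (100 * k ^ 2) / r * ‖v‖ ^ 2) ≤ Hs (Vf D x' y r η α) x v := by
  rw [Vf_Hs]
  have hr := H.r0
  have h1 := qf_ge (D := D) (x' := x') (y := y) (r := r) x
  have h2 := (abs_le.1 (qf_Hs_le H hx v)).2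
  have h3 : exp (-(α * (1 + qf D x' y r x))) ≤ 1 := by
    rw [exp_le_one_iff]; nlinarith
  set E := exp (-(α * (1 + qf D x' y r x)))
  have hE : 0 < E := exp_pos _
  set B := 100 * k ^ 2 / r ^ 2 * ‖v‖ ^ 2 with hB
  have hB0 : 0 ≤ B := by positivity
  have h4 : - (α * B) ≤ α ^ 2 * (fderiv ℝ (qf D x' y r) x v) ^ 2 - α * Hs (qf D x' y r) x v := by
    have : 0 ≤ α ^ 2 * (fderiv ℝ (qf D x' y r) x v) ^ 2 := by positivity
    nlinarith
  have h5 : η * α * (100 * k ^ 2) / r * ‖v‖ ^ 2 = η * r * (α * B) := by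
    rw [hB]; field_simp
  rw [h5]
  have h6 : η * r * E * (-(α * B)) ≤ η * r * E * (α ^ 2 * (fderiv ℝ (qf D x' y r) x v) ^ 2 - α * Hs (qf D x' y r) x v) :=
    mul_le_mul_of_nonneg_left h4 (by positivity)
  have h7 : η * r * (α * B) * E ≤ η * r * (α * B) * 1 := mul_le_mul_of_nonneg_left h3 (by positivity)
  linarith

lemma Vf_lap (H : QH D x' y r k) (hη : 0 < η) (hα : 0 < α) {κ : ℝ} (hκ : 0 < κ) {x : En n}
    (hq : qf D x' y r x ≤ 0) (hx : κ * r ≤ ‖x - y‖) (h72 : 72 * k * r ≤ κ ^ 2 / 5)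
    (hα2 : 225 * (n * (100 * k ^ 2) + 1) ≤ α * κ ^ 4) :
    η * α * exp (-α) / r ≤ lap n (Vf D x' y r η α) x := by
  have hr := H.r0
  have hr2 : 0 < r ^ 2 := by positivity
  obtain ⟨_, _, hx5⟩ := qf_nonpos H hq
  have hd := qf_dist H x
  have hg := qf_grad H hq
  have q1 : κ ^ 2 / 5 ≤ qf D x' y r x + 1 := by
    have : (κ * r) ^ 2 ≤ ‖x - y‖ ^ 2 := pow_le_pow_left₀ (by positivity) hx 2
    have h2 : κ ^ 2 * r ^ 2 ≤ (5 * (qf D x' y r x + 1)) * r ^ 2 := by nlinarith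
    have := le_of_mul_le_mul_right h2 hr2
    linarith
  have q2 : ‖x - y‖ ≤ 3 * r := by
    have : ‖x - y‖ ^ 2 ≤ (3 * r) ^ 2 := by nlinarith
    exact le_of_sq_le_sq this (by positivity)
  set L := fderiv ℝ (qf D x' y r) x
  have q3 : κ ^ 2 / 5 ≤ ‖L‖ * (3 * r) := by
    calc κ ^ 2 / 5 ≤ L (x - y) := by linarith
      _ ≤ ‖L (x - y)‖ := le_abs_self _
      _ ≤ ‖L‖ * ‖x - y‖ := L.le_opNorm _
      _ ≤ _ := by gcongr
  have q4 : κ ^ 4 / 225 ≤ ‖L‖ ^ 2 * r ^ 2 := by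
    have := pow_le_pow_left₀ (by positivity) q3 2
    nlinarith
  rw [lap_eq_sum Vf_contDiff.contDiffAt]
  simp_rw [Vf_Hs]
  rw [← Finset.mul_sum, Finset.sum_sub_distrib, ← Finset.mul_sum, ← Finset.mul_sum, sum_sq_single]
  have q5 : ∑ i : Fin n, Hs (qf D x' y r) x (EuclideanSpace.single i 1) ≤ n * (100 * k ^ 2 / r ^ 2) := by
    calc _ ≤ ∑ i : Fin n, 100 * k ^ 2 / r ^ 2 := by
          refine Finset.sum_le_sum fun i _ => ?_
          have := (abs_le.1 (qf_Hs_le H (x := x) (by linarith) (EuclideanSpace.single i 1))).2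
          simpa using this
      _ = _ := by simp
  set S := ∑ i : Fin n, Hs (qf D x' y r) x (EuclideanSpace.single i 1)
  have q6 : exp (-α) ≤ exp (-(α * (1 + qf D x' y r x))) := by
    rw [exp_le_exp]; nlinarith
  set E := exp (-(α * (1 + qf D x' y r x)))
  have hE := exp_pos (-α)
  have q7 : α / r ^ 2 ≤ α ^ 2 * ‖L‖ ^ 2 - α * S := by
    have e1 : α * (n * (100 * k ^ 2 / r ^ 2)) = α * n * (100 * k ^ 2) / r ^ 2 := by ring
    have e2 : α * S ≤ α * n * (100 * k ^ 2) / r ^ 2 := by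
      rw [← e1]; exact mul_le_mul_of_nonneg_left q5 hα.le
    have e3 : α / r ^ 2 + α * n * (100 * k ^ 2) / r ^ 2 ≤ α ^ 2 * ‖L‖ ^ 2 := by
      rw [← add_div, div_le_iff₀ hr2]
      have : α * (n * (100 * k ^ 2) + 1) ≤ α * (α * (‖L‖ ^ 2 * r ^ 2)) := by
        refine mul_le_mul_of_nonneg_left ?_ hα.le
        have := mul_le_mul_of_nonneg_left q4 hα.le
        linarith
      linarith
    linarith
  calc η * α * exp (-α) / r = η * r * exp (-α) * (α / r ^ 2) := by field_simp
    _ ≤ η * r * E * (α / r ^ 2) := by gcongr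
    _ ≤ _ := mul_le_mul_of_nonneg_left q7 (by positivity)

lemma sq_le_kap_r {s : ℝ} (hs : s ∈ Ioo (0:ℝ) 1) (hr : 0 < r) (hr1 : r ≤ 1) {z : En n} (hz : ‖z‖ ≤ r) :
    ‖z‖ ^ 2 / r ≤ r ^ (-s) * kap s z := by
  have hk : kap s z = ‖z‖ ^ (1 + s) := by
    unfold kap
    exact min_eq_left (Real.rpow_le_one (norm_nonneg _) (hz.trans hr1) (by linarith [hs.1]))
  rw [hk]
  rcases (norm_nonneg z).eq_or_lt with h | h
  · rw [← h]; simp; positivity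
  · have e1 : ‖z‖ ^ 2 = ‖z‖ ^ (1 + s) * ‖z‖ ^ (1 - s) := by
      rw [← Real.rpow_add h, ← Real.rpow_natCast]; congr 1; push_cast; ring
    have e2 : r ^ (-s) = r ^ (1 - s) / r := by
      rw [Real.rpow_sub hr, Real.rpow_neg hr.le, Real.rpow_one]; field_simp
    rw [e1, e2, div_mul_eq_mul_div, mul_comm]
    have : ‖z‖ ^ (1 - s) ≤ r ^ (1 - s) := Real.rpow_le_rpow h.le hz (by linarith [hs.2])
    gcongr

lemma one_le_kap {s ρ : ℝ} (hs : s ∈ Ioo (0:ℝ) 1) (hρ : 0 < ρ) (hρ1 : ρ ≤ 1) {z : En n} (hz : ρ ≤ ‖z‖) :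
    1 ≤ ρ ^ (-(1 + s)) * kap s z := by
  have := kap_ge hs.1 hρ hρ1 hz
  rw [Real.rpow_neg hρ.le]
  have h2 : 0 < ρ ^ (1 + s) := by positivity
  rw [← div_eq_inv_mul, one_le_div h2]; exact this

lemma hopf_cmp (hn : 1 ≤ n) {s a : ℝ} (hs : s ∈ Ioo (0:ℝ) 1) (ha : 0 ≤ a) (H : QH D x' y r k)
    (hη : 0 < η) (hα : 0 < α) {κ M r' : ℝ} (hκ : 0 < κ) (hM : 0 ≤ M) (hr' : 0 < r') (hr'1 : r' ≤ 1)
    {w : En n → ℝ} (hwc : Continuous w) (hw0 : ∀ x, D.τ x ≤ 0 → w x = 0)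
    (hwn : ∀ x, 0 < D.τ x → Nice w x) (hwM : ∀ x, -M ≤ w x)
    (hwp : ∀ x, 0 < D.τ x → D.τ x < r' → 0 ≤ w x)
    (hLw : ∀ x, 0 < D.τ x → D.τ x < r' → 0 ≤ - lap n w x + a * fracLap n s w x)
    (hb : ∀ x, ‖x - y‖ ≤ κ * r → η * r ≤ w x)
    (h8 : 8 * D.K * r ≤ r')
    (h72 : 72 * k * r ≤ κ ^ 2 / 5)
    (hα2 : 225 * (n * (100 * k ^ 2) + 1) ≤ α * κ ^ 4)
    (hsm : a * (((η * α * (100 * k ^ 2) + 2 * η) * r ^ (-s) + 2 * M * (r' / (2 * D.K)) ^ (-(1 + s))) * IK n s) <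
      η * α * exp (-α) / r) {x : En n} (hx : qf D x' y r x ≤ 0) : Vf D x' y r η α x ≤ w x := by
  by_contra hcon
  push Not at hcon
  have hr := H.r0
  have hr1 := H.r1
  have hK := D.hK
  set V := Vf D x' y r η α with hVdef
  have hVc : Continuous V := Vf_contDiff.continuous
  have hqc : Continuous (qf D x' y r) := qf_contDiff.continuous
  set S := {z | qf D x' y r z ≤ 0} with hS
  have hSc : IsCompact S := by
    refine Metric.isCompact_of_isClosed_isBounded (isClosed_le hqc continuous_const) ?_
    refine (isBounded_closedBall (x := x') (r := 5 * r)).subset fun z hz => ?_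
    rw [mem_closedBall, dist_eq_norm]; exact (qf_nonpos H hz).2.2
  obtain ⟨p, hpS, hpm⟩ := hSc.exists_isMaxOn ⟨x, hx⟩ (hVc.sub hwc).continuousOn
  have hp1 : V x - w x ≤ V p - w p := hpm hx
  have hpm' : ∀ z, qf D x' y r z ≤ 0 → V z - w z ≤ V p - w p := fun z hz => hpm hz
  have hτy : D.τ y ≤ 2 * D.K * r := by
    have := D.lip y x'
    rw [H.hx', max_self, sub_zero, max_eq_left H.h0.le, abs_of_pos H.h0] at this
    nlinarith [H.hy]
  have hτS : ∀ z, qf D x' y r z ≤ 0 → 0 ≤ D.τ z ∧ D.τ z ≤ r' / 2 := by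
    intro z hz
    obtain ⟨_, h2, _⟩ := qf_nonpos H hz
    have h3 := abs_le.1 h2
    have h4 : D.τ z = D.τ z / D.τ y * D.τ y := by have := H.h0; field_simp
    have h0 := H.h0
    constructor
    · rw [h4]; exact mul_nonneg (by linarith) h0.le
    · rw [h4]; nlinarith
  have hwS : ∀ z, D.τ z < r' → 0 ≤ w z := by
    intro z hz
    rcases le_or_gt (D.τ z) 0 with h | h
    · rw [hw0 z h]
    · exact hwp z h hz
  have hVp : 0 < V p := by
    have := hwS p (by linarith [(hτS p hpS).2])
    linarith
  have hqp : qf D x' y r p < 0 := (Vf_pos H hη hα).1 hVp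
  have hτp : 0 < D.τ p := by
    rcases (hτS p hpS).1.eq_or_lt with h | h
    · exfalso
      unfold qf at hqp
      rw [← h] at hqp
      have : 0 ≤ ‖p - x' - (0 / D.τ y) • (y - x')‖ ^ 2 / r ^ 2 := by positivity
      norm_num at hqp; norm_num at this; linarith
    · exact h
  have hτp2 : D.τ p ≤ r' / 2 := (hτS p hpS).2
  have hpy : κ * r ≤ ‖p - y‖ := by
    by_contra h
    have h1 := hb p (not_le.1 h).le
    have h2 := Vf_le H hη hα p
    linarith
  have hlapV := Vf_lap H hη hα hκ hqp.le hpy h72 hα2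
  set m := V p - w p with hm
  have hm0 : 0 < m := by linarith
  -- lower bound of w - V⁺
  have g1 : ∀ z, D.τ z < r' → -m ≤ w z - max (V z) 0 := by
    intro z hz
    rcases le_or_gt (qf D x' y r z) 0 with h | h
    · have h1 := hpm' z h
      have h2 := hwS z hz
      rcases max_cases (V z) 0 with ⟨h3, _⟩ | ⟨h3, _⟩ <;> rw [h3] <;> linarith
    · have h1 : V z ≤ 0 := by
        by_contra h2
        linarith [(Vf_pos H hη hα).1 (not_le.1 h2)]
      rw [max_eq_right h1]; linarith [hwS z hz]
  have g2 : ∀ z, -M - m ≤ w z - max (V z) 0 := by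
    intro z
    rcases lt_or_ge (D.τ z) r' with h | h
    · linarith [g1 z h]
    · have h1 : V z ≤ 0 := by
        by_contra h2
        linarith [(hτS z ((Vf_pos H hη hα).1 (not_le.1 h2)).le).2]
      rw [max_eq_right h1]; linarith [hwM z]
  set d := r' / (2 * D.K) with hd
  have hd0 : 0 < d := by positivity
  have hd1 : d ≤ 1 := by rw [hd, div_le_one (by positivity)]; linarith
  have hKd : D.K * d = r' / 2 := by rw [hd]; field_simp
  have g3 : ∀ z, ‖z‖ < d → D.τ (p + z) < r' := by
    intro z hz
    have h1 := D.lip (p + z) p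
    rw [add_sub_cancel_left, max_eq_left hτp.le] at h1
    have h2 := (abs_le.1 h1).2
    have h3 : D.K * ‖z‖ < D.K * d := mul_lt_mul_of_pos_left hz (by linarith)
    linarith [le_max_left (D.τ (p + z)) 0]
  have hkz := fun z : En n => kap_nonneg s z
  have gm : w p - max (V p) 0 = -m := by rw [max_eq_left hVp.le]; linarith
  have s1 : ∀ z, ‖z‖ < d → sdf (fun z => max (V z) 0) p z ≤ sdf w p z := by
    intro z hz
    have h1 := g1 _ (g3 z hz)
    have h2 := g1 _ (g3 (-z) (by simpa using hz))
    rw [← sub_eq_add_neg] at h2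
    unfold sdf; linarith
  have s2 : ∀ z, sdf (fun z => max (V z) 0) p z - 2 * M * d ^ (-(1 + s)) * kap s z ≤ sdf w p z := by
    intro z
    have hdp : 0 < d ^ (-(1 + s)) := by positivity
    rcases lt_or_ge ‖z‖ d with h | h
    · have := s1 z h
      have : 0 ≤ 2 * M * d ^ (-(1 + s)) * kap s z := mul_nonneg (by positivity) (hkz z)
      linarith
    · have h1 := g2 (p + z)
      have h2 := g2 (p - z)
      have h3 := one_le_kap hs hd0 hd1 h
      have h4 : 2 * M * 1 ≤ 2 * M * (d ^ (-(1 + s)) * kap s z) := by gcongr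
      unfold sdf; linarith
  have s3 : ∀ z, -((η * α * (100 * k ^ 2) + 2 * η) * r ^ (-s) * kap s z) ≤ sdf (fun z => max (V z) 0) p z := by
    intro z
    have hrs : 0 < r ^ (-s) := by positivity
    have hrk : 0 ≤ r ^ (-s) * kap s z := mul_nonneg hrs.le (hkz z)
    rcases le_or_gt ‖z‖ r with h | h
    · have h1 : sdf V p z ≤ sdf (fun z => max (V z) 0) p z := by
        unfold sdf
        have e : max (V p) 0 = V p := max_eq_left hVp.le
        simp only [e]
        linarith [le_max_left (V (p + z)) 0, le_max_left (V (p - z)) 0]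
      have h2 : -(η * α * (100 * k ^ 2) / r * ‖z‖ ^ 2) ≤ sdf V p z := by
        refine le_sdf (fun t _ => Vf_contDiff.contDiffAt) fun t ht => ?_
        refine Vf_Hs_ge H hη hα ?_ z
        have h3 := line_norm (x := p) (y := z) ht
        have h4 := (qf_nonpos H hpS).2.2
        have : p + t • z - x' = (p + t • z - p) + (p - x') := by abel
        rw [this]
        refine (norm_add_le _ _).trans ?_
        linarith
      have h3 := sq_le_kap_r hs hr (by linarith) h
      have h4 : η * α * (100 * k ^ 2) * (‖z‖ ^ 2 / r) ≤ η * α * (100 * k ^ 2) * (r ^ (-s) * kap s z) :=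
        mul_le_mul_of_nonneg_left h3 (by positivity)
      have h5 : η * α * (100 * k ^ 2) / r * ‖z‖ ^ 2 = η * α * (100 * k ^ 2) * (‖z‖ ^ 2 / r) := by ring
      have h6 : 0 ≤ 2 * η * (r ^ (-s) * kap s z) := by positivity
      linarith
    · have h1 := one_le_kap hs hr (by linarith) h.le
      have h2 : r ^ (-(1 + s)) = r ^ (-s) / r := by
        rw [neg_add, add_comm, Real.rpow_add hr, Real.rpow_neg_one]; rfl
      rw [h2] at h1
      have h3 : r ≤ r ^ (-s) * kap s z := by
        have := mul_le_mul_of_nonneg_left h1 hr.le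
        have e : r * (r ^ (-s) / r * kap s z) = r ^ (-s) * kap s z := by field_simp
        linarith
      have h4 := Vf_le H hη hα p
      have h5 : 2 * η * r ≤ 2 * η * (r ^ (-s) * kap s z) := by gcongr
      have h6 : 0 ≤ η * α * (100 * k ^ 2) * (r ^ (-s) * kap s z) := by positivity
      unfold sdf
      have e : max (V p) 0 = V p := max_eq_left hVp.le
      simp only [e]
      linarith [le_max_right (V (p + z)) 0, le_max_right (V (p - z)) 0]
  have f1 := fracLap_le_of_le_sdf (hwn p hτp) hn hs
    (C := (η * α * (100 * k ^ 2) + 2 * η) * r ^ (-s) + 2 * M * d ^ (-(1 + s))) (fun z => by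
      have := s2 z; have := s3 z; linarith)
  have f2 : lap n V p ≤ lap n w p := by
    refine lap_le_of_sdf Vf_contDiff.contDiffAt (hwn p hτp).c2 ?_
    filter_upwards [Metric.ball_mem_nhds (0 : En n) hd0] with z hz
    have hz' : ‖z‖ < d := by simpa using hz
    refine le_trans ?_ (s1 z hz')
    unfold sdf
    have e : max (V p) 0 = V p := max_eq_left hVp.le
    simp only [e]
    linarith [le_max_left (V (p + z)) 0, le_max_left (V (p - z)) 0]
  have f3 := hLw p hτp (by linarith)
  have f4 := mul_le_mul_of_nonneg_left f1 ha
  linarith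

end

set_option maxHeartbeats 1600000 in
lemma Sol.hopf {n : ℕ} {D : Dom n} {s a lam : ℝ} {u : En n → ℝ} (h : Sol D s a lam u)
    {A δ : ℝ} (hA : 0 < A) (hδ : 0 < δ) :
    ∃ β c1 : ℝ, 0 < β ∧ 0 < c1 ∧ ∀ ω : ℝ, 0 < ω → ω ≤ 1 → ∀ r' : ℝ, 0 < r' →
      (∀ x, 0 < D.τ x → D.τ x < r' → u x ≤ (A + ω) * D.W s x) →
      ∃ ρ0, 0 < ρ0 ∧ ∀ r, 0 < r → r < ρ0 → ∀ x' y, D.τ x' = 0 → ‖x'‖ ≤ D.R + 1 → ‖y - x'‖ ≤ 2 * r →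
        0 < D.τ y → δ * r ≤ A * D.W s y - u y → ∀ x, 0 < D.τ x → ‖x - x'‖ ≤ 2 / D.c0 * D.τ x →
        D.τ x ≤ c1 * D.τ y → β * D.τ x ≤ (A + ω) * D.W s x - u x := by
  obtain ⟨C, hC, huC⟩ := h.abs_le_tau
  obtain ⟨CL, hCL, hLip⟩ := h.lipschitz
  obtain ⟨M, hM, huM⟩ := h.bdd
  have hK := D.hK
  have hc0 := D.hc0
  have hs := h.hs
  have hn := h.hn
  have ha := h.ha
  obtain ⟨t1, ht1, ht10, hWop⟩ := D.W_op hn hs ha (|lam| * M / A)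
  set δ1 := δ / (A + C) with hδ1
  have hδ10 : 0 < δ1 := by positivity
  set k := max 1 (10 * D.K / δ1) with hk
  have hk1 : 1 ≤ k := le_max_left _ _
  have hk2 : 10 * D.K ≤ k * δ1 := by
    have : 10 * D.K / δ1 ≤ k := le_max_right _ _
    rwa [div_le_iff₀ hδ10] at this
  set Lw := (A + 1) * D.K + CL with hLw
  have hLw0 : 0 < Lw := by positivity
  set κ := δ / (2 * Lw) with hκ
  have hκ0 : 0 < κ := by positivity
  set η := δ / 2 with hη
  have hη0 : 0 < η := by positivity
  set α := 225 * (n * (100 * k ^ 2) + 1) / κ ^ 4 with hα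
  have hα0 : 0 < α := by positivity
  have hα2 : 225 * (n * (100 * k ^ 2) + 1) ≤ α * κ ^ 4 := by
    rw [hα, div_mul_cancel₀ _ (by positivity)]
  set g := 4 * D.K / D.c0 + 2 with hg
  have hg0 : 0 < g := by positivity
  set c1 := 1 / (g ^ 2 + 1) with hc1
  set β := η * α * exp (-α) / (2 * D.K) with hβ
  have hexp := exp_pos (-α)
  refine ⟨β, c1, by positivity, by positivity, fun ω hω hω1 r1 hr1 hur => ?_⟩
  set r' := min r1 (min t1 1) with hr'
  have hr'0 : 0 < r' := by positivity
  have hr'1 : r' ≤ 1 := (min_le_right _ _).trans (min_le_right _ _)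
  have hr't : r' ≤ t1 := (min_le_right _ _).trans (min_le_left _ _)
  have hr'r : r' ≤ r1 := min_le_left _ _
  -- smallness
  set C1 := η * α * (100 * k ^ 2) + 2 * η
  set C2 := 2 * M * (r' / (2 * D.K)) ^ (-(1 + s))
  have hev : ∀ᶠ r in 𝓝[>] (0:ℝ), a * ((C1 * r ^ (1 - s) + C2 * r) * IK n s) < η * α * exp (-α) := by
    have hcont : Continuous (fun r : ℝ => a * ((C1 * r ^ (1 - s) + C2 * r) * IK n s)) := by
      have : Continuous (fun r : ℝ => r ^ (1 - s)) :=
        continuous_id.rpow_const fun x => Or.inr (by linarith [hs.2])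
      fun_prop
    have h0 : a * ((C1 * (0:ℝ) ^ (1 - s) + C2 * 0) * IK n s) = 0 := by
      rw [Real.zero_rpow (by linarith [hs.2])]; ring
    have := (hcont.tendsto 0).mono_left (nhdsWithin_le_nhds (s := Ioi 0))
    rw [h0] at this
    exact this.eventually (gt_mem_nhds (by positivity))
  obtain ⟨ρ1, hρ1, hρ⟩ := mem_nhdsGT_iff_exists_Ioo_subset.1 hev
  have hρ1 : 0 < ρ1 := hρ1
  refine ⟨min ρ1 (min (1 / 2) (min (r' / (8 * D.K)) (κ ^ 2 / 5 / (72 * k)))), by positivity, ?_⟩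
  intro r hr hrρ x' y hx' hnx' hyx' hτy hδr x hτx hxx' hxy
  have hrρ1 : r < ρ1 := hrρ.trans_le (min_le_left _ _)
  have hrh : r ≤ 1 / 2 := hrρ.le.trans ((min_le_right _ _).trans (min_le_left _ _))
  have hr8 : 8 * D.K * r ≤ r' := by
    have : r ≤ r' / (8 * D.K) :=
      hrρ.le.trans ((min_le_right _ _).trans ((min_le_right _ _).trans (min_le_left _ _)))
    rw [le_div_iff₀ (by positivity)] at this; linarith
  have hr72 : 72 * k * r ≤ κ ^ 2 / 5 := by
    have : r ≤ κ ^ 2 / 5 / (72 * k) :=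
      hrρ.le.trans ((min_le_right _ _).trans ((min_le_right _ _).trans (min_le_right _ _)))
    rw [le_div_iff₀ (by positivity)] at this; linarith
  have hsm : a * ((C1 * r ^ (-s) + C2) * IK n s) < η * α * exp (-α) / r := by
    have h1 : a * ((C1 * r ^ (1 - s) + C2 * r) * IK n s) < η * α * exp (-α) := hρ ⟨hr, hrρ1⟩
    rw [lt_div_iff₀ hr]
    have e : r ^ (1 - s) = r ^ (-s) * r := by
      rw [sub_eq_neg_add, Real.rpow_add hr, Real.rpow_one]
    rw [e] at h1
    calc _ = a * ((C1 * (r ^ (-s) * r) + C2 * r) * IK n s) := by ring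
      _ < _ := h1
  have hdrad : δ1 * r ≤ D.τ y := by
    have h1 := (abs_le.1 (huC y)).1
    have h2 := D.W_le (s := s) y
    rw [max_eq_left hτy.le] at h1 h2
    have h3 : A * D.W s y ≤ A * D.τ y := by gcongr
    have h4 : δ * r ≤ (A + C) * D.τ y := by linarith
    rw [hδ1, div_mul_eq_mul_div, div_le_iff₀ (by positivity)]; linarith
  have H : QH D x' y r k := ⟨hr, hrh, hx', hnx', hyx', hτy, by
    have h1 := mul_le_mul_of_nonneg_left hdrad (by linarith : 0 ≤ k)
    nlinarith, hk1⟩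
  set w := fun x => (A + ω) * D.W s x - u x with hw
  have hwn : ∀ x, 0 < D.τ x → Nice w x := by
    intro x hx
    have := ((D.W_nice hs hx).const_mul (A + ω)).add (h.nice hx).neg
    simpa only [hw, sub_eq_add_neg] using this
  have hVw : ∀ x, qf D x' y r x ≤ 0 → Vf D x' y r η α x ≤ w x := by
    intro x hx
    refine hopf_cmp hn hs ha H hη0 hα0 hκ0 hM.le hr'0 hr'1 (w := w) ?_ ?_ hwn ?_ ?_ ?_ ?_ hr8 hr72 hα2 hsm hx
    · exact ((D.W_cont hs).const_mul _).sub h.cont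
    · intro x hx; simp only [hw]; rw [D.W_zero hs hx, h.zero x hx]; ring
    · intro x
      have h1 := (abs_le.1 (huM x)).2
      have h2 := D.W_nonneg hs x
      have : 0 ≤ (A + ω) * D.W s x := by positivity
      simp only [hw]; linarith
    · intro x hx hx2
      have := hur x hx (hx2.trans_le hr'r)
      simp only [hw]; linarith
    · intro x hx hx2
      have h1 := hWop x hx (hx2.trans_le hr't)
      have h2 := h.eq x hx
      have e1 : lap n w x = (A + ω) * lap n (D.W s) x - lap n u x := by
        rw [hw, lap_sub (contDiffAt_const.mul (D.W_cd hx)) (h.c2 x hx), lap_const_mul (D.W_cd hx)]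
      have e2 : fracLap n s w x = (A + ω) * fracLap n s (D.W s) x - fracLap n s u x := by
        have := fracLap_add hn hs ((D.W_nice hs hx).const_mul (A + ω)) (h.nice hx).neg
        rw [fracLap_const_mul, fracLap_neg] at this
        rw [sub_eq_add_neg, ← this]
        simp only [hw, sub_eq_add_neg]
      rw [e1, e2]
      have h3 : |lam| * M ≤ (A + ω) * (-lap n (D.W s) x + a * fracLap n s (D.W s) x) := by
        calc |lam| * M = A * (|lam| * M / A) := by field_simp
          _ ≤ (A + ω) * (|lam| * M / A) := by gcongr; linarith
          _ ≤ _ := by gcongr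
      have h4 : lam * u x ≤ |lam| * M := by
        refine (le_abs_self _).trans ?_
        rw [abs_mul]; gcongr; exact huM x
      linarith
    · intro x hx
      have h1 := (abs_le.1 (D.W_lip hs x y)).1
      have h2 := (abs_le.1 (hLip x y)).2
      have h3 : (A + ω) * (D.W s y - D.W s x) ≤ (A + 1) * (D.K * ‖x - y‖) := by
        calc _ ≤ (A + ω) * (D.K * ‖x - y‖) := by gcongr; linarith
          _ ≤ _ := by gcongr
      have h4 : Lw * ‖x - y‖ ≤ Lw * (κ * r) := by gcongr
      have h5 : Lw * (κ * r) = δ / 2 * r := by rw [hκ]; field_simp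
      have h6 : 0 ≤ ω * D.W s y := mul_nonneg hω.le (D.W_nonneg hs y)
      have h7 : Lw * ‖x - y‖ = (A + 1) * (D.K * ‖x - y‖) + CL * ‖x - y‖ := by rw [hLw]; ring
      simp only [hw, hη]
      linarith
  -- evaluate
  have hτyr : D.τ y ≤ 2 * D.K * r := by
    have := D.lip y x'
    rw [hx', max_self, sub_zero, max_eq_left hτy.le, abs_of_pos hτy] at this
    nlinarith
  set l := D.τ x / D.τ y with hl
  have hl0 : 0 < l := by positivity
  have hτl : D.τ x = l * D.τ y := by rw [hl]; field_simp
  have hlc : l * (g ^ 2 + 1) ≤ 1 := by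
    have : l ≤ c1 := by rw [hl, div_le_iff₀ hτy]; exact hxy
    rwa [hc1, le_div_iff₀ (by positivity)] at this
  have hq : qf D x' y r x ≤ -l := by
    unfold qf
    rw [← hl]
    have n1 : ‖x - x' - l • (y - x')‖ ≤ l * r * g := by
      refine (norm_sub_le _ _).trans ?_
      rw [norm_smul, Real.norm_eq_abs, abs_of_pos hl0]
      calc ‖x - x'‖ + l * ‖y - x'‖ ≤ 2 / D.c0 * (l * (2 * D.K * r)) + l * (2 * r) := by
            refine add_le_add (hxx'.trans ?_) (by gcongr)
            rw [hτl]; gcongr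
        _ = l * r * g := by rw [hg]; ring
    have n2 : ‖x - x' - l • (y - x')‖ ^ 2 / r ^ 2 ≤ l ^ 2 * g ^ 2 := by
      rw [div_le_iff₀ (by positivity)]
      have := pow_le_pow_left₀ (norm_nonneg _) n1 2
      linarith [this, show (l * r * g) ^ 2 = l ^ 2 * g ^ 2 * r ^ 2 by ring]
    nlinarith
  have hV := hVw x (by linarith)
  refine le_trans ?_ hV
  unfold Vf
  have e1 : α * l ≤ exp (-(α * qf D x' y r x)) - 1 := by
    have h1 := add_one_le_exp (-(α * qf D x' y r x))
    nlinarith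
  calc β * D.τ x = η * α * exp (-α) / (2 * D.K) * (l * D.τ y) := by rw [hτl]
    _ ≤ η * α * exp (-α) / (2 * D.K) * (l * (2 * D.K * r)) := by gcongr
    _ = η * r * exp (-α) * (α * l) := by field_simp
    _ ≤ _ := by gcongr

lemma unique_path {n : ℕ} {D : Dom n} {u : En n → ℝ} {x0 v : En n} (hx0 : D.τ x0 = 0) (hx0c : x0 ∈ closure D.Ω)
    (hv : 0 < fderiv ℝ D.τ x0 v) {L1 L2 : En n →L[ℝ] ℝ}
    (h3 : HasFDerivWithinAt u L1 (closure D.Ω) x0)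
    (h4 : HasFDerivWithinAt u L2 (closure D.Ω) x0) : L1 v = L2 v := by
  have hline : HasDerivAt (fun t : ℝ => x0 + t • v) v 0 := by
    simpa using ((hasDerivAt_id (0:ℝ)).smul_const v).const_add x0
  have htau := hasDerivAt_line (u := D.τ) (x := x0) (v := v) (t := 0)
    (D.smooth.differentiable (by norm_num) _)
  simp only [zero_smul, add_zero] at htau
  have hpos : ∀ᶠ t in 𝓝[>] (0:ℝ), 0 < D.τ (x0 + t • v) := by
    have := htau.tendsto_slope_zero_right
    filter_upwards [this.eventually (lt_mem_nhds hv), self_mem_nhdsWithin] with t ht ht0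
    have ht0 : 0 < t := ht0
    simp only [zero_add, zero_smul, add_zero, hx0, sub_zero, smul_eq_mul] at ht
    exact (mul_pos_iff_of_pos_left (inv_pos.2 ht0)).1 ht
  obtain ⟨ε, hε, hI⟩ := mem_nhdsGT_iff_exists_Ioo_subset.1 hpos
  have hε : 0 < ε := hε
  have hmaps : MapsTo (fun t : ℝ => x0 + t • v) (Icc 0 (ε / 2)) (closure D.Ω) := by
    intro t ht
    rcases ht.1.eq_or_lt with h0 | h0
    · simpa [← h0] using hx0c
    · exact subset_closure (hI ⟨h0, by linarith [ht.2]⟩)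
  have hx0' : x0 = x0 + (0:ℝ) • v := by simp
  have c1 := HasFDerivWithinAt.comp_hasDerivWithinAt (t := closure D.Ω) (f := fun t : ℝ => x0 + t • v) (0:ℝ)
    (by rw [← hx0']; exact h3) (hline.hasDerivWithinAt (s := Icc 0 (ε / 2))) hmaps
  have c2 := HasFDerivWithinAt.comp_hasDerivWithinAt (t := closure D.Ω) (f := fun t : ℝ => x0 + t • v) (0:ℝ)
    (by rw [← hx0']; exact h4) (hline.hasDerivWithinAt (s := Icc 0 (ε / 2))) hmaps
  have c3 := (uniqueDiffOn_Icc (by linarith : (0:ℝ) < ε / 2) 0 ⟨le_rfl, by linarith⟩).eq_deriv _ c1 c2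
  simpa using c3

lemma Sol.case1 {n : ℕ} {D : Dom n} {s a lam : ℝ} {u : En n → ℝ} (h : Sol D s a lam u)
    {A : ℝ} (hA : 0 < A) {x0 : En n} (hx0 : D.τ x0 = 0) (hx0c : x0 ∈ closure D.Ω)
    (hup : ∀ ω : ℝ, 0 < ω → ∃ r' : ℝ, 0 < r' ∧ ∀ x, 0 < D.τ x → D.τ x < r' → u x ≤ (A + ω) * D.W s x)
    (hlow : ∀ δ : ℝ, 0 < δ → ∃ ρ : ℝ, 0 < ρ ∧ ∀ y, 0 < D.τ y → ‖y - x0‖ < ρ → A * D.W s y - u y ≤ δ * ‖y - x0‖)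
    {v : En n} (hv : 0 < fderiv ℝ D.τ x0 v) 
    (hd : ∀ L : En n →L[ℝ] ℝ, HasFDerivWithinAt u L (closure D.Ω) x0 → L v = 0) : False := by
  have hs := h.hs
  have hK := D.hK
  have hγ : 0 < (1 - s) / 2 := by linarith [hs.2]
  have hnn : ∀ y ∈ closure D.Ω, 0 ≤ D.τ y := by
    intro y hy
    have : closure D.Ω ⊆ {y | 0 ≤ D.τ y} := closure_minimal (fun z hz => le_of_lt (show 0 < D.τ z from hz))
      (isClosed_le continuous_const D.τ_cont)
    exact this hy
  have hx00 : u x0 = 0 := h.zero x0 hx0.le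
  have hW0 : D.W s x0 = 0 := D.W_zero hs hx0.le
  have h1 : HasFDerivWithinAt (fun y => u y - A * D.W s y) (0 : En n →L[ℝ] ℝ) (closure D.Ω) x0 := by
    rw [hasFDerivWithinAt_iff_isLittleO, Asymptotics.isLittleO_iff]
    intro c hc
    obtain ⟨r', hr', hu'⟩ := hup (c / D.K) (by positivity)
    obtain ⟨ρ, hρ, hl⟩ := hlow c hc
    have e1 : ∀ᶠ y in 𝓝 x0, D.τ y < r' := D.τ_cont.continuousAt.eventually (gt_mem_nhds (by rw [hx0]; exact hr'))
    have e2 : ∀ᶠ y in 𝓝 x0, ‖y - x0‖ < ρ := by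
      filter_upwards [Metric.ball_mem_nhds x0 hρ] with y hy
      rwa [mem_ball, dist_eq_norm] at hy
    filter_upwards [nhdsWithin_le_nhds e1, nhdsWithin_le_nhds e2] with y hy1 hy2
    rw [hx00, hW0]
    simp only [mul_zero, sub_zero, zero_apply, Real.norm_eq_abs]
    rcases le_or_gt (D.τ y) 0 with h0 | h0
    · rw [h.zero y h0, D.W_zero hs h0]; simp; positivity
    · have b1 := hu' y h0 hy1
      have b2 := hl y h0 hy2
      have b3 := D.W_lip hs y x0
      rw [hW0, sub_zero, abs_of_nonneg (D.W_nonneg hs y)] at b3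
      have b4 : c / D.K * D.W s y ≤ c / D.K * (D.K * ‖y - x0‖) := by gcongr
      have b5 : c / D.K * (D.K * ‖y - x0‖) = c * ‖y - x0‖ := by field_simp
      rw [abs_le]; constructor <;> linarith
  have h2 : HasFDerivWithinAt (D.W s) (fderiv ℝ D.τ x0) (closure D.Ω) x0 := by
    have p := Psi_deriv (t := D.τ x0) hγ
    have q := (D.smooth.differentiable (by norm_num) x0).hasFDerivAt
    have pq := p.comp_hasFDerivAt x0 q
    rw [hx0, Real.zero_rpow hγ.ne'] at pq
    have pq' : HasFDerivAt (Psi ((1 - s) / 2) ∘ D.τ) (fderiv ℝ D.τ x0) x0 := by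
      simpa using pq
    refine HasFDerivWithinAt.congr' pq'.hasFDerivWithinAt (fun y hy => ?_) hx0c
    simp only [Dom.W, Function.comp]
    rw [max_eq_left (hnn y hy)]
  have h3 : HasFDerivWithinAt u (A • fderiv ℝ D.τ x0) (closure D.Ω) x0 := by
    have := h1.add (h2.const_mul A)
    rw [zero_add] at this
    refine HasFDerivWithinAt.congr' this (fun y _ => ?_) hx0c
    simp
  have := hd _ h3
  simp at this
  rcases this with c3 | c3 <;> linarith

lemma Sol.case2 {n : ℕ} {D : Dom n} {s a lam : ℝ} {u : En n → ℝ} (h : Sol D s a lam u)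
    {A : ℝ} (hA : 0 < A) {x0 : En n} (hx0 : D.τ x0 = 0) (hx0c : ‖x0‖ ≤ D.R)
    (hup : ∀ ω : ℝ, 0 < ω → ∃ r' : ℝ, 0 < r' ∧ ∀ x, 0 < D.τ x → D.τ x < r' → u x ≤ (A + ω) * D.W s x)
    (hP : ∀ ω ρ : ℝ, 0 < ω → 0 < ρ → ∃ x, 0 < D.τ x ∧ ‖x - x0‖ < ρ ∧ (A - ω) * D.W s x < u x)
    {δ : ℝ} (hδ : 0 < δ)
    (hlow : ∀ ρ : ℝ, 0 < ρ → ∃ y, 0 < D.τ y ∧ ‖y - x0‖ < ρ ∧ δ * ‖y - x0‖ < A * D.W s y - u y) :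
    False := by
  have hK := D.hK
  have hc0 := D.hc0
  have ht0 := D.ht0
  obtain ⟨β, c1, hβ, hc1, hhopf⟩ := h.hopf hA hδ
  set ω := min 1 (β / 4)
  have hω : 0 < ω := by positivity
  have hω1 : ω ≤ 1 := min_le_left _ _
  have hω2 : ω ≤ β / 4 := min_le_right _ _
  obtain ⟨r', hr', hur⟩ := hup ω hω
  obtain ⟨ρ0, hρ0, hh⟩ := hhopf ω hω hω1 r' hr' hur
  obtain ⟨y, hτy, hy, hyd⟩ := hlow ρ0 hρ0
  set r := ‖y - x0‖ with hr
  have hr0 : 0 < r := by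
    rw [hr, norm_pos_iff, sub_ne_zero]
    rintro rfl
    linarith
  set g := 1 + 2 / D.c0 * D.K
  have hg : 0 < g := by positivity
  set ρ := min (min (r / g) (1 / g)) (min (D.t0 / D.K) (c1 * D.τ y / D.K)) with hρ
  have hρpos : 0 < ρ := by positivity
  obtain ⟨x, hτx, hxρ, hxu⟩ := hP (β / 2) ρ (by positivity) hρpos
  have hρ1 : ρ * g ≤ r := by
    rw [← le_div_iff₀ hg]; exact (min_le_left _ _).trans (min_le_left _ _)
  have hρ2 : ρ * g ≤ 1 := by
    rw [← le_div_iff₀ hg]; exact (min_le_left _ _).trans (min_le_right _ _)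
  have hρ3 : ρ * D.K ≤ D.t0 := by
    rw [← le_div_iff₀ (by positivity)]; exact (min_le_right _ _).trans (min_le_left _ _)
  have hρ4 : ρ * D.K ≤ c1 * D.τ y := by
    rw [← le_div_iff₀ (by positivity)]; exact (min_le_right _ _).trans (min_le_right _ _)
  have hτxρ : D.τ x < ρ * D.K := by
    have := D.lip x x0
    rw [hx0, max_self, sub_zero, max_eq_left hτx.le, abs_of_pos hτx] at this
    nlinarith
  obtain ⟨x', hx', hxx'⟩ := D.proj x hτx (by linarith)
  have hx'x0 : ‖x' - x0‖ ≤ ρ * g := by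
    have e : x' - x0 = (x - x0) - (x - x') := by abel
    rw [e]
    refine (norm_sub_le _ _).trans ?_
    have : 2 / D.c0 * D.τ x ≤ 2 / D.c0 * (ρ * D.K) := by gcongr
    simp only [g]
    linarith
  have hnx' : ‖x'‖ ≤ D.R + 1 := by
    have := norm_sub_norm_le x' x0
    linarith
  have hyx' : ‖y - x'‖ ≤ 2 * r := by
    have e : y - x' = (y - x0) - (x' - x0) := by abel
    rw [e]
    refine (norm_sub_le _ _).trans ?_
    linarith
  have := hh r hr0 hy x' y hx' hnx' hyx' hτy hyd.le x hτx hxx' (by linarith)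
  have hW := D.W_le (s := s) x
  rw [max_eq_left hτx.le] at hW
  have hW0 := D.W_nonneg h.hs x
  have e1 : β * D.W s x ≤ β * D.τ x := by gcongr
  have e2 : ω * D.W s x ≤ β / 4 * D.W s x := by gcongr
  have e3 : 0 ≤ β / 4 * D.W s x := by positivity
  linarith

lemma Sol.little {n : ℕ} {D : Dom n} {s a lam : ℝ} {u : En n → ℝ} (h : Sol D s a lam u)
    (hnd : ∀ x0 ∈ closure D.Ω, D.τ x0 = 0 → ∃ v, 0 < fderiv ℝ D.τ x0 v ∧
      ∀ L : En n →L[ℝ] ℝ, HasFDerivWithinAt u L (closure D.Ω) x0 → L v = 0) :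
    ∀ ε : ℝ, 0 < ε → ∃ r : ℝ, 0 < r ∧ ∀ x, 0 < D.τ x → D.τ x < r → u x ≤ ε * D.τ x := by
  have hs := h.hs
  obtain ⟨C, hC, huC⟩ := h.abs_le_tau
  set S := {B : ℝ | 0 ≤ B ∧ ∃ r : ℝ, 0 < r ∧ ∀ x, 0 < D.τ x → D.τ x < r → u x ≤ B * D.W s x} with hS
  have hne : S.Nonempty := by
    refine ⟨4 / 3 * C, by positivity, 1, one_pos, fun x hx _ => ?_⟩
    have h1 := (abs_le.1 (huC x)).2
    have h2 := D.W_pos hs hx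
    rw [max_eq_left hx.le] at h1
    have h3 : C * (3 / 4 * D.τ x) ≤ C * D.W s x := by gcongr
    linarith
  have hbb : BddBelow S := ⟨0, fun B hB => hB.1⟩
  set A := sInf S with hAdef
  have hA0 : 0 ≤ A := le_csInf hne fun B hB => hB.1
  have hup : ∀ ω : ℝ, 0 < ω → ∃ r' : ℝ, 0 < r' ∧ ∀ x, 0 < D.τ x → D.τ x < r' → u x ≤ (A + ω) * D.W s x := by
    intro ω hω
    obtain ⟨B, ⟨hB0, r, hr, hB⟩, hBA⟩ := exists_lt_of_csInf_lt hne (show sInf S < A + ω by linarith)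
    refine ⟨r, hr, fun x hx hxr => (hB x hx hxr).trans ?_⟩
    have := D.W_nonneg hs x
    gcongr
  rcases hA0.eq_or_lt with hA | hA
  · intro ε hε
    obtain ⟨r, hr, hB⟩ := hup ε hε
    refine ⟨r, hr, fun x hx hxr => (hB x hx hxr).trans ?_⟩
    rw [← hA, zero_add]
    have hW := D.W_le (s := s) x
    rw [max_eq_left hx.le] at hW
    gcongr
  exfalso
  have hseq : ∀ j : ℕ, ∃ x, 0 < D.τ x ∧ D.τ x < 1 / ((j : ℝ) + 1) ∧ (A - A / ((j : ℝ) + 1)) * D.W s x < u x := by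
    intro j
    by_contra hcon
    push Not at hcon
    have hj : (0:ℝ) < (j : ℝ) + 1 := by positivity
    have : A - A / ((j : ℝ) + 1) ∈ S := by
      refine ⟨?_, 1 / ((j : ℝ) + 1), by positivity, fun x hx hxr => hcon x hx hxr⟩
      have : A / ((j : ℝ) + 1) ≤ A := div_le_self hA.le (by linarith [(Nat.cast_nonneg j : (0:ℝ) ≤ j)])
      linarith
    have h1 := csInf_le hbb this
    have : 0 < A / ((j : ℝ) + 1) := by positivity
    linarith
  choose xs hx1 hx2 hx3 using hseq
  obtain ⟨x0, hx0, φ, hφ, hlim⟩ := (isCompact_closedBall (0 : En n) D.R).tendsto_subseq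
    (x := xs) (fun j => by simpa using (D.mem_ball _ (hx1 j)).le)
  have hjlim : Tendsto (fun j : ℕ => 1 / ((φ j : ℝ) + 1)) atTop (𝓝 0) :=
    tendsto_one_div_add_atTop_nhds_zero_nat.comp hφ.tendsto_atTop
  have hτ0 : D.τ x0 = 0 := by
    have h1 : Tendsto (fun j => D.τ (xs (φ j))) atTop (𝓝 (D.τ x0)) := (D.τ_cont.tendsto x0).comp hlim
    have h2 : Tendsto (fun j => D.τ (xs (φ j))) atTop (𝓝 0) :=
      squeeze_zero (fun j => (hx1 _).le) (fun j => (hx2 _).le) hjlim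
    exact tendsto_nhds_unique h1 h2
  have hx0c : x0 ∈ closure D.Ω := mem_closure_of_tendsto hlim (Eventually.of_forall fun j => hx1 _)
  have hP : ∀ ω ρ : ℝ, 0 < ω → 0 < ρ → ∃ x, 0 < D.τ x ∧ ‖x - x0‖ < ρ ∧ (A - ω) * D.W s x < u x := by
    intro ω ρ hω hρ
    have e1 : ∀ᶠ j in atTop, ‖xs (φ j) - x0‖ < ρ := by
      filter_upwards [hlim.eventually (Metric.ball_mem_nhds x0 hρ)] with j hj
      rw [← dist_eq_norm]; exact hj
    have e2 : ∀ᶠ j in atTop, 1 / ((φ j : ℝ) + 1) < ω / A := hjlim.eventually (gt_mem_nhds (by positivity))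
    obtain ⟨j, hj1, hj2⟩ := (e1.and e2).exists
    refine ⟨xs (φ j), hx1 _, hj1, lt_of_le_of_lt ?_ (hx3 _)⟩
    have := D.W_nonneg hs (xs (φ j))
    have h3 : A / ((φ j : ℝ) + 1) ≤ ω := by
      rw [lt_div_iff₀ hA] at hj2
      calc A / ((φ j : ℝ) + 1) = 1 / ((φ j : ℝ) + 1) * A := by ring
        _ ≤ ω := hj2.le
    gcongr
  by_cases hc : ∀ δ : ℝ, 0 < δ → ∃ ρ : ℝ, 0 < ρ ∧ ∀ y, 0 < D.τ y → ‖y - x0‖ < ρ → A * D.W s y - u y ≤ δ * ‖y - x0‖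
  · obtain ⟨v, hv, hd⟩ := hnd x0 hx0c hτ0
    exact h.case1 hA hτ0 hx0c hup hc hv hd
  · push Not at hc
    obtain ⟨δ, hδ, hc⟩ := hc
    exact h.case2 hA hτ0 (by simpa using hx0) hup hP hδ hc

lemma Sol.little_abs {n : ℕ} {D : Dom n} {s a lam : ℝ} {u : En n → ℝ} (h : Sol D s a lam u)
    (hnd : ∀ x0 ∈ closure D.Ω, D.τ x0 = 0 → ∃ v, 0 < fderiv ℝ D.τ x0 v ∧
      ∀ L : En n →L[ℝ] ℝ, HasFDerivWithinAt u L (closure D.Ω) x0 → L v = 0) :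
    ∀ ε : ℝ, 0 < ε → ∃ r : ℝ, 0 < r ∧ ∀ x, 0 < D.τ x → D.τ x < r → |u x| ≤ ε * D.τ x := by
  intro ε hε
  obtain ⟨r1, hr1, h1⟩ := h.little hnd ε hε
  obtain ⟨r2, hr2, h2⟩ := h.neg.little (fun x0 hx0 hx1 => by
    obtain ⟨v, hv, hd⟩ := hnd x0 hx0 hx1
    refine ⟨v, hv, ?_⟩
    intro L hL
    have h2 : HasFDerivWithinAt u (-L) (closure D.Ω) x0 := by
      refine HasFDerivWithinAt.congr' hL.neg (fun y _ => ?_) hx0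
      simp
    have := hd _ h2
    simpa using this) ε hε
  refine ⟨min r1 r2, lt_min hr1 hr2, fun x hx hxr => abs_le.2 ⟨?_, h1 x hx (hxr.trans_le (min_le_left _ _))⟩⟩
  have := h2 x hx (hxr.trans_le (min_le_right _ _))
  linarith

lemma pigeon {n : ℕ} {S : Set (En n)} (hS : MeasurableSet S) {z e : En n} {r δ : ℝ} (he : ‖e‖ = 1)
    (hδ : 0 < δ) (hSb : S ⊆ ball z r) (hd : ∀ x ∈ S, ∀ t, δ ≤ t → x + t • e ∉ S) :
    volume S ≤ ENNReal.ofReal (2 * δ) * volume (ball z (r + 1)) := by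
  have hball : S ⊆ ball z (r + 1) := hSb.trans (ball_subset_ball (by linarith))
  rcases le_or_gt 1 δ with h1 | h1
  · calc volume S ≤ volume (ball z (r + 1)) := measure_mono hball
      _ = 1 * volume (ball z (r + 1)) := (one_mul _).symm
      _ ≤ _ := by
        gcongr
        rw [← ENNReal.ofReal_one]
        exact ENNReal.ofReal_le_ofReal (by linarith)
  set N := ⌊1 / δ⌋₊ with hN
  have hN1 : (N : ℝ) ≤ 1 / δ := Nat.floor_le (by positivity)
  have hN2 : 1 / δ < N + 1 := Nat.lt_floor_add_one _
  have hN0 : 1 ≤ N := by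
    rw [hN, Nat.one_le_floor_iff]
    rw [le_div_iff₀ hδ]; linarith
  have hN3 : 1 ≤ 2 * δ * N := by
    have : (1:ℝ) ≤ N := by exact_mod_cast hN0
    rw [div_lt_iff₀ hδ] at hN2
    nlinarith
  have key : (N : ℝ≥0∞) * volume S ≤ volume (ball z (r + 1)) := by
    have hmeas : ∀ j : ℕ, volume ((fun x => x - ((j : ℝ) * δ) • e) ⁻¹' S) = volume S := fun j => by
      simp_rw [sub_eq_add_neg]
      exact measure_preimage_add_right volume _ S
    have : (N : ℝ≥0∞) * volume S = ∑ j ∈ Finset.range N, volume ((fun x => x - ((j : ℝ) * δ) • e) ⁻¹' S) := by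
      rw [Finset.sum_congr rfl (fun j _ => hmeas j)]; simp
    rw [this, ← measure_biUnion_finset]
    · refine measure_mono ?_
      intro x hx
      simp only [mem_iUnion, Finset.mem_range] at hx
      obtain ⟨j, hj, hx⟩ := hx
      have hx := hSb hx
      rw [mem_ball, dist_eq_norm] at hx ⊢
      have e1 : x - z = (x - ((j : ℝ) * δ) • e - z) + ((j : ℝ) * δ) • e := by abel
      have e2 : ‖((j : ℝ) * δ) • e‖ ≤ 1 := by
        rw [norm_smul, he, mul_one, Real.norm_of_nonneg (by positivity)]
        have : (j : ℝ) ≤ N := by exact_mod_cast hj.le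
        rw [le_div_iff₀ hδ] at hN1
        nlinarith
      rw [e1]
      exact lt_of_le_of_lt (norm_add_le _ _) (by linarith)
    · have main : ∀ i j : ℕ, i < j → Disjoint ((fun x => x - ((i : ℝ) * δ) • e) ⁻¹' S) ((fun x => x - ((j : ℝ) * δ) • e) ⁻¹' S) := by
        intro i j hij
        rw [Set.disjoint_left]
        intro x hx1 hx2
        refine hd _ hx2 ((j : ℝ) * δ - i * δ) ?_ ?_
        · have : (i : ℝ) + 1 ≤ j := by exact_mod_cast hij
          nlinarith
        · have : x - ((j : ℝ) * δ) • e + ((j : ℝ) * δ - i * δ) • e = x - ((i : ℝ) * δ) • e := by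
            rw [sub_smul]; abel
          rw [this]; exact hx1
      intro i _ j _ hij
      rcases lt_or_gt_of_ne hij with h | h
      · exact main i j h
      · exact (main j i h).symm
    · intro j _
      exact (measurable_id.sub_const _) hS
  calc volume S = 1 * volume S := (one_mul _).symm
    _ ≤ ENNReal.ofReal (2 * δ * N) * volume S := by
      gcongr
      rw [← ENNReal.ofReal_one]
      exact ENNReal.ofReal_le_ofReal hN3
    _ = ENNReal.ofReal (2 * δ) * ((N : ℝ≥0∞) * volume S) := by
      rw [ENNReal.ofReal_mul (by positivity), ENNReal.ofReal_natCast, mul_assoc]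
    _ ≤ _ := by gcongr

lemma exists_dir {n : ℕ} {L : En n →L[ℝ] ℝ} (hL : 0 < ‖L‖) : ∃ e : En n, ‖e‖ = 1 ∧ L e = ‖L‖ := by
  set g := (InnerProductSpace.toDual ℝ (En n)).symm L with hg
  have hgn : ‖g‖ = ‖L‖ := by simp [hg]
  have h2 : L g = ‖L‖ ^ 2 := by
    have : ⟪g, g⟫ = L g := InnerProductSpace.toDual_symm_apply
    rw [← this, real_inner_self_eq_norm_sq, hgn]
  refine ⟨‖L‖⁻¹ • g, ?_, ?_⟩
  · rw [norm_smul, hgn, norm_inv, norm_norm, inv_mul_cancel₀ hL.ne']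
  · rw [map_smul, h2, smul_eq_mul]; field_simp

lemma Dom.strip {n : ℕ} (D : Dom n) : ∃ C : ℝ, 0 < C ∧ ∀ ε : ℝ, 0 < ε →
    volume {x | 0 < D.τ x ∧ D.τ x < ε} ≤ ENNReal.ofReal (C * ε) := by
  have hK := D.hK
  have hc0 := D.hc0
  have ht0 := D.ht0
  set r := min 1 (D.c0 / (6 * D.K)) with hr
  have hr0 : 0 < r := by positivity
  have hr1 : r ≤ 1 := min_le_left _ _
  have hr2 : r * (6 * D.K) ≤ D.c0 := by
    rw [← le_div_iff₀ (by positivity)]; exact min_le_right _ _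
  have htb : TotallyBounded {x | 0 < D.τ x ∧ D.τ x < D.t0} :=
    (isCompact_closedBall (0 : En n) D.R).totallyBounded.subset fun x hx => by
      simpa using (D.mem_ball x hx.1).le
  obtain ⟨T, hT, hTf, hcov⟩ := totallyBounded_iff_subset.1 htb _ (Metric.dist_mem_uniformity hr0)
  set V := volume (ball (0 : En n) (D.R + 2)) with hV
  have hVt : V ≠ ∞ := measure_ball_lt_top.ne
  have hmS : ∀ ε, MeasurableSet {x | 0 < D.τ x ∧ D.τ x < ε} := fun ε =>
    (measurableSet_lt measurable_const D.τ_cont.measurable).inter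
      (measurableSet_lt D.τ_cont.measurable measurable_const)
  refine ⟨(hTf.toFinset.card * (4 / D.c0) + 1 / D.t0) * V.toReal + 1, by positivity, fun ε hε => ?_⟩
  have hfin : ∀ c : ℝ, 0 ≤ c → ENNReal.ofReal c * V = ENNReal.ofReal (c * V.toReal) := fun c hc => by
    rw [ENNReal.ofReal_mul hc, ENNReal.ofReal_toReal hVt]
  rcases le_or_gt D.t0 ε with h0 | h0
  · calc volume {x | 0 < D.τ x ∧ D.τ x < ε} ≤ V := measure_mono fun x hx => by
          rw [mem_ball_zero_iff]; linarith [D.mem_ball x hx.1]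
      _ = ENNReal.ofReal 1 * V := by simp
      _ ≤ ENNReal.ofReal ((hTf.toFinset.card * (4 / D.c0) + 1 / D.t0) * V.toReal * ε + 1 * ε) := by
        rw [hfin 1 zero_le_one]
        apply ENNReal.ofReal_le_ofReal
        have e1 : 1 ≤ ε / D.t0 := by rw [le_div_iff₀ ht0]; linarith
        have e2 : 0 ≤ hTf.toFinset.card * (4 / D.c0) * V.toReal * ε := by positivity
        have e3 : 1 * V.toReal ≤ ε / D.t0 * V.toReal := by gcongr
        have e4 : (hTf.toFinset.card * (4 / D.c0) + 1 / D.t0) * V.toReal * ε + 1 * ε = 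
          hTf.toFinset.card * (4 / D.c0) * V.toReal * ε + ε / D.t0 * V.toReal + ε := by ring
        linarith
      _ = _ := by congr 1; ring
  · have hloc : ∀ z ∈ hTf.toFinset, volume ({x | 0 < D.τ x ∧ D.τ x < ε} ∩ ball z r) ≤
        ENNReal.ofReal (4 / D.c0 * ε * V.toReal) := by
      intro z hz
      obtain ⟨hz1, hz2⟩ := hT (hTf.mem_toFinset.1 hz)
      have hzR := D.mem_ball z hz1
      have hg := D.grad z hz1 hz2
      obtain ⟨e, he, hLe⟩ := exists_dir (L := fderiv ℝ D.τ z) (by linarith)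
      have := pigeon (S := {x | 0 < D.τ x ∧ D.τ x < ε} ∩ ball z r) (z := z) (e := e) (r := r)
        (δ := 2 * ε / D.c0) ((hmS ε).inter measurableSet_ball) he (by positivity) inter_subset_right ?_
      · refine this.trans ?_
        calc _ ≤ ENNReal.ofReal (2 * (2 * ε / D.c0)) * V := by
              gcongr
              refine measure_mono (ball_subset_ball' ?_)
              rw [dist_zero_right]; linarith
          _ = _ := by rw [hfin _ (by positivity)]; congr 1; ring
      · rintro x ⟨⟨hx1, hx2⟩, hx3⟩ t ht ⟨⟨hy1, hy2⟩, hy3⟩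
        have ht0' : 0 < t := lt_of_lt_of_le (by positivity) ht
        have hxR := D.mem_ball x hx1
        have hyR := D.mem_ball _ hy1
        rw [Metric.mem_ball, dist_eq_norm] at hx3 hy3
        have t2 := taylor2 D.smooth (by linarith) D.d2 (x := x) (y := x + t • e) (by linarith) (by linarith)
        have t1 := taylor1 D.smooth D.d2 (x := z) (y := x) (by linarith) (by linarith)
        rw [add_sub_cancel_left, norm_smul, he, map_smul, mul_one, Real.norm_of_nonneg ht0'.le] at t2
        have t3 : D.c0 - D.K * r ≤ fderiv ℝ D.τ x e := by
          have := (fderiv ℝ D.τ x - fderiv ℝ D.τ z).le_opNorm e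
          rw [he, mul_one, ContinuousLinearMap.sub_apply, hLe] at this
          have h4 := (abs_le.1 (this.trans t1)).1
          have h5 : D.K * ‖x - z‖ ≤ D.K * r := by gcongr
          linarith
        have ht2 : t ≤ 2 * r := by
          have e1 : t • e = (x + t • e - z) - (x - z) := by abel
          have := norm_sub_le (x + t • e - z) (x - z)
          rw [← e1, norm_smul, he, mul_one, Real.norm_of_nonneg ht0'.le] at this
          linarith
        have h6 := (abs_le.1 t2).1
        rw [smul_eq_mul] at h6
        have h7 : ε ≤ t * (D.c0 / 2) := by
          calc ε = 2 * ε / D.c0 * (D.c0 / 2) := by field_simp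
            _ ≤ _ := by gcongr
        have h8 : t * (D.c0 - D.K * r) ≤ t * fderiv ℝ D.τ x e := by gcongr
        have h9 : D.K * t ^ 2 ≤ t * (D.K * (2 * r)) := by
          have : D.K * t ^ 2 = t * (D.K * t) := by ring
          rw [this]; gcongr
        have h10 : t * (6 * (D.K * r)) ≤ t * D.c0 := by gcongr; linarith
        linarith
    calc volume {x | 0 < D.τ x ∧ D.τ x < ε} 
        ≤ volume (⋃ z ∈ hTf.toFinset, ({x | 0 < D.τ x ∧ D.τ x < ε} ∩ ball z r)) := by
          refine measure_mono fun x hx => ?_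
          have := hcov (show x ∈ {x | 0 < D.τ x ∧ D.τ x < D.t0} from ⟨hx.1, hx.2.trans h0⟩)
          simp only [mem_iUnion] at this ⊢
          obtain ⟨z, hz, hxz⟩ := this
          exact ⟨z, hTf.mem_toFinset.2 hz, hx, hxz⟩
      _ ≤ ∑ z ∈ hTf.toFinset, volume ({x | 0 < D.τ x ∧ D.τ x < ε} ∩ ball z r) := measure_biUnion_finset_le _ _
      _ ≤ ∑ z ∈ hTf.toFinset, ENNReal.ofReal (4 / D.c0 * ε * V.toReal) := Finset.sum_le_sum hloc
      _ = ENNReal.ofReal (hTf.toFinset.card * (4 / D.c0 * ε * V.toReal)) := by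
        rw [Finset.sum_const, nsmul_eq_mul, ENNReal.ofReal_mul (p := (hTf.toFinset.card : ℝ)) (by positivity), ENNReal.ofReal_natCast]
      _ ≤ _ := by
        apply ENNReal.ofReal_le_ofReal
        have : 0 ≤ 1 / D.t0 * V.toReal * ε + ε := by positivity
        have e4 : ((hTf.toFinset.card * (4 / D.c0) + 1 / D.t0) * V.toReal + 1) * ε = 
          hTf.toFinset.card * (4 / D.c0 * ε * V.toReal) + (1 / D.t0 * V.toReal * ε + ε) := by ring
        linarith

lemma Dom.int_neg {n : ℕ} (D : Dom n) {s : ℝ} (hs : s ∈ Ioo (0:ℝ) 1) :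
    IntegrableOn (fun x => D.τ x ^ (-s)) D.Ω := by
  have hΩ : MeasurableSet D.Ω := measurableSet_lt measurable_const D.τ_cont.measurable
  obtain ⟨C, hC, hst⟩ := D.strip
  refine ⟨(D.τ_cont.measurable.pow_const _).aestronglyMeasurable, ?_⟩
  have h2s : (1:ℝ) ≤ 2 ^ s := Real.one_le_rpow (by norm_num) hs.1.le
  have h2s2 : (2:ℝ) ^ s < 2 := by
    calc (2:ℝ) ^ s < 2 ^ (1:ℝ) := Real.rpow_lt_rpow_of_exponent_lt (by norm_num) hs.2
      _ = 2 := Real.rpow_one _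
  set q : ℝ := 2 ^ s / 2 with hq
  have hq0 : 0 ≤ q := by positivity
  have hq1 : q < 1 := by rw [hq]; linarith
  have hmS : ∀ ε, MeasurableSet {x | 0 < D.τ x ∧ D.τ x < ε} := fun ε =>
    (measurableSet_lt measurable_const D.τ_cont.measurable).inter
      (measurableSet_lt D.τ_cont.measurable measurable_const)
  rw [hasFiniteIntegral_iff_ofReal (by
    filter_upwards [ae_restrict_mem hΩ] with x hx
    exact (Real.rpow_pos_of_pos (show 0 < D.τ x from hx) _).le)]
  have hle : ∀ x ∈ D.Ω, ENNReal.ofReal (D.τ x ^ (-s)) ≤ 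
      ∑' k : ℕ, {x | 0 < D.τ x ∧ D.τ x < 4 * (1/2 : ℝ) ^ k}.indicator (fun _ => ENNReal.ofReal ((2 ^ s) ^ k)) x := by
    intro x hx
    have hx : 0 < D.τ x := hx
    obtain ⟨k, hk1, hk2⟩ := exists_nat_pow_near_of_lt_one hx (D.le_one x) (show (0:ℝ) < 1/2 by norm_num) (by norm_num)
    refine le_trans ?_ (ENNReal.le_tsum (k + 1))
    rw [indicator_of_mem]
    · apply ENNReal.ofReal_le_ofReal
      calc D.τ x ^ (-s) ≤ ((1/2 : ℝ) ^ (k + 1)) ^ (-s) :=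
            Real.rpow_le_rpow_of_nonpos (by positivity) hk1.le (by linarith [hs.1])
        _ = _ := by
          rw [← Real.rpow_natCast, ← Real.rpow_mul (by norm_num), mul_comm, Real.rpow_mul (by norm_num),
            Real.rpow_natCast]
          congr 1
          rw [one_div, Real.inv_rpow (by norm_num), Real.rpow_neg (by norm_num), inv_inv]
    · refine ⟨hx, lt_of_le_of_lt hk2 ?_⟩
      rw [pow_succ]
      have : (0:ℝ) < (1/2) ^ k := by positivity
      linarith
  calc ∫⁻ x in D.Ω, ENNReal.ofReal (D.τ x ^ (-s))
      ≤ ∫⁻ x in D.Ω, ∑' k : ℕ, {x | 0 < D.τ x ∧ D.τ x < 4 * (1/2 : ℝ) ^ k}.indicator (fun _ => ENNReal.ofReal ((2 ^ s) ^ k)) x :=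
        setLIntegral_mono' hΩ hle
    _ ≤ ∫⁻ x, ∑' k : ℕ, {x | 0 < D.τ x ∧ D.τ x < 4 * (1/2 : ℝ) ^ k}.indicator (fun _ => ENNReal.ofReal ((2 ^ s) ^ k)) x :=
        setLIntegral_le_lintegral _ _
    _ = ∑' k : ℕ, ENNReal.ofReal ((2 ^ s) ^ k) * volume {x | 0 < D.τ x ∧ D.τ x < 4 * (1/2 : ℝ) ^ k} := by
        rw [lintegral_tsum (fun k => (measurable_const.indicator (hmS _)).aemeasurable)]
        simp_rw [lintegral_indicator_const (hmS _)]
    _ ≤ ∑' k : ℕ, ENNReal.ofReal (4 * C) * (ENNReal.ofReal q) ^ k := by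
        refine ENNReal.tsum_le_tsum fun k => ?_
        calc _ ≤ ENNReal.ofReal ((2 ^ s) ^ k) * ENNReal.ofReal (C * (4 * (1/2 : ℝ) ^ k)) := by
              gcongr; exact hst _ (by positivity)
          _ = _ := by
            rw [← ENNReal.ofReal_pow hq0, ← ENNReal.ofReal_mul (by positivity), ← ENNReal.ofReal_mul (by positivity)]
            congr 1
            rw [hq, div_pow, div_pow, one_pow]; ring
    _ < ∞ := by
        rw [ENNReal.tsum_mul_left, ENNReal.tsum_geometric]
        refine ENNReal.mul_lt_top ENNReal.ofReal_lt_top ?_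
        rw [ENNReal.inv_lt_top, tsub_pos_iff_lt, ← ENNReal.ofReal_one]
        exact (ENNReal.ofReal_lt_ofReal_iff one_pos).2 hq1

lemma sdf_symm {n : ℕ} {f g : En n → ℝ} (hf : Continuous f) (hg : Continuous g) (hgc : HasCompactSupport g)
    (y : En n) : ∫ x, sdf f x y * g x = ∫ x, f x * sdf g x y := by
  have i1 : Integrable (fun x => f (x + y) * g x) :=
    Continuous.integrable_of_hasCompactSupport (by fun_prop) hgc.mul_left
  have i2 : Integrable (fun x => f (x - y) * g x) :=
    Continuous.integrable_of_hasCompactSupport (by fun_prop) hgc.mul_left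
  have i3 : Integrable (fun x => f x * g x) :=
    Continuous.integrable_of_hasCompactSupport (by fun_prop) hgc.mul_left
  have e1 : (fun x => f x * g (x - y)) = fun x => (fun z => f (z + y) * g z) (x - y) := by
    funext x; simp
  have e2 : (fun x => f x * g (x + y)) = fun x => (fun z => f (z - y) * g z) (x + y) := by
    funext x; simp
  have j1 : Integrable (fun x => f x * g (x - y)) := by
    rw [e1]; exact i1.comp_sub_right y
  have j2 : Integrable (fun x => f x * g (x + y)) := by
    rw [e2]; exact i2.comp_add_right y
  have k1 : ∫ x, f x * g (x - y) = ∫ x, f (x + y) * g x := by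
    rw [e1]; exact integral_sub_right_eq_self (μ := (volume : Measure (En n))) (fun z => f (z + y) * g z) y
  have k2 : ∫ x, f x * g (x + y) = ∫ x, f (x - y) * g x := by
    rw [e2]; exact integral_add_right_eq_self (μ := (volume : Measure (En n))) (fun z => f (z - y) * g z) y
  have l1 : ∫ x, sdf f x y * g x = (∫ x, f (x + y) * g x) + (∫ x, f (x - y) * g x) - 2 * ∫ x, f x * g x := by
    rw [← integral_const_mul, ← integral_add i1 i2]
    refine Eq.trans ?_ (integral_sub (i1.add i2) (i3.const_mul 2))
    congr 1; funext x; simp only [sdf]; ring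
  have l2 : ∫ x, f x * sdf g x y = (∫ x, f x * g (x + y)) + (∫ x, f x * g (x - y)) - 2 * ∫ x, f x * g x := by
    rw [← integral_const_mul, ← integral_add j2 j1]
    refine Eq.trans ?_ (integral_sub (j2.add j1) (i3.const_mul 2))
    congr 1; funext x; simp only [sdf]; ring
  rw [l1, l2, k1, k2]; ring

lemma continuous_Hs {n : ℕ} {f : En n → ℝ} (hf : ContDiff ℝ 2 f) (v : En n) : Continuous (fun x => Hs f x v) :=
  continuous_iff_continuousAt.2 fun _ => Hs_continuousAt hf.contDiffAt v

lemma c2c_bound {n : ℕ} {f : En n → ℝ} (hf : ContDiff ℝ 2 f) (hfc : HasCompactSupport f) :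
    ∃ M, 0 ≤ M ∧ ∀ x v, |Hs f x v| ≤ M * ‖v‖ ^ 2 := by
  have hc : Continuous (fderiv ℝ (fderiv ℝ f)) :=
    (hf.fderiv_right (m := 1) (by norm_num)).continuous_fderiv (by norm_num)
  have hcn : Continuous (fun x => ‖fderiv ℝ (fderiv ℝ f) x‖) :=
    Continuous.norm (E := En n →L[ℝ] En n →L[ℝ] ℝ) hc
  obtain ⟨R, hR⟩ := hfc.isCompact.isBounded.subset_closedBall (0 : En n)
  obtain ⟨M, hM⟩ := (isCompact_closedBall (0 : En n) R).exists_bound_of_continuousOn hcn.continuousOn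
  have h0 : ∀ x, x ∉ tsupport f → fderiv ℝ (fderiv ℝ f) x = 0 := by
    intro x hx
    by_contra hne
    exact hx (tsupport_fderiv_subset ℝ (tsupport_fderiv_subset ℝ (subset_tsupport _ hne)))
  refine ⟨max M 0, le_max_right _ _, fun x v => (abs_Hs_le f x v).trans ?_⟩
  refine mul_le_mul_of_nonneg_right ?_ (by positivity)
  by_cases hx : x ∈ tsupport f
  · have := hM x (hR hx)
    rw [Real.norm_eq_abs] at this
    exact ((le_abs_self _).trans this).trans (le_max_left _ _)
  · rw [h0 x hx]
    exact le_max_of_le_right (norm_zero (E := En n →L[ℝ] En n →L[ℝ] ℝ)).le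

lemma abs_sdf_le_of_Hs {n : ℕ} {f : En n → ℝ} (hf : ContDiff ℝ 2 f) {M : ℝ}
    (hM : ∀ x v, |Hs f x v| ≤ M * ‖v‖ ^ 2) (x y : En n) : |sdf f x y| ≤ M * ‖y‖ ^ 2 := by
  rw [abs_le]
  exact ⟨le_sdf (fun t _ => hf.contDiffAt) (fun t _ => (abs_le.1 (hM _ _)).1),
    sdf_le (fun t _ => hf.contDiffAt) (fun t _ => (abs_le.1 (hM _ _)).2)⟩

lemma tendsto_int_sdf {n : ℕ} {f g : En n → ℝ} (hf : ContDiff ℝ 2 f) (hfc : HasCompactSupport f)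
    (hg : Continuous g) (hgc : HasCompactSupport g) (v : En n) :
    Tendsto (fun t : ℝ => (∫ x, sdf f x (t • v) * g x) / t ^ 2) (𝓝[>] 0) (𝓝 (∫ x, Hs f x v * g x)) := by
  obtain ⟨M, hM0, hM⟩ := c2c_bound hf hfc
  have hgi : Integrable g := hg.integrable_of_hasCompactSupport hgc
  have e : (fun t : ℝ => (∫ x, sdf f x (t • v) * g x) / t ^ 2) = 
      fun t : ℝ => ∫ x, sdf f x (t • v) / t ^ 2 * g x := by
    funext t
    rw [← integral_div]
    congr 1; funext x; ring
  rw [e]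
  refine tendsto_integral_filter_of_dominated_convergence (fun x => M * ‖v‖ ^ 2 * ‖g x‖) ?_ ?_ (hgi.norm.const_mul _) ?_
  · refine Eventually.of_forall fun t => Continuous.aestronglyMeasurable ?_
    have := hf.continuous
    unfold sdf
    fun_prop
  · filter_upwards [self_mem_nhdsWithin] with t ht
    have ht : 0 < t := ht
    refine Eventually.of_forall fun x => ?_
    rw [norm_mul]
    gcongr
    rw [norm_div, Real.norm_eq_abs, Real.norm_of_nonneg (by positivity), div_le_iff₀ (by positivity)]
    refine (abs_sdf_le_of_Hs hf hM x _).trans ?_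
    rw [norm_smul, mul_pow, Real.norm_eq_abs, sq_abs]
    exact le_of_eq (by ring)
  · refine Eventually.of_forall fun x => ?_
    exact (tendsto_sdf hf.contDiffAt v).mul_const _

lemma int_Hs_symm {n : ℕ} {f g : En n → ℝ} (hf : ContDiff ℝ 2 f) (hfc : HasCompactSupport f)
    (hg : ContDiff ℝ 2 g) (hgc : HasCompactSupport g) (v : En n) :
    ∫ x, Hs f x v * g x = ∫ x, f x * Hs g x v := by
  have h1 := tendsto_int_sdf hf hfc hg.continuous hgc v
  have h2 := tendsto_int_sdf hg hgc hf.continuous hfc v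
  refine (tendsto_nhds_unique h1 (h2.congr fun t => ?_)).trans ?_
  · rw [sdf_symm hf.continuous hg.continuous hgc]
    simp_rw [mul_comm]
  · simp_rw [mul_comm]

lemma hcs_Hs {n : ℕ} {f : En n → ℝ} (hfc : HasCompactSupport f) (v : En n) :
    HasCompactSupport (fun x => Hs f x v) := by
  refine ((hfc.fderiv ℝ).fderiv ℝ).mono fun x hx => ?_
  simp only [Function.mem_support] at hx ⊢
  intro h0; apply hx
  unfold Hs; rw [h0]; simp

lemma int_lap_symm {n : ℕ} {f g : En n → ℝ} (hf : ContDiff ℝ 2 f) (hfc : HasCompactSupport f)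
    (hg : ContDiff ℝ 2 g) (hgc : HasCompactSupport g) :
    ∫ x, lap n f x * g x = ∫ x, f x * lap n g x := by
  have e1 : (fun x => lap n f x * g x) = fun x => ∑ i : Fin n, Hs f x (EuclideanSpace.single i 1) * g x := by
    funext x; rw [lap_eq_sum hf.contDiffAt, Finset.sum_mul]
  have e2 : (fun x => f x * lap n g x) = fun x => ∑ i : Fin n, f x * Hs g x (EuclideanSpace.single i 1) := by
    funext x; rw [lap_eq_sum hg.contDiffAt, Finset.mul_sum]
  rw [e1, e2, integral_finsetSum, integral_finsetSum]
  · exact Finset.sum_congr rfl fun i _ => int_Hs_symm hf hfc hg hgc _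
  · intro i _
    exact Continuous.integrable_of_hasCompactSupport (hf.continuous.mul (continuous_Hs hg _)) hfc.mul_right
  · intro i _
    exact Continuous.integrable_of_hasCompactSupport ((continuous_Hs hf _).mul hg.continuous) hgc.mul_left

lemma continuous_lap {n : ℕ} {f : En n → ℝ} (hf : ContDiff ℝ 2 f) : Continuous (lap n f) := by
  have : lap n f = fun x => ∑ i : Fin n, Hs f x (EuclideanSpace.single i 1) := by
    funext x; exact lap_eq_sum hf.contDiffAt
  rw [this]
  exact continuous_finsetSum _ fun i _ => continuous_Hs hf _

lemma fracLap_fubini {n : ℕ} (hn : 1 ≤ n) {s : ℝ} (hs : s ∈ Ioo (0:ℝ) 1) {f g : En n → ℝ}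
    (hf : Measurable f) (hg : Continuous g) (hgc : HasCompactSupport g) {C : ℝ}
    (hC : ∀ x, g x ≠ 0 → ∀ y, |sdf f x y| ≤ C * kap s y) :
    Integrable (fun x => fracLap n s f x * g x) ∧
    ∫ x, fracLap n s f x * g x = 
      -(cK n s / 2) * ∫ y : En n, (∫ x, sdf f x y * g x) / ‖y‖ ^ ((n : ℝ) + 2 * s) := by
  have hgi : Integrable g := hg.integrable_of_hasCompactSupport hgc
  have hI : Integrable (fun p : En n × En n => sdf f p.1 p.2 / ‖p.2‖ ^ ((n : ℝ) + 2 * s) * g p.1)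
      (volume.prod volume) := by
    refine Integrable.mono' (g := fun p : En n × En n => C * (‖g p.1‖ * kr n s p.2))
      ((hgi.norm.mul_prod (kr_integrable n hn s hs)).const_mul C) ?_ ?_
    · refine Measurable.aestronglyMeasurable ?_
      unfold sdf
      have := hg.measurable
      fun_prop
    · refine Eventually.of_forall fun p => ?_
      rw [norm_mul]
      by_cases h0 : g p.1 = 0
      · rw [h0]; simp
      have := hC p.1 h0 p.2
      rw [norm_div, Real.norm_eq_abs, Real.norm_of_nonneg (by positivity)]
      unfold kr
      calc _ ≤ C * kap s p.2 / ‖p.2‖ ^ ((n : ℝ) + 2 * s) * ‖g p.1‖ := by gcongr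
        _ = _ := by ring
  have e : ∀ x, fracLap n s f x * g x = -(cK n s / 2) * 
      ∫ y : En n, sdf f x y / ‖y‖ ^ ((n : ℝ) + 2 * s) * g x := by
    intro x
    rw [fracLap_eq, integral_mul_const]; ring
  simp_rw [e]
  refine ⟨hI.integral_prod_left.const_mul _, ?_⟩
  rw [integral_const_mul]
  congr 1
  rw [integral_integral_swap hI]
  congr 1; funext y
  rw [← integral_div]
  congr 1; funext x; ring

lemma sdf_bound_c2c {n : ℕ} {s : ℝ} (hs : s ∈ Ioo (0:ℝ) 1) {f : En n → ℝ} (hf : ContDiff ℝ 2 f)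
    (hfc : HasCompactSupport f) : ∃ C, ∀ x y, |sdf f x y| ≤ C * kap s y := by
  obtain ⟨M, hM0, hM⟩ := c2c_bound hf hfc
  obtain ⟨B, hB⟩ := hfc.exists_bound_of_continuous hf.continuous
  exact ⟨_, fun x y => sdf_bound_ball (x := x) hs one_pos le_rfl hB (fun z _ => hf.contDiffAt) (fun z _ v => hM z v) y⟩

lemma fracLap_symm {n : ℕ} (hn : 1 ≤ n) {s : ℝ} (hs : s ∈ Ioo (0:ℝ) 1) {f g : En n → ℝ}
    (hf : Continuous f) (hfc : HasCompactSupport f) (hg : ContDiff ℝ 2 g) (hgc : HasCompactSupport g) {C : ℝ}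
    (hC : ∀ x, g x ≠ 0 → ∀ y, |sdf f x y| ≤ C * kap s y) :
    Integrable (fun x => fracLap n s f x * g x) ∧ Integrable (fun x => fracLap n s g x * f x) ∧
    ∫ x, fracLap n s f x * g x = ∫ x, fracLap n s g x * f x := by
  obtain ⟨C', hC'⟩ := sdf_bound_c2c hs hg hgc
  obtain ⟨a1, a2⟩ := fracLap_fubini hn hs hf.measurable hg.continuous hgc hC
  obtain ⟨b1, b2⟩ := fracLap_fubini hn hs hg.continuous.measurable hf hfc (fun x _ => hC' x)
  refine ⟨a1, b1, ?_⟩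
  rw [a2, b2]
  congr 2; funext y
  rw [sdf_symm hf hg.continuous hgc]
  simp_rw [mul_comm]

def Th (t : ℝ) : ℝ := 1 - Real.smoothTransition (t - 1)

def eb {n : ℕ} (D : Dom n) (ε : ℝ) (x : En n) : ℝ := Th (D.τ x / ε)

lemma Th_cd : ContDiff ℝ 3 Th := by
  unfold Th
  exact contDiff_const.sub (Real.smoothTransition.contDiff.comp (contDiff_id.sub contDiff_const))

lemma Th_one {t : ℝ} (h : t ≤ 1) : Th t = 1 := by
  unfold Th; rw [Real.smoothTransition.zero_of_nonpos (by linarith)]; ring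

lemma Th_zero {t : ℝ} (h : 2 ≤ t) : Th t = 0 := by
  unfold Th; rw [Real.smoothTransition.one_of_one_le (by linarith)]; ring

lemma Th_nonneg (t : ℝ) : 0 ≤ Th t := by
  unfold Th; linarith [Real.smoothTransition.le_one (t - 1)]

lemma Th_le_one (t : ℝ) : Th t ≤ 1 := by
  unfold Th; linarith [Real.smoothTransition.nonneg (t - 1)]

lemma Th_d1_cd : ContDiff ℝ 2 (deriv Th) := by
  have : ContDiff ℝ (2 + 1) Th := by
    have e : (2 + 1 : WithTop ℕ∞) = 3 := by norm_num
    rw [e]; exact Th_cd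
  exact (contDiff_succ_iff_deriv.1 this).2.2

lemma Th_out {t : ℝ} (h : t ∉ Icc (0:ℝ) 3) : deriv Th t = 0 ∧ deriv (deriv Th) t = 0 := by
  have h' : t < 0 ∨ 3 < t := by
    by_contra hc; push Not at hc; exact h hc
  have key : ∃ c : ℝ, Th =ᶠ[𝓝 t] fun _ => c := by
    rcases h' with h' | h'
    · exact ⟨1, by filter_upwards [Iio_mem_nhds h'] with z hz; exact Th_one (by linarith [show z < 0 from hz])⟩
    · exact ⟨0, by filter_upwards [Ioi_mem_nhds h'] with z hz; exact Th_zero (by linarith [show 3 < z from hz])⟩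
  obtain ⟨c, hc⟩ := key
  have h1 := hc.deriv
  refine ⟨by simpa using h1.eq_of_nhds, ?_⟩
  have h2 := h1.deriv.eq_of_nhds
  simpa using h2

lemma Th_bound : ∃ C, 1 ≤ C ∧ ∀ t, |deriv Th t| ≤ C ∧ |deriv (deriv Th) t| ≤ C := by
  obtain ⟨M1, h1⟩ := (isCompact_Icc (a := (0:ℝ)) (b := 3)).exists_bound_of_continuousOn Th_d1_cd.continuous.continuousOn
  obtain ⟨M2, h2⟩ := (isCompact_Icc (a := (0:ℝ)) (b := 3)).exists_bound_of_continuousOn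
    ((Th_d1_cd.continuous_deriv (by norm_num)).continuousOn)
  refine ⟨max 1 (max M1 M2), le_max_left _ _, fun t => ?_⟩
  by_cases ht : t ∈ Icc (0:ℝ) 3
  · exact ⟨(h1 t ht).trans ((le_max_left _ _).trans (le_max_right _ _)), 
      (h2 t ht).trans ((le_max_right _ _).trans (le_max_right _ _))⟩
  · obtain ⟨a, b⟩ := Th_out ht
    rw [a, b]; simp

section
variable {n : ℕ} (D : Dom n) {ε : ℝ}

lemma eb_cd : ContDiff ℝ 2 (eb D ε) := by
  unfold eb
  exact (Th_cd.of_le (by norm_num)).comp (D.smooth.div_const _)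

lemma eb_one (hε : 0 < ε) {x : En n} (hx : D.τ x ≤ ε) : eb D ε x = 1 := by
  unfold eb; exact Th_one (by rw [div_le_one hε]; exact hx)

lemma eb_zero (hε : 0 < ε) {x : En n} (hx : 2 * ε ≤ D.τ x) : eb D ε x = 0 := by
  unfold eb; exact Th_zero (by rw [le_div_iff₀ hε]; exact hx)

lemma eb_nonneg (x : En n) : 0 ≤ eb D ε x := Th_nonneg _
lemma eb_le_one (x : En n) : eb D ε x ≤ 1 := Th_le_one _

lemma eb_bound : ∃ C, 1 ≤ C ∧ ∀ ε, 0 < ε → ε ≤ 1 → ∀ x, ‖x‖ ≤ D.R + 10 → ∀ v,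
    |fderiv ℝ (eb D ε) x v| ≤ C / ε * ‖v‖ ∧ |Hs (eb D ε) x v| ≤ C / ε ^ 2 * ‖v‖ ^ 2 := by
  have hK := D.hK
  obtain ⟨C, hC, hT⟩ := Th_bound
  refine ⟨2 * C * D.K ^ 2, by nlinarith [mul_pos (show 0 < C by linarith) (show 0 < D.K by linarith)], fun ε hε hε1 x hx v => ?_⟩
  have d1 : |fderiv ℝ D.τ x v| ≤ D.K * ‖v‖ :=
    ((fderiv ℝ D.τ x).le_opNorm v).trans (by gcongr; exact D.d1 x hx)
  have d2 : |Hs D.τ x v| ≤ D.K * ‖v‖ ^ 2 :=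
    (abs_Hs_le _ _ _).trans (mul_le_mul_of_nonneg_right (D.d2 x hx) (by positivity))
  have hTd : ∀ t, HasDerivAt Th (deriv Th t) t := fun t => (Th_cd.differentiable (by norm_num) t).hasDerivAt
  have hTd2 : ∀ t, HasDerivAt (deriv Th) (deriv (deriv Th) t) t := fun t =>
    (Th_d1_cd.differentiable (by norm_num) t).hasDerivAt
  have g1 : ∀ t, HasDerivAt (fun t => Th (t / ε)) (deriv Th (t / ε) / ε) t := fun t => by
    have := (hTd (t / ε)).comp t ((hasDerivAt_id t).div_const ε)
    exact this.congr_deriv (by ring)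
  have g2 : ∀ t, HasDerivAt (fun t => deriv Th (t / ε) / ε) (deriv (deriv Th) (t / ε) / ε / ε) t := fun t => by
    have := ((hTd2 (t / ε)).comp t ((hasDerivAt_id t).div_const ε)).div_const ε
    exact this.congr_deriv (by ring)
  obtain ⟨b1, b2⟩ := hT (D.τ x / ε)
  constructor
  · have : HasFDerivAt (eb D ε) ((deriv Th (D.τ x / ε) / ε) • fderiv ℝ D.τ x) x :=
      (g1 (D.τ x)).comp_hasFDerivAt x (D.smooth.differentiable (by norm_num) x).hasFDerivAt
    rw [this.fderiv, smul_apply, smul_eq_mul, abs_mul, abs_div, abs_of_pos hε]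
    calc _ ≤ C / ε * (D.K * ‖v‖) := by gcongr
      _ = (1 * C * D.K) / ε * ‖v‖ := by ring
      _ ≤ _ := by gcongr <;> nlinarith
  · have := Hs_comp (q := D.τ) (x := x) D.smooth.contDiffAt (Θ := fun t => Th (t / ε)) 
      (((Th_cd.of_le (by norm_num)).comp (contDiff_id.div_const _)).contDiffAt)
      (Eventually.of_forall g1) (g2 _) v
    have e : Hs (eb D ε) x v = _ := this
    rw [e]
    refine (abs_add_le _ _).trans ?_
    rw [abs_mul, abs_mul, abs_div, abs_div, abs_div, abs_of_pos hε, abs_pow]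
    calc _ ≤ C / ε / ε * (D.K * ‖v‖) ^ 2 + C / ε * (D.K * ‖v‖ ^ 2) := by gcongr
      _ ≤ C / ε / ε * (D.K * ‖v‖) ^ 2 + C / ε / ε * (D.K ^ 2 * ‖v‖ ^ 2) := by
        have q1 : C / ε ≤ C / ε / ε := by
          rw [le_div_iff₀ hε]; exact mul_le_of_le_one_right (by positivity) hε1
        have q2 : D.K ≤ D.K ^ 2 := by nlinarith
        have q3 : D.K * ‖v‖ ^ 2 ≤ D.K ^ 2 * ‖v‖ ^ 2 := mul_le_mul_of_nonneg_right q2 (by positivity)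
        have q4 := mul_le_mul q1 q3 (by positivity) (by positivity)
        linarith
      _ = _ := by field_simp; ring

end

lemma Dom.hcs {n : ℕ} (D : Dom n) {f : En n → ℝ} (h : ∀ x, D.τ x ≤ 0 → f x = 0) : HasCompactSupport f := by
  refine HasCompactSupport.of_support_subset_isCompact (isCompact_closedBall (0 : En n) D.R) ?_
  intro x hx
  by_contra hc
  refine hx (h x ?_)
  by_contra h0
  push Not at h0
  exact hc (by simpa using (D.mem_ball x h0).le)

lemma Sol.trunc {n : ℕ} {D : Dom n} {s a lam : ℝ} {u : En n → ℝ} (h : Sol D s a lam u) {ε : ℝ} (hε : 0 < ε) :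
    ∃ u1 : En n → ℝ, ContDiff ℝ 2 u1 ∧ HasCompactSupport u1 ∧ (∀ x, ε ≤ D.τ x → u1 x = u x) := by
  refine ⟨fun x => (1 - eb D (ε / 2) x) * u x, ?_, ?_, ?_⟩
  · rw [contDiff_iff_contDiffAt]
    intro x
    rcases lt_or_ge 0 (D.τ x) with h0 | h0
    · exact (contDiffAt_const.sub (eb_cd D).contDiffAt).mul (h.c2 x h0)
    · have : (fun x => (1 - eb D (ε / 2) x) * u x) =ᶠ[𝓝 x] fun _ => 0 := by
        have : ∀ᶠ z in 𝓝 x, D.τ z < ε / 2 := D.τ_cont.continuousAt.eventually (gt_mem_nhds (by linarith))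
        filter_upwards [this] with z hz
        rw [eb_one D (by positivity) hz.le]; ring
      exact contDiffAt_const.congr_of_eventuallyEq this
  · exact D.hcs fun x hx => by rw [h.zero x hx]; ring
  · intro x hx
    show (1 - eb D (ε / 2) x) * u x = u x
    rw [eb_zero D (by positivity) (by linarith)]; ring

lemma Sol.test1 {n : ℕ} {D : Dom n} {s a lam : ℝ} {u : En n → ℝ} (h : Sol D s a lam u) {ε : ℝ} (hε : 0 < ε)
    {ψ : En n → ℝ} (hψ : ContDiff ℝ 2 ψ) (hψ0 : ∀ x, D.τ x < ε → ψ x = 0) :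
    Integrable (fun x => fracLap n s ψ x * u x) ∧
    -(∫ x, u x * lap n ψ x) + a * ∫ x, fracLap n s ψ x * u x = lam * ∫ x, u x * ψ x := by
  have hK := D.hK
  have hs := h.hs
  have hψc : HasCompactSupport ψ := D.hcs fun x hx => hψ0 x (by linarith)
  have huc : HasCompactSupport u := D.hcs h.zero
  obtain ⟨u1, hu1, hu1c, hu1e⟩ := h.trunc (ε := ε / 4) (by positivity)
  have heq : ∀ z, ε / 4 < D.τ z → u1 =ᶠ[𝓝 z] u := fun z hz => by
    filter_upwards [D.τ_cont.continuousAt.eventually (lt_mem_nhds hz)] with y hy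
    exact hu1e y hy.le
  have hne : ∀ x, ψ x ≠ 0 → ε ≤ D.τ x := fun x hx => by
    by_contra hc; push Not at hc; exact hx (hψ0 x hc)
  obtain ⟨M, hM0, hM⟩ := c2c_bound hu1 hu1c
  obtain ⟨B, hB0, hB⟩ := h.bdd
  obtain ⟨C, hC⟩ : ∃ C, ∀ x, ψ x ≠ 0 → ∀ y, |sdf u x y| ≤ C * kap s y := by
    set ρ := min 1 (ε / (2 * D.K)) with hρ
    refine ⟨M + 4 * B / ρ ^ (1 + s), fun x hx y => ?_⟩
    have hxe := hne x hx
    have hz : ∀ z ∈ ball x ρ, ε / 4 < D.τ z := fun z hz => by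
      have := D.inner_mem (x := x) (y := z) (by linarith) (by
        rw [Metric.mem_ball, dist_eq_norm] at hz
        refine hz.le.trans ((min_le_right _ _).trans ?_)
        gcongr)
      linarith
    refine sdf_bound_ball hs (by positivity) (min_le_left _ _) hB (fun z hz' => h.c2 z (by linarith [hz z hz'])) 
      (fun z hz' v => ?_) y
    rw [← Hs_congr (heq z (hz z hz'))]
    exact hM z v
  obtain ⟨i1, i2, e1⟩ := fracLap_symm h.hn hs h.cont huc hψ hψc hC
  refine ⟨i2, ?_⟩
  have hlap : ∀ x, ψ x ≠ 0 → lap n u x = lap n u1 x := fun x hx => by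
    have hxe := hne x hx
    rw [lap_eq_sum (h.c2 x (by linarith)), lap_eq_sum hu1.contDiffAt]
    exact Finset.sum_congr rfl fun i _ => Hs_congr (heq x (by linarith)).symm _
  have e2 : ∫ x, u x * lap n ψ x = ∫ x, lap n u1 x * ψ x := by
    rw [int_lap_symm hu1 hu1c hψ hψc]
    congr 1; funext x
    by_cases hx : ε / 4 < D.τ x
    · rw [hu1e x hx.le]
    · have : ψ =ᶠ[𝓝 x] fun _ => 0 := by
        filter_upwards [D.τ_cont.continuousAt.eventually (gt_mem_nhds (show D.τ x < ε by linarith))] with y hy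
        exact hψ0 y hy
      have : lap n ψ x = 0 := by
        rw [lap_eq_sum hψ.contDiffAt]
        refine Finset.sum_eq_zero fun i _ => ?_
        rw [Hs_congr this]
        simp [Hs]
      rw [this]; ring
  have i3 : Integrable (fun x => lap n u1 x * ψ x) :=
    Continuous.integrable_of_hasCompactSupport ((continuous_lap hu1).mul hψ.continuous) hψc.mul_left
  rw [e2, ← e1, ← integral_neg, ← integral_const_mul, ← integral_const_mul]
  refine (integral_add i3.neg (i1.const_mul a)).symm.trans ?_
  congr 1; funext x
  by_cases hx : ψ x = 0
  · simp [hx]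
  · have := h.eq x (by linarith [hne x hx])
    rw [hlap x hx] at this
    calc _ = (- lap n u1 x + a * fracLap n s u x) * ψ x := by simp; ring
      _ = _ := by rw [this]; ring

def Ps {n : ℕ} (b : En n) (θ : ℝ) (x : En n) : ℝ := Real.cos (⟪b, x⟫ + θ)

def mb (n : ℕ) (s : ℝ) (b : En n) : ℝ :=
  (cK n s / 2) * ∫ y : En n, (2 - 2 * Real.cos ⟪b, y⟫) / ‖y‖ ^ ((n : ℝ) + 2 * s)

section
variable {n : ℕ} (b : En n) (θ : ℝ)

lemma Ps_cd : ContDiff ℝ 2 (Ps b θ) := by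
  unfold Ps
  exact Real.contDiff_cos.comp ((contDiff_const.inner ℝ contDiff_id).add contDiff_const)

lemma Ps_cont : Continuous (Ps b θ) := (Ps_cd b θ).continuous

lemma Ps_le (x : En n) : |Ps b θ x| ≤ 1 := Real.abs_cos_le_one _

lemma Ps_fd (x v : En n) : fderiv ℝ (Ps b θ) x v = -Real.sin (⟪b, x⟫ + θ) * ⟪b, v⟫ := by
  have h1 : HasFDerivAt (fun x : En n => ⟪b, x⟫ + θ) (innerSL ℝ b) x :=
    ((innerSL ℝ b).hasFDerivAt (x := x)).add_const θ
  have := (Real.hasDerivAt_cos (⟪b, x⟫ + θ)).comp_hasFDerivAt x h1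
  rw [show fderiv ℝ (Ps b θ) x = _ from this.fderiv]
  simp

lemma Ps_Hs (x v : En n) : Hs (Ps b θ) x v = -⟪b, v⟫ ^ 2 * Ps b θ x := by
  have h0 : ∀ t : ℝ, HasDerivAt (fun t : ℝ => ⟪b, x + t • v⟫ + θ) ⟪b, v⟫ t := fun t => by
    have e : (fun t : ℝ => ⟪b, x + t • v⟫ + θ) = fun t => (⟪b, x⟫ + t * ⟪b, v⟫) + θ := by
      funext t; rw [inner_add_right, inner_smul_right]
    rw [e]
    exact ((((hasDerivAt_id t).mul_const _).const_add _).add_const _).congr_deriv (by simp)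
  have h1 : ∀ t : ℝ, HasDerivAt (fun t : ℝ => Ps b θ (x + t • v))
      (-Real.sin (⟪b, x + t • v⟫ + θ) * ⟪b, v⟫) t := fun t =>
    (Real.hasDerivAt_cos _).comp t (h0 t)
  have h2 : HasDerivAt (fun t : ℝ => -Real.sin (⟪b, x + t • v⟫ + θ) * ⟪b, v⟫)
      (-(Real.cos (⟪b, x + (0:ℝ) • v⟫ + θ) * ⟪b, v⟫) * ⟪b, v⟫) 0 :=
    (((Real.hasDerivAt_sin _).comp (0:ℝ) (h0 0)).neg).mul_const _
  rw [Hs_eq_of_line (Ps_cd b θ).contDiffAt (Eventually.of_forall h1) h2]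
  simp [Ps]; ring

lemma Ps_lap (x : En n) : lap n (Ps b θ) x = -‖b‖ ^ 2 * Ps b θ x := by
  rw [lap_eq_sum (Ps_cd b θ).contDiffAt]
  simp_rw [Ps_Hs]
  rw [← Finset.sum_mul, Finset.sum_neg_distrib, EuclideanSpace.real_norm_sq_eq]
  congr 2
  refine Finset.sum_congr rfl fun i _ => ?_
  rw [EuclideanSpace.inner_single_right]; simp

lemma Ps_sdf (x y : En n) : sdf (Ps b θ) x y = -((2 - 2 * Real.cos ⟪b, y⟫) * Ps b θ x) := by
  unfold sdf Ps
  rw [inner_add_right, inner_sub_right,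
    show ⟪b, x⟫ + ⟪b, y⟫ + θ = (⟪b, x⟫ + θ) + ⟪b, y⟫ by ring,
    show ⟪b, x⟫ - ⟪b, y⟫ + θ = (⟪b, x⟫ + θ) - ⟪b, y⟫ by ring, Real.cos_add, Real.cos_sub]
  ring

lemma Ps_fracLap (s : ℝ) (x : En n) : fracLap n s (Ps b θ) x = mb n s b * Ps b θ x := by
  rw [fracLap_eq, mb]
  simp_rw [Ps_sdf]
  have : ∀ y : En n, -((2 - 2 * Real.cos ⟪b, y⟫) * Ps b θ x) / ‖y‖ ^ ((n : ℝ) + 2 * s) =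
    ((2 - 2 * Real.cos ⟪b, y⟫) / ‖y‖ ^ ((n : ℝ) + 2 * s)) * (-Ps b θ x) := fun y => by ring
  simp_rw [this, integral_mul_const]
  ring

lemma mb_nonneg {s : ℝ} (hs : s ∈ Ioo (0:ℝ) 1) : 0 ≤ mb n s b := by
  unfold mb
  have := cK_pos n s hs
  refine mul_nonneg (by linarith) (integral_nonneg fun y => ?_)
  have := Real.cos_le_one ⟪b, y⟫
  exact div_nonneg (by linarith) (by positivity)

lemma mb_smul {s μ : ℝ} (hμ : 0 < μ) : mb n s (μ • b) = μ ^ (2 * s) * mb n s b := by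
  unfold mb
  have := Measure.integral_comp_smul (volume : Measure (En n))
    (fun y : En n => (2 - 2 * Real.cos ⟪b, y⟫) / ‖y‖ ^ ((n : ℝ) + 2 * s)) μ
  have e : ∀ y : En n, (2 - 2 * Real.cos ⟪μ • b, y⟫) / ‖y‖ ^ ((n : ℝ) + 2 * s) = 
      μ ^ ((n : ℝ) + 2 * s) * ((2 - 2 * Real.cos ⟪b, μ • y⟫) / ‖μ • y‖ ^ ((n : ℝ) + 2 * s)) := fun y => by
    rw [inner_smul_left, inner_smul_right, norm_smul, Real.norm_of_nonneg hμ.le, Real.mul_rpow hμ.le (norm_nonneg _)]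
    have : μ ^ ((n : ℝ) + 2 * s) ≠ 0 := by positivity
    simp only [conj_trivial]
    rw [← div_div, mul_div_assoc', mul_div_assoc', mul_div_cancel_left₀ _ this]
  simp_rw [e, integral_const_mul]
  rw [this, finrank_euclideanSpace_fin, abs_of_pos (by positivity), smul_eq_mul, Real.rpow_add hμ, Real.rpow_natCast]
  field_simp

end

lemma psi2_bound {n : ℕ} (D : Dom n) (b : En n) (θ : ℝ) : ∃ C, 1 ≤ C ∧ ∀ ε, 0 < ε → ε ≤ 1 → ∀ x, ‖x‖ ≤ D.R + 10 → ∀ v,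
    |Hs (fun z => eb D ε z * Ps b θ z) x v| ≤ C / ε ^ 2 * ‖v‖ ^ 2 := by
  obtain ⟨C, hC, h⟩ := eb_bound D
  refine ⟨C + 2 * C * ‖b‖ + ‖b‖ ^ 2, by nlinarith [norm_nonneg b, mul_nonneg (show 0 ≤ C by linarith) (norm_nonneg b)],
    fun ε hε hε1 x hx v => ?_⟩
  obtain ⟨h1, h2⟩ := h ε hε hε1 x hx v
  rw [Hs_mul (eb_cd D).contDiffAt (Ps_cd b θ).contDiffAt, Ps_Hs, Ps_fd]
  have hb : |⟪b, v⟫| ≤ ‖b‖ * ‖v‖ := abs_real_inner_le_norm b v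
  have hP := Ps_le b θ x
  have hsn := Real.abs_sin_le_one (⟪b, x⟫ + θ)
  have he1 := eb_le_one D (ε := ε) x
  have he0 := eb_nonneg D (ε := ε) x
  have hi1 : 1 ≤ 1 / ε ^ 2 := by rw [le_div_iff₀ (by positivity)]; nlinarith
  have hi2 : C / ε ≤ C / ε ^ 2 := by
    gcongr; nlinarith
  have t1 : |Hs (eb D ε) x v * Ps b θ x| ≤ C / ε ^ 2 * ‖v‖ ^ 2 := by
    rw [abs_mul]
    exact (mul_le_of_le_one_right (abs_nonneg _) hP).trans h2
  have t2 : |2 * (fderiv ℝ (eb D ε) x v * (-Real.sin (⟪b, x⟫ + θ) * ⟪b, v⟫))| ≤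
      2 * (C / ε ^ 2 * ‖v‖ * (1 * (‖b‖ * ‖v‖))) := by
    rw [abs_mul, abs_mul, abs_mul, abs_neg, abs_two]
    refine mul_le_mul_of_nonneg_left ?_ (by norm_num)
    exact mul_le_mul (h1.trans (mul_le_mul_of_nonneg_right hi2 (norm_nonneg _)))
      (mul_le_mul hsn hb (abs_nonneg _) (by norm_num)) (by positivity) (by positivity)
  have t3 : |eb D ε x * (-⟪b, v⟫ ^ 2 * Ps b θ x)| ≤ 1 / ε ^ 2 * (‖b‖ * ‖v‖) ^ 2 := by
    rw [abs_mul, abs_mul, abs_neg, abs_pow, abs_of_nonneg he0]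
    refine mul_le_mul (he1.trans hi1) ?_ (by positivity) (by positivity)
    refine (mul_le_of_le_one_right (by positivity) hP).trans ?_
    gcongr
  refine (abs_add_le _ _).trans ((add_le_add ((abs_add_le _ _).trans (add_le_add t1 t2)) t3).trans (le_of_eq ?_))
  ring

lemma psi2_sdf {n : ℕ} (D : Dom n) {s : ℝ} (hs : s ∈ Ioo (0:ℝ) 1) (b : En n) (θ : ℝ) :
    ∃ C, 0 < C ∧ ∀ ε, 0 < ε → ε ≤ 1 → ∀ x, 0 < D.τ x → ∀ y,
      |sdf (fun z => eb D ε z * Ps b θ z) x y| ≤ C * D.τ x ^ (-(1 + s)) * kap s y := by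
  have hK := D.hK
  obtain ⟨C, hC, h⟩ := psi2_bound D b θ
  have hs1 : (0:ℝ) < 1 + s := by linarith [hs.1]
  refine ⟨4 * (2 * D.K) ^ (1 + s) + (C + 4) * 4 ^ (1 + s), by positivity, fun ε hε hε1 x hx y => ?_⟩
  have hM : ∀ z, |eb D ε z * Ps b θ z| ≤ 1 := fun z => by
    rw [abs_mul, abs_of_nonneg (eb_nonneg D z)]
    exact mul_le_one₀ (eb_le_one D z) (abs_nonneg _) (Ps_le b θ z)
  have h4 := abs_sdf_le4 hM x y
  have hk := kap_nonneg s y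
  have hτ : 0 < D.τ x ^ (-(1 + s)) := by positivity
  rcases le_or_gt (4 * ε) (D.τ x) with h1 | h1
  · have hA : |sdf (fun z => eb D ε z * Ps b θ z) x y| ≤ 4 * (2 * D.K) ^ (1 + s) * D.τ x ^ (-(1 + s)) * kap s y := by
      rcases le_or_gt ‖y‖ (D.τ x / (2 * D.K)) with h2 | h2
      · have hz : ∀ z, ‖z - x‖ ≤ D.τ x / (2 * D.K) → eb D ε z = 0 := fun z hz =>
          eb_zero D hε (by linarith [D.inner_mem hx hz])
        have : sdf (fun z => eb D ε z * Ps b θ z) x y = 0 := by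
          unfold sdf
          simp only []
          rw [hz (x + y) (by simpa using h2), hz (x - y) (by simpa using h2), hz x (by simp; positivity)]
          ring
        rw [this, abs_zero]; positivity
      · have := one_le_kap hs (ρ := D.τ x / (2 * D.K)) (by positivity) 
          (by rw [div_le_one (by positivity)]; linarith [D.le_one x]) h2.le
        rw [Real.div_rpow hx.le (by positivity), Real.rpow_neg (x := 2 * D.K) (by positivity), div_inv_eq_mul] at this
        nlinarith
    refine hA.trans (mul_le_mul_of_nonneg_right (mul_le_mul_of_nonneg_right ?_ hτ.le) hk)
    have : 0 ≤ (C + 4) * 4 ^ (1 + s) := by positivity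
    linarith
  · have hA : |sdf (fun z => eb D ε z * Ps b θ z) x y| ≤ (C + 4) * ε ^ (-(1 + s)) * kap s y := by
      have hεp : 0 < ε ^ (-(1 + s)) := by positivity
      rcases le_or_gt ‖y‖ ε with h2 | h2
      · have hcd : ContDiff ℝ 2 (fun z => eb D ε z * Ps b θ z) := (eb_cd D).mul (Ps_cd b θ)
        have hb : ∀ t ∈ Icc (-1:ℝ) 1, |Hs (fun z => eb D ε z * Ps b θ z) (x + t • y) y| ≤ C / ε ^ 2 * ‖y‖ ^ 2 := fun t ht => by
          refine h ε hε hε1 _ ?_ y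
          have q1 := D.mem_ball x hx
          have q2 : ‖t • y‖ ≤ 1 * 1 := by
            rw [norm_smul]
            exact mul_le_mul (abs_le.2 ht) (h2.trans hε1) (norm_nonneg _) (by norm_num)
          linarith [norm_add_le x (t • y)]
        have q1 := sdf_le (fun t _ => hcd.contDiffAt) (fun t ht => (abs_le.1 (hb t ht)).2)
        have q2 := le_sdf (fun t _ => hcd.contDiffAt) (fun t ht => (abs_le.1 (hb t ht)).1)
        have q3 := sq_le_kap_r hs hε hε1 h2
        have q4 : C / ε ^ 2 * ‖y‖ ^ 2 ≤ C * ε ^ (-(1 + s)) * kap s y := by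
          have : ε ^ (-(1 + s)) = ε ^ (-s) / ε := by
            rw [show -(1 + s) = -s - 1 by ring, Real.rpow_sub hε, Real.rpow_one]
          rw [this]
          calc C / ε ^ 2 * ‖y‖ ^ 2 = C / ε * (‖y‖ ^ 2 / ε) := by field_simp
            _ ≤ C / ε * (ε ^ (-s) * kap s y) := mul_le_mul_of_nonneg_left q3 (by positivity)
            _ = _ := by ring
        refine (abs_le.2 ⟨q2, q1⟩).trans (q4.trans ?_)
        refine mul_le_mul_of_nonneg_right (mul_le_mul_of_nonneg_right (by linarith) hεp.le) hk
      · have := one_le_kap hs hε hε1 h2.le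
        have q : 0 ≤ C * (ε ^ (-(1 + s)) * kap s y) := by positivity
        nlinarith
    refine hA.trans (mul_le_mul_of_nonneg_right ?_ hk)
    have e1 : ε ^ (-(1 + s)) ≤ 4 ^ (1 + s) * D.τ x ^ (-(1 + s)) := by
      have := Real.rpow_le_rpow_of_nonpos (z := -(1 + s)) (x := D.τ x / 4) (y := ε) (by positivity) (by linarith) (by linarith)
      rw [Real.div_rpow hx.le (by norm_num), Real.rpow_neg (x := 4) (by norm_num), div_inv_eq_mul] at this
      linarith
    have : 0 ≤ 4 * (2 * D.K) ^ (1 + s) * D.τ x ^ (-(1 + s)) := by positivity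
    have e2 := mul_le_mul_of_nonneg_left e1 (show 0 ≤ C + 4 by linarith)
    linarith

def gE {n : ℕ} (D : Dom n) (b : En n) (θ : ℝ) (z : En n) : ℝ := if D.τ z ≤ 0 then Ps b θ z else 0

lemma eb_tendsto {n : ℕ} (D : Dom n) (b : En n) (θ : ℝ) (z : En n) :
    Tendsto (fun ε => eb D ε z * Ps b θ z) (𝓝[>] 0) (𝓝 (gE D b θ z)) := by
  refine tendsto_const_nhds.congr' ?_
  unfold gE
  split_ifs with h
  · filter_upwards [self_mem_nhdsWithin] with ε hε
    rw [eb_one D hε (h.trans (le_of_lt hε))]; ring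
  · push Not at h
    have : Ioo (0:ℝ) (D.τ z / 2) ∈ 𝓝[>] (0:ℝ) := Ioo_mem_nhdsGT (by linarith)
    filter_upwards [this] with ε hε
    rw [eb_zero D hε.1 (by linarith [hε.2])]; ring

lemma psi2_abs {n : ℕ} (D : Dom n) (b : En n) (θ : ℝ) (ε : ℝ) (z : En n) : |eb D ε z * Ps b θ z| ≤ 1 := by
  rw [abs_mul, abs_of_nonneg (eb_nonneg D z)]
  exact mul_le_one₀ (eb_le_one D z) (abs_nonneg _) (Ps_le b θ z)

lemma psi2_cd {n : ℕ} (D : Dom n) (b : En n) (θ : ℝ) (ε : ℝ) : ContDiff ℝ 2 (fun z => eb D ε z * Ps b θ z) :=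
  (eb_cd D).mul (Ps_cd b θ)

lemma psi2_nice {n : ℕ} (D : Dom n) (b : En n) (θ : ℝ) (ε : ℝ) (x : En n) : Nice (fun z => eb D ε z * Ps b θ z) x :=
  ⟨(psi2_cd D b θ ε).contDiffAt, (psi2_cd D b θ ε).continuous.measurable, ⟨1, psi2_abs D b θ ε⟩⟩

/-- Domination and convergence for the fractional term. -/
lemma Sol.frac_tendsto {n : ℕ} {D : Dom n} {s a lam : ℝ} {u : En n → ℝ} (h : Sol D s a lam u) (b : En n) (θ : ℝ)
    (hm : ∀ᶠ ε in 𝓝[>] (0:ℝ), AEStronglyMeasurable (fun x => u x * fracLap n s (fun z => eb D ε z * Ps b θ z) x)) :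
    Tendsto (fun ε => ∫ x, u x * fracLap n s (fun z => eb D ε z * Ps b θ z) x) (𝓝[>] 0)
      (𝓝 (∫ x, u x * fracLap n s (gE D b θ) x)) := by
  obtain ⟨C, hC, hCb⟩ := psi2_sdf D h.hs b θ
  obtain ⟨A, hA, hAb⟩ := h.abs_le_tau
  have hI := IK_nonneg (n := n) h.hs
  have hε1 : ∀ᶠ ε in 𝓝[>] (0:ℝ), 0 < ε ∧ ε ≤ 1 := by
    filter_upwards [Ioo_mem_nhdsGT (show (0:ℝ) < 1 by norm_num)] with ε hε using ⟨hε.1, hε.2.le⟩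
  have hΩ : MeasurableSet D.Ω := measurableSet_lt measurable_const D.τ_cont.measurable
  refine tendsto_integral_filter_of_dominated_convergence
    (D.Ω.indicator fun x => A * (C * IK n s) * D.τ x ^ (-s)) hm ?_ ?_ ?_
  · filter_upwards [hε1] with ε hε
    refine Eventually.of_forall fun x => ?_
    by_cases hx : 0 < D.τ x
    · rw [indicator_of_mem (show x ∈ D.Ω from hx), norm_mul, Real.norm_eq_abs, Real.norm_eq_abs]
      have q1 : |fracLap n s (fun z => eb D ε z * Ps b θ z) x| ≤ C * D.τ x ^ (-(1 + s)) * IK n s := by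
        rw [abs_le]
        exact ⟨fracLap_ge_of_sdf_le (psi2_nice D b θ ε x) h.hn h.hs fun y => (abs_le.1 (hCb ε hε.1 hε.2 x hx y)).2,
          fracLap_le_of_le_sdf (psi2_nice D b θ ε x) h.hn h.hs fun y => (abs_le.1 (hCb ε hε.1 hε.2 x hx y)).1⟩
      have q2 := hAb x
      rw [max_eq_left hx.le] at q2
      refine (mul_le_mul q2 q1 (abs_nonneg _) (by positivity)).trans (le_of_eq ?_)
      have : D.τ x ^ (-s) = D.τ x * D.τ x ^ (-(1 + s)) := by
        conv_rhs => enter [1]; rw [← Real.rpow_one (D.τ x)]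
        rw [← Real.rpow_add hx]; congr 1; ring
      rw [this]; ring
    · push Not at hx
      rw [h.zero x hx, zero_mul, norm_zero]
      exact indicator_nonneg (fun x hx => by 
        have : 0 < D.τ x := hx
        positivity) _
  · exact (integrable_indicator_iff hΩ).2 ((D.int_neg h.hs).const_mul _)
  · refine Eventually.of_forall fun x => ?_
    by_cases hx : 0 < D.τ x
    · refine Tendsto.const_mul _ ?_
      simp_rw [fracLap_eq]
      refine Tendsto.const_mul _ ?_
      refine tendsto_integral_filter_of_dominated_convergence
        (fun y => C * D.τ x ^ (-(1 + s)) * kr n s y) ?_ ?_ ((kr_integrable n h.hn s h.hs).const_mul _) ?_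
      · filter_upwards [hε1] with ε hε
        exact ((psi2_nice D b θ ε x).integrable h.hn h.hs).aestronglyMeasurable
      · filter_upwards [hε1] with ε hε
        refine Eventually.of_forall fun y => ?_
        have hp : 0 ≤ ‖y‖ ^ ((n : ℝ) + 2 * s) := by positivity
        rw [norm_div, Real.norm_eq_abs, Real.norm_of_nonneg hp, kr, ← mul_div_assoc]
        exact div_le_div_of_nonneg_right (hCb ε hε.1 hε.2 x hx y) hp
      · refine Eventually.of_forall fun y => ?_
        refine Tendsto.div_const ?_ _
        unfold sdf
        exact ((eb_tendsto D b θ (x + y)).add (eb_tendsto D b θ (x - y))).sub ((eb_tendsto D b θ x).const_mul 2)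
    · push Not at hx
      simp_rw [h.zero x hx, zero_mul]
      exact tendsto_const_nhds

lemma Sol.lap_tendsto {n : ℕ} {D : Dom n} {s a lam : ℝ} {u : En n → ℝ} (h : Sol D s a lam u) 
    (hl : ∀ ε : ℝ, 0 < ε → ∃ r : ℝ, 0 < r ∧ ∀ x, 0 < D.τ x → D.τ x < r → |u x| ≤ ε * D.τ x) (b : En n) (θ : ℝ) :
    Tendsto (fun ε => ∫ x, u x * lap n (fun z => eb D ε z * Ps b θ z) x) (𝓝[>] 0) (𝓝 0) := by
  obtain ⟨C, hC, hCb⟩ := psi2_bound D b θ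
  obtain ⟨A, hA, hAb⟩ := D.strip
  rw [Metric.tendsto_nhds]
  intro δ hδ
  obtain ⟨r, hr, hrb⟩ := hl (δ / (9 * A * (n * C) + 1)) (by positivity)
  set δ' := δ / (9 * A * (n * C) + 1) with hδ'
  have hδ'0 : 0 < δ' := by positivity
  filter_upwards [Ioo_mem_nhdsGT (show (0:ℝ) < min 1 (r / 3) by positivity)] with ε hε
  obtain ⟨hε, hε2⟩ := hε
  have hε1 : ε ≤ 1 := (hε2.trans_le (min_le_left _ _)).le
  have hεr : 3 * ε ≤ r := by linarith [hε2.trans_le (min_le_right _ _)]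
  rw [Real.dist_eq, sub_zero]
  have e1 : ∀ x, x ∉ {x | 0 < D.τ x ∧ D.τ x < 3 * ε} → u x * lap n (fun z => eb D ε z * Ps b θ z) x = 0 := fun x hx => by
    by_cases h0 : 0 < D.τ x
    · have h3 : 3 * ε ≤ D.τ x := by
        by_contra hc; push Not at hc; exact hx ⟨h0, hc⟩
      have hz : (fun z => eb D ε z * Ps b θ z) =ᶠ[𝓝 x] fun _ => 0 := by
        filter_upwards [D.τ_cont.continuousAt.eventually (lt_mem_nhds (show 2 * ε < D.τ x by linarith))] with z hz
        rw [eb_zero D hε hz.le]; ring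
      rw [lap_eq_sum (psi2_cd D b θ ε).contDiffAt]
      rw [Finset.sum_eq_zero, mul_zero]
      intro i _
      rw [Hs_congr hz]; simp [Hs]
    · rw [h.zero x (by linarith), zero_mul]
  rw [← setIntegral_eq_integral_of_forall_compl_eq_zero e1]
  have hfin : volume {x | 0 < D.τ x ∧ D.τ x < 3 * ε} < ⊤ := (hAb (3 * ε) (by positivity)).trans_lt ENNReal.ofReal_lt_top
  have := norm_setIntegral_le_of_norm_le_const (μ := volume) (s := {x | 0 < D.τ x ∧ D.τ x < 3 * ε})
    (f := fun x => u x * lap n (fun z => eb D ε z * Ps b θ z) x) (C := δ' * (3 * ε) * (n * (C / ε ^ 2))) hfin (fun x hx => by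
      obtain ⟨x0, x1⟩ := hx
      rw [norm_mul]
      refine mul_le_mul ?_ ?_ (norm_nonneg _) (by positivity)
      · exact (hrb x x0 (by linarith)).trans (mul_le_mul_of_nonneg_left x1.le hδ'0.le)
      · rw [lap_eq_sum (psi2_cd D b θ ε).contDiffAt]
        refine (norm_sum_le _ _).trans ?_
        refine (Finset.sum_le_card_nsmul _ _ (C / ε ^ 2) fun i _ => ?_).trans (by simp)
        have := hCb ε hε hε1 x (by linarith [D.mem_ball x x0]) (EuclideanSpace.single i 1)
        simpa using this)
  have hv : volume.real {x | 0 < D.τ x ∧ D.τ x < 3 * ε} ≤ A * (3 * ε) :=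
    ENNReal.toReal_le_of_le_ofReal (by positivity) (hAb (3 * ε) (by positivity))
  have q := this.trans (mul_le_mul_of_nonneg_left hv (by positivity))
  refine lt_of_le_of_lt q ?_
  have : δ' * (3 * ε) * (n * (C / ε ^ 2)) * (A * (3 * ε)) = δ' * (9 * A * (n * C)) := by field_simp; ring
  rw [this, hδ', div_mul_eq_mul_div, div_lt_iff₀ (by positivity)]
  nlinarith

lemma Sol.TI {n : ℕ} {D : Dom n} {s a lam : ℝ} {u : En n → ℝ} (h : Sol D s a lam u) 
    (hl : ∀ ε : ℝ, 0 < ε → ∃ r : ℝ, 0 < r ∧ ∀ x, 0 < D.τ x → D.τ x < r → |u x| ≤ ε * D.τ x) (b : En n) (θ : ℝ) :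
    (‖b‖ ^ 2 + a * mb n s b - lam) * ∫ x, u x * Ps b θ x = a * ∫ x, u x * fracLap n s (gE D b θ) x := by
  have huc : HasCompactSupport u := D.hcs h.zero
  have iP : Integrable (fun x => u x * Ps b θ x) :=
    (h.cont.mul (Ps_cont b θ)).integrable_of_hasCompactSupport huc.mul_right
  have i2 : ∀ ε, Integrable (fun x => u x * (eb D ε x * Ps b θ x)) := fun ε =>
    (h.cont.mul (psi2_cd D b θ ε).continuous).integrable_of_hasCompactSupport huc.mul_right
  have iL : ∀ ε, Integrable (fun x => u x * lap n (fun z => eb D ε z * Ps b θ z) x) := fun ε =>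
    (h.cont.mul (continuous_lap (psi2_cd D b θ ε))).integrable_of_hasCompactSupport huc.mul_right
  have key : ∀ ε, 0 < ε → Integrable (fun x => u x * fracLap n s (fun z => eb D ε z * Ps b θ z) x) ∧
      (‖b‖ ^ 2 + a * mb n s b - lam) * ∫ x, u x * Ps b θ x = 
      -(∫ x, u x * lap n (fun z => eb D ε z * Ps b θ z) x) + a * (∫ x, u x * fracLap n s (fun z => eb D ε z * Ps b θ z) x)
       - lam * ∫ x, u x * (eb D ε x * Ps b θ x) := fun ε hε => by
    obtain ⟨j1, j2⟩ := h.test1 hε (ψ := fun x => Ps b θ x - eb D ε x * Ps b θ x) ((Ps_cd b θ).sub (psi2_cd D b θ ε))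
      (fun x hx => by rw [eb_one D hε hx.le]; ring)
    have ef : ∀ x, fracLap n s (fun x => Ps b θ x - eb D ε x * Ps b θ x) x = mb n s b * Ps b θ x
        - fracLap n s (fun z => eb D ε z * Ps b θ z) x := fun x => by
      have nP : Nice (Ps b θ) x := ⟨(Ps_cd b θ).contDiffAt, (Ps_cont b θ).measurable, ⟨1, Ps_le b θ⟩⟩
      have := fracLap_add h.hn h.hs nP (psi2_nice D b θ ε x).neg
      rw [fracLap_neg, Ps_fracLap] at this
      simp_rw [sub_eq_add_neg]
      exact this
    have el : ∀ x, lap n (fun x => Ps b θ x - eb D ε x * Ps b θ x) x = -‖b‖ ^ 2 * Ps b θ x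
        - lap n (fun z => eb D ε z * Ps b θ z) x := fun x => by
      rw [lap_sub (Ps_cd b θ).contDiffAt (psi2_cd D b θ ε).contDiffAt, Ps_lap]
    have i3 : Integrable (fun x => u x * fracLap n s (fun z => eb D ε z * Ps b θ z) x) := by
      have := (iP.const_mul (mb n s b)).sub j1
      refine this.congr (Eventually.of_forall fun x => ?_)
      simp only [Pi.sub_apply, ef]; ring
    refine ⟨i3, ?_⟩
    have k1 : ∫ x, u x * lap n (fun x => Ps b θ x - eb D ε x * Ps b θ x) x = 
        -‖b‖ ^ 2 * (∫ x, u x * Ps b θ x) - ∫ x, u x * lap n (fun z => eb D ε z * Ps b θ z) x := by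
      rw [← integral_const_mul]
      refine Eq.trans ?_ (integral_sub (iP.const_mul _) (iL ε))
      congr 1; funext x; rw [el]; ring
    have k2 : ∫ x, fracLap n s (fun x => Ps b θ x - eb D ε x * Ps b θ x) x * u x = 
        mb n s b * (∫ x, u x * Ps b θ x) - ∫ x, u x * fracLap n s (fun z => eb D ε z * Ps b θ z) x := by
      rw [← integral_const_mul]
      refine Eq.trans ?_ (integral_sub (iP.const_mul _) i3)
      congr 1; funext x; rw [ef]; ring
    have k3 : ∫ x, u x * (Ps b θ x - eb D ε x * Ps b θ x) = 
        (∫ x, u x * Ps b θ x) - ∫ x, u x * (eb D ε x * Ps b θ x) := by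
      refine Eq.trans ?_ (integral_sub iP (i2 ε))
      congr 1; funext x; ring
    rw [k1, k2, k3] at j2
    linarith
  have l2 : Tendsto (fun ε => ∫ x, u x * (eb D ε x * Ps b θ x)) (𝓝[>] 0) (𝓝 (∫ x, u x * gE D b θ x)) := by
    refine tendsto_integral_filter_of_dominated_convergence (fun x => |u x|) 
      (Eventually.of_forall fun ε => (i2 ε).aestronglyMeasurable) (Eventually.of_forall fun ε => 
        Eventually.of_forall fun x => ?_) (h.cont.integrable_of_hasCompactSupport huc).abs
      (Eventually.of_forall fun x => (eb_tendsto D b θ x).const_mul _)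
    rw [norm_mul]
    exact mul_le_of_le_one_right (norm_nonneg _) (psi2_abs D b θ ε x)
  have z : ∫ x, u x * gE D b θ x = 0 := by
    rw [← integral_zero (En n) ℝ (μ := volume)]
    congr 1; funext x
    unfold gE
    split_ifs with hx
    · rw [h.zero x hx, zero_mul]
    · rw [mul_zero]
  have l3 := h.frac_tendsto b θ (by
    filter_upwards [self_mem_nhdsWithin] with ε hε using (key ε hε).1.aestronglyMeasurable)
  have l4 := ((h.lap_tendsto hl b θ).neg.add (l3.const_mul a)).sub (l2.const_mul lam)
  rw [z, neg_zero, mul_zero, sub_zero, zero_add] at l4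
  refine tendsto_nhds_unique (tendsto_const_nhds.congr' ?_) l4
  filter_upwards [self_mem_nhdsWithin] with ε hε using (key ε hε).2

def FK {n : ℕ} (D : Dom n) (s : ℝ) (u : En n → ℝ) (x z : En n) : ℝ :=
  if D.τ z ≤ 0 then u x / ‖z - x‖ ^ ((n : ℝ) + 2 * s) else 0

def HH {n : ℕ} (D : Dom n) (s : ℝ) (u : En n → ℝ) (z : En n) : ℝ := -(cK n s) * ∫ x, FK D s u x z

lemma FK_meas {n : ℕ} {D : Dom n} {s : ℝ} {u : En n → ℝ} (hu : Continuous u) :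
    Measurable (Function.uncurry (FK D s u)) := by
  unfold FK Function.uncurry
  refine Measurable.ite (measurableSet_le (D.τ_cont.measurable.comp measurable_snd) measurable_const) ?_ measurable_const
  exact (hu.measurable.comp measurable_fst).div (((measurable_snd.sub measurable_fst).norm).pow_const _)

lemma HH_zero {n : ℕ} {D : Dom n} {s : ℝ} {u : En n → ℝ} {z : En n} (hz : 0 < D.τ z) : HH D s u z = 0 := by
  unfold HH FK
  simp [not_le.2 hz]

lemma FK_bound {n : ℕ} (D : Dom n) {s : ℝ} (hs : s ∈ Ioo (0:ℝ) 1) (u : En n → ℝ) {x : En n} (hx : 0 < D.τ x) (z : En n) :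
    |FK D s u x z| ≤ |u x| * ((2 * D.K) ^ (1 + s) * D.τ x ^ (-(1 + s))) * kr n s (z - x) := by
  have hK := D.hK
  have hp : 0 ≤ ‖z - x‖ ^ ((n : ℝ) + 2 * s) := by positivity
  have hk := kr_nonneg n s (z - x)
  unfold FK
  split_ifs with h
  · have h2 : D.τ x / (2 * D.K) < ‖z - x‖ := by
      by_contra hc
      push Not at hc
      linarith [D.inner_mem hx hc]
    have := one_le_kap hs (ρ := D.τ x / (2 * D.K)) (by positivity) 
      (by rw [div_le_one (by positivity)]; linarith [D.le_one x]) h2.le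
    rw [Real.div_rpow hx.le (by positivity), Real.rpow_neg (x := 2 * D.K) (by positivity), div_inv_eq_mul] at this
    rw [abs_div, abs_of_nonneg hp, kr, mul_assoc, mul_div_assoc', div_eq_mul_inv, div_eq_mul_inv, ]
    refine mul_le_mul_of_nonneg_left ?_ (abs_nonneg _)
    refine le_mul_of_one_le_left (inv_nonneg.2 hp) ?_
    linarith
  · rw [abs_zero]; positivity

lemma Sol.FK_int {n : ℕ} {D : Dom n} {s a lam : ℝ} {u : En n → ℝ} (h : Sol D s a lam u) :
    (∀ x, Integrable (FK D s u x)) ∧ Integrable (Function.uncurry (FK D s u)) (volume.prod volume) := by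
  have hK := D.hK
  have hm := FK_meas (D := D) (s := s) h.cont
  have hkr : ∀ x : En n, Integrable (fun z => kr n s (z - x)) := fun x => (kr_integrable n h.hn s h.hs).comp_sub_right x
  obtain ⟨A, hA, hAb⟩ := h.abs_le_tau
  have hz : ∀ x, D.τ x ≤ 0 → ∀ z, FK D s u x z = 0 := fun x hx z => by unfold FK; rw [h.zero x hx]; simp
  have h1 : ∀ x, Integrable (FK D s u x) := fun x => by
    by_cases hx : 0 < D.τ x
    · exact ((hkr x).const_mul _).mono' (hm.comp (measurable_const.prodMk measurable_id)).aestronglyMeasurable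
        (Eventually.of_forall fun z => FK_bound D h.hs u hx z)
    · have : FK D s u x = fun _ => 0 := funext (hz x (by linarith))
      rw [this]; exact integrable_zero _ _ _
  refine ⟨h1, ?_⟩
  rw [integrable_prod_iff hm.aestronglyMeasurable]
  refine ⟨Eventually.of_forall h1, ?_⟩
  have hΩ : MeasurableSet D.Ω := measurableSet_lt measurable_const D.τ_cont.measurable
  have hI : 0 ≤ ∫ z, kr n s z := integral_nonneg fun z => kr_nonneg n s z
  refine ((integrable_indicator_iff hΩ).2 ((D.int_neg h.hs).const_mul (A * (2 * D.K) ^ (1 + s) * ∫ z, kr n s z))).mono'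
    (hm.norm.stronglyMeasurable.integral_prod_right).aestronglyMeasurable (Eventually.of_forall fun x => ?_)
  rw [Real.norm_of_nonneg (integral_nonneg fun z => norm_nonneg _)]
  by_cases hx : 0 < D.τ x
  · rw [indicator_of_mem (show x ∈ D.Ω from hx)]
    refine (integral_mono (h1 x).norm ((hkr x).const_mul _) (fun z => FK_bound D h.hs u hx z)).trans ?_
    rw [integral_const_mul, integral_sub_right_eq_self (μ := (volume : Measure (En n))) (kr n s) x]
    have : D.τ x ^ (-s) = D.τ x * D.τ x ^ (-(1 + s)) := by
      conv_rhs => enter [1]; rw [← Real.rpow_one (D.τ x)]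
      rw [← Real.rpow_add hx]; congr 1; ring
    rw [this]
    have q2 := hAb x
    rw [max_eq_left hx.le] at q2
    have q3 := mul_le_mul_of_nonneg_right q2 (show 0 ≤ (2 * D.K) ^ (1 + s) * D.τ x ^ (-(1 + s)) * ∫ z, kr n s z by positivity)
    nlinarith
  · have : ∀ z, ‖Function.uncurry (FK D s u) (x, z)‖ = 0 := fun z => by
      rw [norm_eq_zero]; exact hz x (by linarith) z
    simp_rw [this, integral_zero]
    exact indicator_nonneg (fun x hx => by 
        have : 0 < D.τ x := hx
        positivity) _

lemma Sol.HH_int {n : ℕ} {D : Dom n} {s a lam : ℝ} {u : En n → ℝ} (h : Sol D s a lam u) : Integrable (HH D s u) :=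
  h.FK_int.2.integral_prod_right.const_mul _

lemma Sol.frac_gE {n : ℕ} {D : Dom n} {s a lam : ℝ} {u : En n → ℝ} (h : Sol D s a lam u) (b : En n) (θ : ℝ) :
    ∫ x, u x * fracLap n s (gE D b θ) x = ∫ z, HH D s u z * Ps b θ z := by
  obtain ⟨h1, h2⟩ := h.FK_int
  have hPm : Measurable (Ps b θ) := (Ps_cont b θ).measurable
  have e1 : ∀ x, u x * fracLap n s (gE D b θ) x = -(cK n s) * ∫ z, FK D s u x z * Ps b θ z := fun x => by
    by_cases hx : 0 < D.τ x
    · have hu : ∀ z, FK D s u x z * Ps b θ z = u x * (gE D b θ z / ‖z - x‖ ^ ((n : ℝ) + 2 * s)) := fun z => by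
        unfold FK gE; split_ifs <;> ring
      rw [fracLap_eq]
      have i1 : Integrable (fun y => u x * (gE D b θ (x + y) / ‖y‖ ^ ((n : ℝ) + 2 * s))) := by
        have := ((h1 x).mul_bdd (c := 1) hPm.aestronglyMeasurable (Eventually.of_forall fun z => Ps_le b θ z)).comp_add_left x
        refine this.congr (Eventually.of_forall fun y => ?_)
        show FK D s u x (x + y) * Ps b θ (x + y) = _
        rw [hu, add_sub_cancel_left]
      have i2 : Integrable (fun y => u x * (gE D b θ (x - y) / ‖y‖ ^ ((n : ℝ) + 2 * s))) := by
        refine i1.comp_neg.congr (Eventually.of_forall fun y => ?_)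
        simp only [norm_neg, sub_eq_add_neg]
      have k1 : ∫ y, u x * (gE D b θ (x + y) / ‖y‖ ^ ((n : ℝ) + 2 * s)) = ∫ z, FK D s u x z * Ps b θ z := by
        rw [← integral_add_left_eq_self (μ := (volume : Measure (En n))) (fun z => FK D s u x z * Ps b θ z) x]
        congr 1; funext y
        rw [hu, add_sub_cancel_left]
      have k2 : ∫ y, u x * (gE D b θ (x - y) / ‖y‖ ^ ((n : ℝ) + 2 * s)) = ∫ z, FK D s u x z * Ps b θ z := by
        rw [← k1, ← integral_neg_eq_self]
        congr 1; funext y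
        simp only [norm_neg, sub_eq_add_neg, neg_neg]
      have k3 : u x * ∫ y, sdf (gE D b θ) x y / ‖y‖ ^ ((n : ℝ) + 2 * s) = 2 * ∫ z, FK D s u x z * Ps b θ z := by
        rw [← integral_const_mul]
        refine Eq.trans ?_ (show (∫ y, u x * (gE D b θ (x + y) / ‖y‖ ^ ((n : ℝ) + 2 * s))) + 
          (∫ y, u x * (gE D b θ (x - y) / ‖y‖ ^ ((n : ℝ) + 2 * s))) = _ by rw [k1, k2]; ring)
        refine Eq.trans ?_ (integral_add i1 i2)
        congr 1; funext y
        have : gE D b θ x = 0 := by unfold gE; simp [not_le.2 hx]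
        unfold sdf; rw [this]; ring
      calc _ = -(cK n s / 2) * (u x * ∫ y, sdf (gE D b θ) x y / ‖y‖ ^ ((n : ℝ) + 2 * s)) := by ring
        _ = _ := by rw [k3]; ring
    · have : u x = 0 := h.zero x (by linarith)
      have hz : ∀ z, FK D s u x z = 0 := fun z => by unfold FK; rw [this]; simp
      simp [this, hz]
  simp_rw [e1, integral_const_mul]
  have i3 : Integrable (Function.uncurry fun x z => FK D s u x z * Ps b θ z) (volume.prod volume) :=
    h2.mul_bdd (c := 1) (hPm.comp measurable_snd).aestronglyMeasurable (Eventually.of_forall fun p => Ps_le b θ p.2)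
  rw [integral_integral_swap i3, ← integral_const_mul]
  congr 1; funext z
  rw [integral_mul_const, HH]; ring

lemma Sol.TI2 {n : ℕ} {D : Dom n} {s a lam : ℝ} {u : En n → ℝ} (h : Sol D s a lam u) 
    (hl : ∀ ε : ℝ, 0 < ε → ∃ r : ℝ, 0 < r ∧ ∀ x, 0 < D.τ x → D.τ x < r → |u x| ≤ ε * D.τ x) (b : En n) (θ : ℝ) :
    (‖b‖ ^ 2 + a * mb n s b - lam) * ∫ x, u x * Ps b θ x = ∫ z, (a * HH D s u z) * Ps b θ z := by
  rw [h.TI hl, h.frac_gE, ← integral_const_mul]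
  congr 1; funext z; ring

def TF {n : ℕ} (θ : ℝ) (f : En n → ℝ) (w : En n) : ℝ := ∫ x, f x * Ps ((2 * π) • w) θ x

section
variable {n : ℕ}

lemma Ps_w_cont (θ : ℝ) : Continuous (fun p : En n × En n => Ps ((2 * π) • p.1) θ p.2) := by
  unfold Ps
  fun_prop

lemma TF_int {θ : ℝ} {f : En n → ℝ} (hf : Integrable f) (b : En n) : Integrable (fun x => f x * Ps b θ x) :=
  hf.mul_bdd (c := 1) (Ps_cont b θ).aestronglyMeasurable (Eventually.of_forall fun z => Ps_le b θ z)

lemma TF_cont {θ : ℝ} {f : En n → ℝ} (hf : Integrable f) : Continuous (TF θ f) := by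
  unfold TF
  refine continuous_of_dominated (bound := fun x => |f x|) (fun w => (TF_int hf _).aestronglyMeasurable)
    (fun w => Eventually.of_forall fun x => ?_) hf.abs (Eventually.of_forall fun x => ?_)
  · rw [norm_mul]; exact mul_le_of_le_one_right (norm_nonneg _) (Ps_le _ _ _)
  · have : Continuous fun w : En n => Ps ((2 * π) • w) θ x := by unfold Ps; fun_prop
    exact continuous_const.mul this

lemma TF_le {θ : ℝ} {f : En n → ℝ} (hf : Integrable f) (w : En n) : |TF θ f w| ≤ ∫ x, |f x| := by
  unfold TF
  refine (norm_integral_le_integral_norm _).trans (integral_mono (TF_int hf _).norm hf.abs fun x => ?_)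
  rw [norm_mul]; exact mul_le_of_le_one_right (norm_nonneg _) (Ps_le _ _ _)

def gs (c : ℝ) (w : En n) : ℝ := Real.exp (-c⁻¹ * ‖w‖ ^ 2)

lemma gs_int {c : ℝ} (hc : 0 < c) : Integrable (gs (n := n) c) := by
  have := (GaussianFourier.integrable_cexp_neg_mul_sq_norm_add (V := En n) (b := ((c⁻¹ : ℝ) : ℂ)) (by simpa) 0 0).re
  refine this.congr (Eventually.of_forall fun w => ?_)
  simp only [gs]
  have : (-((c⁻¹ : ℝ) : ℂ) * (‖w‖ : ℂ) ^ 2 + 0 * ((⟪(0 : En n), w⟫ : ℝ) : ℂ)) = ((-c⁻¹ * ‖w‖ ^ 2 : ℝ) : ℂ) := by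
    push_cast; ring
  rw [this]
  exact Complex.exp_ofReal_re _

lemma gs_nonneg (c : ℝ) (w : En n) : 0 ≤ gs c w := (Real.exp_pos _).le

lemma gs_le {c : ℝ} (hc : 0 < c) (w : En n) : gs c w ≤ 1 := by
  unfold gs; rw [Real.exp_le_one_iff]
  have : 0 < c⁻¹ := by positivity
  nlinarith [mul_nonneg this.le (sq_nonneg ‖w‖)]

lemma gs_cont (c : ℝ) : Continuous (gs (n := n) c) := by unfold gs; fun_prop

def GG (c : ℝ) (z : En n) : ℝ := (π * c) ^ ((n : ℝ) / 2) * Real.exp (-π ^ 2 * c * ‖z‖ ^ 2)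

lemma GG_eq {c : ℝ} (hc : 0 < c) (z : En n) : ∫ w, gs c w * Real.cos (2 * π * ⟪w, z⟫) = GG c z := by
  have h := fourier_gaussian_innerProductSpace' (V := En n) (b := ((c⁻¹ : ℝ) : ℂ)) (by simpa) 0 z
  rw [Real.fourier_eq'] at h
  have hi : Integrable (fun v : En n => Complex.exp (((-2 * π * ⟪v, z⟫ : ℝ) : ℂ) * Complex.I) • 
      Complex.exp (-((c⁻¹ : ℝ) : ℂ) * (‖v‖ : ℂ) ^ 2 + 2 * π * Complex.I * ((⟪(0 : En n), v⟫ : ℝ) : ℂ))) := by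
    have := GaussianFourier.integrable_cexp_neg_mul_sq_norm_add (V := En n) (b := ((c⁻¹ : ℝ) : ℂ)) (by simpa) (-2 * π * Complex.I) z
    refine this.congr (Eventually.of_forall fun w => ?_)
    simp only [smul_eq_mul, ← Complex.exp_add]
    congr 1
    rw [real_inner_comm]
    simp
    ring
  have h2 := congrArg Complex.re h
  rw [show (∫ v : En n, Complex.exp (((-2 * π * ⟪v, z⟫ : ℝ) : ℂ) * Complex.I) • 
      Complex.exp (-((c⁻¹ : ℝ) : ℂ) * (‖v‖ : ℂ) ^ 2 + 2 * π * Complex.I * ((⟪(0 : En n), v⟫ : ℝ) : ℂ))).re = 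
      ∫ v : En n, (Complex.exp (((-2 * π * ⟪v, z⟫ : ℝ) : ℂ) * Complex.I) • 
      Complex.exp (-((c⁻¹ : ℝ) : ℂ) * (‖v‖ : ℂ) ^ 2 + 2 * π * Complex.I * ((⟪(0 : En n), v⟫ : ℝ) : ℂ))).re from
      (integral_re hi).symm] at h2
  have e1 : ∀ v : En n, (Complex.exp (((-2 * π * ⟪v, z⟫ : ℝ) : ℂ) * Complex.I) • 
      Complex.exp (-((c⁻¹ : ℝ) : ℂ) * (‖v‖ : ℂ) ^ 2 + 2 * π * Complex.I * ((⟪(0 : En n), v⟫ : ℝ) : ℂ))).re = 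
      gs c v * Real.cos (2 * π * ⟪v, z⟫) := fun v => by
    have : (-((c⁻¹ : ℝ) : ℂ) * (‖v‖ : ℂ) ^ 2 + 2 * π * Complex.I * ((⟪(0 : En n), v⟫ : ℝ) : ℂ)) = ((-c⁻¹ * ‖v‖ ^ 2 : ℝ) : ℂ) := by
      simp
    rw [this, ← Complex.ofReal_exp, smul_eq_mul, mul_comm, Complex.re_ofReal_mul, Complex.exp_ofReal_mul_I_re]
    unfold gs
    rw [show -2 * π * ⟪v, z⟫ = -(2 * π * ⟪v, z⟫) by ring, Real.cos_neg]
  simp_rw [e1] at h2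
  rw [h2, finrank_euclideanSpace_fin]
  have e2 : ((π : ℂ) / ((c⁻¹ : ℝ) : ℂ)) = ((π * c : ℝ) : ℂ) := by push_cast; field_simp
  have e3 : (-(π : ℂ) ^ 2 * (‖(0 : En n) - z‖ : ℂ) ^ 2 / ((c⁻¹ : ℝ) : ℂ)) = ((-π ^ 2 * c * ‖z‖ ^ 2 : ℝ) : ℂ) := by
    push_cast; rw [zero_sub, norm_neg]; field_simp
  rw [e2, e3, show ((n : ℂ) / 2) = (((n : ℝ) / 2 : ℝ) : ℂ) by push_cast; ring,
    ← Complex.ofReal_cpow (by positivity), ← Complex.ofReal_exp, ← Complex.ofReal_mul, Complex.ofReal_re]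
  rfl

lemma GG_cont (c : ℝ) : Continuous (GG (n := n) c) := by unfold GG; fun_prop
lemma GG_nonneg {c : ℝ} (hc : 0 < c) (z : En n) : 0 ≤ GG c z := by unfold GG; positivity

lemma GG_integral {c : ℝ} (hc : 0 < c) : Integrable (GG (n := n) c) ∧ ∫ z : En n, GG c z = 1 := by
  have e : ∀ z : En n, GG c z = (π * c) ^ ((n : ℝ) / 2) * gs ((π ^ 2 * c)⁻¹) z := fun z => by
    unfold GG gs; rw [inv_inv, neg_mul]
  constructor
  · rw [show GG (n := n) c = _ from funext e]
    exact (gs_int (by positivity)).const_mul _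
  · simp_rw [e]
    rw [integral_const_mul]
    unfold gs
    rw [GaussianFourier.integral_rexp_neg_mul_sq_norm (by positivity), finrank_euclideanSpace_fin, inv_inv,
      ← Real.mul_rpow (by positivity) (by positivity)]
    have : π * c * (π / (π ^ 2 * c)) = 1 := by field_simp
    rw [this, Real.one_rpow]

lemma GG_tendsto {v : En n → ℝ} (hv : Integrable v) (hc : Continuous v) (x : En n) :
    Tendsto (fun c => ∫ y, v y * GG c (x - y)) atTop (𝓝 (v x)) := by
  have h := Real.tendsto_integral_gaussian_smul' (V := En n) (f := fun y => (v y : ℂ)) hv.ofReal (v := x)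
    (Complex.continuous_ofReal.comp hc).continuousAt
  have h2 := (Complex.continuous_re.tendsto _).comp h
  rw [Complex.ofReal_re] at h2
  refine h2.congr' ?_
  filter_upwards [Ioi_mem_atTop 0] with c hc0
  have hc0 : 0 < c := hc0
  simp only [Function.comp]
  have : ∀ y, (((π : ℂ) * c) ^ ((Module.finrank ℝ (En n) : ℂ) / 2) * Complex.exp (-(π : ℂ) ^ 2 * c * (‖x - y‖ : ℂ) ^ 2)) • (v y : ℂ) =
      ((v y * GG c (x - y) : ℝ) : ℂ) := fun y => by
    unfold GG
    rw [finrank_euclideanSpace_fin, smul_eq_mul, mul_comm]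
    push_cast
    rw [Complex.ofReal_cpow (by positivity)]
    push_cast
    rfl
  simp_rw [this]
  rw [integral_complex_ofReal, Complex.ofReal_re]

lemma Ps_sum (b x y : En n) : Ps b 0 x * Ps b 0 y + Ps b (-(π / 2)) x * Ps b (-(π / 2)) y = Real.cos (⟪b, x - y⟫) := by
  unfold Ps
  rw [← sub_eq_add_neg, ← sub_eq_add_neg, Real.cos_sub_pi_div_two, Real.cos_sub_pi_div_two, add_zero, add_zero, 
    inner_sub_right, Real.cos_sub]

/-- The regularised pairing. -/
def XX (f v : En n → ℝ) (w : En n) : ℝ :=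
  TF 0 f w * TF 0 v w + TF (-(π / 2)) f w * TF (-(π / 2)) v w

lemma XX_eq1 {v : En n → ℝ} (hv : Integrable v) (w x : En n) :
    Ps ((2 * π) • w) 0 x * TF 0 v w + Ps ((2 * π) • w) (-(π / 2)) x * TF (-(π / 2)) v w =
      ∫ y, v y * Real.cos (2 * π * ⟪w, x - y⟫) := by
  unfold TF
  rw [← integral_const_mul, ← integral_const_mul]
  refine (integral_add ((TF_int hv _).const_mul _) ((TF_int hv _).const_mul _)).symm.trans ?_
  congr 1; funext y
  have := Ps_sum ((2 * π) • w) x y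
  rw [inner_smul_left] at this
  simp only [conj_trivial] at this
  rw [← this]; ring

lemma XX_eq2 {v : En n → ℝ} (hv : Integrable v) {c : ℝ} (hc : 0 < c) (x : En n) :
    ∫ w, gs c w * (Ps ((2 * π) • w) 0 x * TF 0 v w + Ps ((2 * π) • w) (-(π / 2)) x * TF (-(π / 2)) v w) =
      ∫ y, v y * GG c (x - y) := by
  have e : ∀ w, gs c w * (Ps ((2 * π) • w) 0 x * TF 0 v w + Ps ((2 * π) • w) (-(π / 2)) x * TF (-(π / 2)) v w) =
      ∫ y, (gs c w * v y) * Real.cos (2 * π * ⟪w, x - y⟫) := fun w => by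
    rw [XX_eq1 hv, ← integral_const_mul]; congr 1; funext y; ring
  simp_rw [e]
  rw [integral_integral_swap]
  · congr 1; funext y
    rw [← GG_eq hc, ← integral_const_mul]; congr 1; funext w; ring
  · refine ((gs_int hc).mul_prod hv).mul_bdd (c := 1) ?_ (Eventually.of_forall fun p => Real.abs_cos_le_one _)
    have : Continuous fun p : En n × En n => Real.cos (2 * π * ⟪p.1, x - p.2⟫) := by fun_prop
    exact this.aestronglyMeasurable

lemma XX_eq3 {f v : En n → ℝ} (hf : Integrable f) (hv : Integrable v) {c : ℝ} (hc : 0 < c) :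
    ∫ w, XX f v w * gs c w = ∫ x, f x * ∫ y, v y * GG c (x - y) := by
  have e : ∀ w, XX f v w * gs c w = ∫ x, (gs c w * f x) * 
      (Ps ((2 * π) • w) 0 x * TF 0 v w + Ps ((2 * π) • w) (-(π / 2)) x * TF (-(π / 2)) v w) := fun w => by
    unfold XX
    have q : XX f v w * gs c w = (gs c w * TF 0 v w) * TF 0 f w + (gs c w * TF (-(π / 2)) v w) * TF (-(π / 2)) f w := by
      unfold XX; ring
    unfold XX at q
    rw [q]
    nth_rewrite 2 [TF]
    nth_rewrite 3 [TF]
    rw [← integral_const_mul, ← integral_const_mul]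
    refine (integral_add ((TF_int hf _).const_mul _) ((TF_int hf _).const_mul _)).symm.trans ?_
    congr 1; funext x; ring
  simp_rw [e]
  rw [integral_integral_swap]
  · congr 1; funext x
    rw [← XX_eq2 hv hc, ← integral_const_mul]; congr 1; funext w; ring
  · refine ((gs_int hc).mul_prod hf).mul_bdd (c := (∫ x, |v x|) + ∫ x, |v x|) ?_ (Eventually.of_forall fun p => ?_)
    · have h0 := TF_cont (θ := 0) hv
      have h1 := TF_cont (θ := -(π / 2)) hv
      have h2 := Ps_w_cont (n := n) 0
      have h3 := Ps_w_cont (n := n) (-(π / 2))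
      exact ((h2.mul (h0.comp continuous_fst)).add (h3.mul (h1.comp continuous_fst))).aestronglyMeasurable
    · refine (norm_add_le _ _).trans (add_le_add ?_ ?_) <;>
      · rw [norm_mul]
        refine (mul_le_of_le_one_left (norm_nonneg _) (Ps_le _ _ _)).trans (TF_le hv _)

lemma lemG {f v : En n → ℝ} (hf : Integrable f) (hv : Integrable v) (hvc : Continuous v) {B : ℝ} (hB : ∀ x, |v x| ≤ B) :
    Tendsto (fun c => ∫ w, XX f v w * gs c w) atTop (𝓝 (∫ x, f x * v x)) := by
  have : Tendsto (fun c => ∫ x, f x * ∫ y, v y * GG c (x - y)) atTop (𝓝 (∫ x, f x * v x)) := by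
    refine tendsto_integral_filter_of_dominated_convergence (fun x => |f x| * B) ?_ ?_ (hf.abs.mul_const B)
      (Eventually.of_forall fun x => (GG_tendsto hv hvc x).const_mul _)
    · refine Eventually.of_forall fun c => hf.aestronglyMeasurable.mul ?_
      have : Continuous fun p : En n × En n => v p.2 * GG c (p.1 - p.2) :=
        (hvc.comp continuous_snd).mul ((GG_cont c).comp (continuous_fst.sub continuous_snd))
      exact this.stronglyMeasurable.integral_prod_right.aestronglyMeasurable
    · filter_upwards [Ioi_mem_atTop 0] with c hc
      have hc : 0 < c := hc
      refine Eventually.of_forall fun x => ?_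
      rw [norm_mul]
      refine mul_le_mul_of_nonneg_left ?_ (norm_nonneg _)
      obtain ⟨i, e⟩ := GG_integral (n := n) hc
      have i2 : Integrable fun y => GG c (x - y) := i.comp_sub_left x
      have e2 : ∫ y, GG c (x - y) = 1 := by rw [integral_sub_left_eq_self (GG c) volume x, e]
      refine (norm_integral_le_of_norm_le (i2.const_mul B) (Eventually.of_forall fun y => ?_)).trans ?_
      · rw [norm_mul, Real.norm_of_nonneg (GG_nonneg hc _)]
        exact mul_le_mul_of_nonneg_right (hB y) (GG_nonneg hc _)
      · rw [integral_const_mul, e2, mul_one]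
  refine this.congr' ?_
  filter_upwards [Ioi_mem_atTop 0] with c hc
  exact (XX_eq3 hf hv hc).symm

lemma fatou_real {F : ℕ → En n → ℝ} {f : En n → ℝ} (h0 : ∀ k x, 0 ≤ F k x) (hi : ∀ k, Integrable (F k))
    (ht : ∀ x, Tendsto (fun k => F k x) atTop (𝓝 (f x))) {L : ℝ}
    (hL : Tendsto (fun k => ∫ x, F k x) atTop (𝓝 L)) : Integrable f ∧ ∫ x, f x ≤ L := by
  have hf0 : ∀ x, 0 ≤ f x := fun x => ge_of_tendsto' (ht x) fun k => h0 k x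
  have hm : AEStronglyMeasurable f volume := 
    aestronglyMeasurable_of_tendsto_ae atTop (fun k => (hi k).aestronglyMeasurable) (Eventually.of_forall ht)
  have hL0 : 0 ≤ L := ge_of_tendsto' hL fun k => integral_nonneg (h0 k)
  have key : ∫⁻ x, ENNReal.ofReal (f x) ≤ ENNReal.ofReal L := by
    have e1 : ∀ x, ENNReal.ofReal (f x) = liminf (fun k => ENNReal.ofReal (F k x)) atTop := fun x =>
      ((ENNReal.continuous_ofReal.tendsto _).comp (ht x)).liminf_eq.symm
    have e2 : liminf (fun k => ∫⁻ x, ENNReal.ofReal (F k x)) atTop = ENNReal.ofReal L := by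
      refine Tendsto.liminf_eq ?_
      refine ((ENNReal.continuous_ofReal.tendsto _).comp hL).congr fun k => ?_
      exact ofReal_integral_eq_lintegral_ofReal (hi k) (Eventually.of_forall (h0 k))
    simp_rw [e1]
    rw [← e2]
    exact lintegral_liminf_le' fun k => (hi k).aestronglyMeasurable.aemeasurable.ennreal_ofReal
  have hif : Integrable f := by
    refine ⟨hm, ?_⟩
    rw [hasFiniteIntegral_iff_ofReal (Eventually.of_forall hf0)]
    exact key.trans_lt ENNReal.ofReal_lt_top
  refine ⟨hif, ?_⟩
  rw [← ofReal_integral_eq_lintegral_ofReal hif (Eventually.of_forall hf0)] at key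
  exact (ENNReal.ofReal_le_ofReal_iff hL0).1 key

end

section
variable {n : ℕ}

def YY (A B : En n → ℝ) (μ : ℝ) (w : En n) : ℝ := A (μ • w) * A w + B (μ • w) * B w

lemma scal_int {E g : En n → ℝ} {p μ : ℝ} (hg : ∀ μ : ℝ, 0 < μ → ∀ w, g (μ • w) = μ ^ p * g w)
    (hi : Integrable fun w => g w * E w) (hμ : 0 < μ) :
    Integrable (fun w => g w * E (μ • w)) ∧ 
    ∫ w, g w * E (μ • w) = (μ ^ p)⁻¹ * ((μ ^ n)⁻¹ * ∫ w, g w * E w) := by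
  have hp : μ ^ p ≠ 0 := by positivity
  have e : ∀ w, g w * E (μ • w) = (μ ^ p)⁻¹ * (g (μ • w) * E (μ • w)) := fun w => by
    rw [hg μ hμ]; field_simp
  simp_rw [e]
  refine ⟨(hi.comp_smul hμ.ne').const_mul _, ?_⟩
  rw [integral_const_mul, Measure.integral_comp_smul (volume : Measure (En n)) (fun w => g w * E w) μ,
    finrank_euclideanSpace_fin, abs_of_pos (by positivity), smul_eq_mul]

lemma YY_int {A B : En n → ℝ} (hA : Continuous A) (hB : Continuous B) {g : En n → ℝ} {p μ : ℝ} 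
    (hgm : Measurable g) (hg0 : ∀ w, 0 ≤ g w) (hg : ∀ μ : ℝ, 0 < μ → ∀ w, g (μ • w) = μ ^ p * g w)
    (hi : Integrable fun w => g w * (A w ^ 2 + B w ^ 2)) (hμ : 0 < μ) :
    Integrable (fun w => g w * YY A B μ w) := by
  have h2 := (scal_int (E := fun w => A w ^ 2 + B w ^ 2) hg hi hμ).1
  refine (hi.add h2).mono' ?_ (Eventually.of_forall fun w => ?_)
  · have : Continuous (YY A B μ) := by unfold YY; fun_prop
    exact (hgm.mul this.measurable).aestronglyMeasurable
  · rw [norm_mul, Real.norm_of_nonneg (hg0 w), Pi.add_apply, ← mul_add]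
    refine mul_le_mul_of_nonneg_left ?_ (hg0 w)
    rw [Real.norm_eq_abs, abs_le]
    unfold YY
    constructor <;>
    nlinarith [sq_nonneg (A (μ • w) + A w), sq_nonneg (A (μ • w) - A w), sq_nonneg (B (μ • w) + B w), sq_nonneg (B (μ • w) - B w),
      sq_nonneg (A w), sq_nonneg (B w), sq_nonneg (A (μ • w)), sq_nonneg (B (μ • w))]

lemma tendsto_d (p : ℝ) : Tendsto (fun μ : ℝ => (μ ^ p - 1) / (μ - 1)) (𝓝[>] 1) (𝓝 p) := by
  have h := Real.hasDerivAt_rpow_const (x := 1) (p := p) (Or.inl one_ne_zero)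
  rw [hasDerivAt_iff_tendsto_slope] at h
  have h2 := h.mono_left (nhdsWithin_mono 1 (show Ioi (1:ℝ) ⊆ {1}ᶜ from fun x hx => ne_of_gt hx))
  simp only [Real.one_rpow, mul_one] at h2
  refine h2.congr fun μ => ?_
  rw [slope_def_field, Real.one_rpow]

set_option maxHeartbeats 1000000 in
lemma spectral {A B : En n → ℝ} (hA : Continuous A) (hB : Continuous B) {N m : En n → ℝ} {s lam : ℝ}
    (hs : s ∈ Ioo (0:ℝ) 1)
    (hNm : Measurable N) (hN0 : ∀ w, 0 ≤ N w) (hN : ∀ μ : ℝ, 0 < μ → ∀ w, N (μ • w) = μ ^ (2:ℝ) * N w)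
    (hmm : Measurable m) (hm0 : ∀ w, 0 ≤ m w) (hm : ∀ μ : ℝ, 0 < μ → ∀ w, m (μ • w) = μ ^ (2 * s) * m w)
    (hE : Integrable fun w => A w ^ 2 + B w ^ 2)
    (hNE : Integrable fun w => N w * (A w ^ 2 + B w ^ 2)) (hmE : Integrable fun w => m w * (A w ^ 2 + B w ^ 2))
    {Q : ℝ → ℝ} (hQ : ∀ μ : ℝ, 0 < μ → ∫ w, (N w + m w - lam) * YY A B μ⁻¹ w = Q μ)
    (hQ0 : Tendsto (fun μ => Q μ / (μ - 1)) (𝓝[≠] 1) (𝓝 0)) : ∫ w, N w * (A w ^ 2 + B w ^ 2) ≤ 0 := by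
  set e2 := ∫ w, N w * (A w ^ 2 + B w ^ 2) with he2
  set em := ∫ w, m w * (A w ^ 2 + B w ^ 2) with hem
  have hem0 : 0 ≤ em := integral_nonneg fun w => mul_nonneg (hm0 w) (by positivity)
  have iN := fun μ hμ => YY_int (μ := μ) hA hB hNm hN0 hN hNE hμ
  have im := fun μ hμ => YY_int (μ := μ) hA hB hmm hm0 hm hmE hμ
  have i1 : ∀ μ : ℝ, 0 < μ → Integrable (YY A B μ) := fun μ hμ => by
    have := YY_int (μ := μ) (g := fun _ => 1) (p := 0) hA hB measurable_const (fun _ => zero_le_one) (by simp) (by simpa using hE) hμ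
    simpa using this
  have Qi : ∀ μ : ℝ, 0 < μ → Q μ⁻¹ = (∫ w, N w * YY A B μ w) + (∫ w, m w * YY A B μ w) - lam * ∫ w, YY A B μ w := fun μ hμ => by
    rw [← hQ _ (inv_pos.2 hμ), inv_inv, ← integral_const_mul]
    refine Eq.trans ?_ ((integral_sub ((iN μ hμ).add (im μ hμ)) ((i1 μ hμ).const_mul lam)).trans ?_)
    · congr 1; funext w; simp only [Pi.add_apply]; ring
    · congr 1; exact integral_add (iN μ hμ) (im μ hμ)
  have Qd : ∀ μ : ℝ, 0 < μ → (μ ^ n)⁻¹ * Q μ = μ ^ (2:ℝ) * (∫ w, N w * YY A B μ w) 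
      + μ ^ (2 * s) * (∫ w, m w * YY A B μ w) - lam * ∫ w, YY A B μ w := fun μ hμ => by
    have := Measure.integral_comp_smul (volume : Measure (En n)) (fun w => (N w + m w - lam) * YY A B μ⁻¹ w) μ
    rw [finrank_euclideanSpace_fin, abs_of_pos (by positivity), smul_eq_mul, hQ μ hμ] at this
    rw [← this, ← integral_const_mul, ← integral_const_mul, ← integral_const_mul]
    refine Eq.trans ?_ ((integral_sub (((iN μ hμ).const_mul (μ ^ (2:ℝ))).add ((im μ hμ).const_mul (μ ^ (2 * s)))) ((i1 μ hμ).const_mul lam)).trans ?_)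
    · congr 1; funext w; simp only [Pi.add_apply]
      rw [hN μ hμ, hm μ hμ]
      unfold YY
      rw [smul_smul, inv_mul_cancel₀ hμ.ne', one_smul]; ring
    · congr 1; exact integral_add ((iN μ hμ).const_mul (μ ^ (2:ℝ))) ((im μ hμ).const_mul (μ ^ (2 * s)))
  set d : ℝ → ℝ → ℝ := fun p μ => (μ ^ p - 1) / (μ - 1) with hd
  let F : ℝ → En n → ℝ := fun μ w => (d 2 μ * N w + d (2 * s) μ * m w) * ((A (μ • w) + A w) ^ 2 + (B (μ • w) + B w) ^ 2)
  have Feq : ∀ μ w, F μ w = d 2 μ * (N w * (A (μ • w) ^ 2 + B (μ • w) ^ 2) + N w * (A w ^ 2 + B w ^ 2) + 2 * (N w * YY A B μ w))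
      + d (2 * s) μ * (m w * (A (μ • w) ^ 2 + B (μ • w) ^ 2) + m w * (A w ^ 2 + B w ^ 2) + 2 * (m w * YY A B μ w)) := fun μ w => by
    simp only [F]; unfold YY; ring
  have jN : ∀ μ : ℝ, 0 < μ → Integrable (fun w => N w * (A (μ • w) ^ 2 + B (μ • w) ^ 2) + N w * (A w ^ 2 + B w ^ 2) + 2 * (N w * YY A B μ w)) ∧
      ∫ w, N w * (A (μ • w) ^ 2 + B (μ • w) ^ 2) + N w * (A w ^ 2 + B w ^ 2) + 2 * (N w * YY A B μ w) = 
        (μ ^ (2:ℝ))⁻¹ * ((μ ^ n)⁻¹ * e2) + e2 + 2 * ∫ w, N w * YY A B μ w := fun μ hμ => by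
    obtain ⟨k1, k2⟩ := scal_int (E := fun w => A w ^ 2 + B w ^ 2) hN hNE hμ
    refine ⟨(k1.add hNE).add ((iN μ hμ).const_mul 2), ?_⟩
    refine (integral_add (k1.add hNE) ((iN μ hμ).const_mul 2)).trans ?_
    rw [integral_const_mul, he2, ← k2]
    congr 1
    exact integral_add k1 hNE
  have jm : ∀ μ : ℝ, 0 < μ → Integrable (fun w => m w * (A (μ • w) ^ 2 + B (μ • w) ^ 2) + m w * (A w ^ 2 + B w ^ 2) + 2 * (m w * YY A B μ w)) ∧
      ∫ w, m w * (A (μ • w) ^ 2 + B (μ • w) ^ 2) + m w * (A w ^ 2 + B w ^ 2) + 2 * (m w * YY A B μ w) = 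
        (μ ^ (2 * s))⁻¹ * ((μ ^ n)⁻¹ * em) + em + 2 * ∫ w, m w * YY A B μ w := fun μ hμ => by
    obtain ⟨k1, k2⟩ := scal_int (E := fun w => A w ^ 2 + B w ^ 2) hm hmE hμ
    refine ⟨(k1.add hmE).add ((im μ hμ).const_mul 2), ?_⟩
    refine (integral_add (k1.add hmE) ((im μ hμ).const_mul 2)).trans ?_
    rw [integral_const_mul, hem, ← k2]
    congr 1
    exact integral_add k1 hmE
  have Fi : ∀ μ : ℝ, 0 < μ → Integrable (F μ) := fun μ hμ => by
    rw [show F μ = _ from funext (Feq μ)]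
    exact ((jN μ hμ).1.const_mul _).add ((jm μ hμ).1.const_mul _)
  have FI : ∀ μ : ℝ, 1 < μ → ∫ w, F μ w = d 2 μ * ((μ ^ (2:ℝ))⁻¹ * ((μ ^ n)⁻¹ * e2) + e2) + 
      d (2 * s) μ * ((μ ^ (2 * s))⁻¹ * ((μ ^ n)⁻¹ * em) + em) + 
      2 * ((μ ^ n)⁻¹ * (Q μ / (μ - 1)) + μ⁻¹ * (Q μ⁻¹ / (μ⁻¹ - 1))) := fun μ hμ => by
    have hμ0 : 0 < μ := by linarith
    simp_rw [Feq]
    refine (integral_add ((jN μ hμ0).1.const_mul _) ((jm μ hμ0).1.const_mul _)).trans ?_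
    rw [integral_const_mul, integral_const_mul, (jN μ hμ0).2, (jm μ hμ0).2]
    have q1 : (μ ^ n)⁻¹ * (Q μ / (μ - 1)) + μ⁻¹ * (Q μ⁻¹ / (μ⁻¹ - 1)) = 
        ((μ ^ n)⁻¹ * Q μ - Q μ⁻¹) / (μ - 1) := by
      have h1 : μ - 1 ≠ 0 := by linarith
      have h3 : μ⁻¹ - 1 = -(μ⁻¹ * (μ - 1)) := by field_simp; ring
      rw [h3]
      field_simp
      ring
    rw [q1, Qd μ hμ0, Qi μ hμ0]
    simp only [hd]
    ring
  have hQ1 : Tendsto (fun μ => Q μ / (μ - 1)) (𝓝[>] 1) (𝓝 0) :=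
    hQ0.mono_left (nhdsWithin_mono 1 (show Ioi (1:ℝ) ⊆ {1}ᶜ from fun x hx => ne_of_gt hx))
  have hinv : Tendsto (fun μ : ℝ => μ⁻¹) (𝓝[>] 1) (𝓝 1) := by
    have : ContinuousAt (fun μ : ℝ => μ⁻¹) 1 := continuousAt_inv₀ one_ne_zero
    have := this.tendsto
    rw [inv_one] at this
    exact this.mono_left nhdsWithin_le_nhds
  have hQ2 : Tendsto (fun μ => Q μ⁻¹ / (μ⁻¹ - 1)) (𝓝[>] 1) (𝓝 0) := by
    refine hQ0.comp (tendsto_nhdsWithin_iff.2 ⟨hinv, ?_⟩)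
    filter_upwards [self_mem_nhdsWithin] with μ hμ
    have hμ : 1 < μ := hμ
    intro hc
    have hc : μ⁻¹ = 1 := hc
    rw [inv_eq_one] at hc
    linarith
  have hpn : Tendsto (fun μ : ℝ => (μ ^ n)⁻¹) (𝓝[>] 1) (𝓝 1) := by
    have := hinv.pow n
    rw [one_pow] at this
    refine this.congr fun μ => by rw [inv_pow]
  have hpp : ∀ p : ℝ, Tendsto (fun μ : ℝ => (μ ^ p)⁻¹) (𝓝[>] 1) (𝓝 1) := fun p => by
    have : ContinuousAt (fun μ : ℝ => (μ ^ p)⁻¹) 1 := 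
      (Real.continuousAt_rpow_const 1 p (Or.inl one_ne_zero)).inv₀ (by simp)
    have := this.tendsto
    rw [Real.one_rpow, inv_one] at this
    exact this.mono_left nhdsWithin_le_nhds
  have hlim : Tendsto (fun μ => ∫ w, F μ w) (𝓝[>] 1) (𝓝 (2 * (1 * (1 * e2) + e2) + (2 * s) * (1 * (1 * em) + em) + 2 * (1 * 0 + 1 * 0))) := by
    refine Tendsto.congr' (f₁ := fun μ => d 2 μ * ((μ ^ (2:ℝ))⁻¹ * ((μ ^ n)⁻¹ * e2) + e2) + 
      d (2 * s) μ * ((μ ^ (2 * s))⁻¹ * ((μ ^ n)⁻¹ * em) + em) + 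
      2 * ((μ ^ n)⁻¹ * (Q μ / (μ - 1)) + μ⁻¹ * (Q μ⁻¹ / (μ⁻¹ - 1)))) ?_ ?_
    · filter_upwards [self_mem_nhdsWithin] with μ hμ using (FI μ hμ).symm
    · exact (((tendsto_d 2).mul (((hpp 2).mul (hpn.mul_const e2)).add_const e2)).add 
        ((tendsto_d (2 * s)).mul (((hpp (2 * s)).mul (hpn.mul_const em)).add_const em))).add
        (((hpn.mul hQ1).add (hinv.mul hQ2)).const_mul 2)
  have hsq : Tendsto (fun k : ℕ => 1 + 1 / ((k : ℝ) + 1)) atTop (𝓝[>] 1) := by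
    refine tendsto_nhdsWithin_iff.2 ⟨?_, Eventually.of_forall fun k => ?_⟩
    · have := (tendsto_one_div_add_atTop_nhds_zero_nat (𝕜 := ℝ)).const_add 1
      rwa [add_zero] at this
    · have : (0:ℝ) < 1 / ((k : ℝ) + 1) := by positivity
      show (1:ℝ) < _
      linarith
  have hs1 : ∀ k : ℕ, (1:ℝ) < 1 + 1 / ((k : ℝ) + 1) := fun k => by
    have : (0:ℝ) < 1 / ((k : ℝ) + 1) := by positivity
    linarith
  have hid : Tendsto (fun μ : ℝ => μ) (𝓝[>] 1) (𝓝 1) := tendsto_id.mono_left nhdsWithin_le_nhds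
  have hFt : ∀ w, Tendsto (fun μ => F μ w) (𝓝[>] 1) (𝓝 ((2 * N w + (2 * s) * m w) * ((A w + A w) ^ 2 + (B w + B w) ^ 2))) := fun w => by
    have hsm : Tendsto (fun μ : ℝ => μ • w) (𝓝[>] 1) (𝓝 w) := by
      have := hid.smul_const w
      rwa [one_smul] at this
    have hAw := (hA.tendsto w).comp hsm
    have hBw := (hB.tendsto w).comp hsm
    exact (((tendsto_d 2).mul_const _).add ((tendsto_d (2 * s)).mul_const _)).mul 
      (((hAw.add_const _).pow 2).add ((hBw.add_const _).pow 2))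
  have hd0 : ∀ p : ℝ, 0 < p → ∀ μ : ℝ, 1 < μ → 0 ≤ d p μ := fun p hp μ hμ => by
    simp only [hd]
    exact div_nonneg (by linarith [Real.one_lt_rpow hμ hp]) (by linarith)
  obtain ⟨r1, r2⟩ := fatou_real (F := fun k => F (1 + 1 / ((k : ℝ) + 1))) 
    (fun k w => mul_nonneg (add_nonneg (mul_nonneg (hd0 2 (by norm_num) _ (hs1 k)) (hN0 w)) 
      (mul_nonneg (hd0 _ (by linarith [hs.1]) _ (hs1 k)) (hm0 w))) (by positivity)) 
    (fun k => Fi _ (by linarith [hs1 k])) (fun w => (hFt w).comp hsq) (hlim.comp hsq)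
  have r3 : ∫ w, (2 * N w + (2 * s) * m w) * ((A w + A w) ^ 2 + (B w + B w) ^ 2) = 8 * e2 + (8 * s) * em := by
    rw [he2, hem, ← integral_const_mul, ← integral_const_mul]
    refine Eq.trans ?_ (integral_add (hNE.const_mul 8) (hmE.const_mul (8 * s)))
    congr 1; funext w; ring
  rw [r3] at r2
  nlinarith [mul_nonneg hs.1.le hem0]

end

section
variable {n : ℕ}

lemma XX_cont {f v : En n → ℝ} (hf : Integrable f) (hv : Integrable v) : Continuous (XX f v) := by
  unfold XX
  exact ((TF_cont hf).mul (TF_cont hv)).add ((TF_cont hf).mul (TF_cont hv))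

lemma XX_gs_int {f v : En n → ℝ} (hf : Integrable f) (hv : Integrable v) {c : ℝ} (hc : 0 < c) :
    Integrable (fun w => XX f v w * gs c w) := by
  refine (gs_int hc).bdd_mul (c := 2 * ((∫ x, |f x|) * ∫ x, |v x|)) (XX_cont hf hv).aestronglyMeasurable
    (Eventually.of_forall fun w => ?_)
  have hF : 0 ≤ ∫ x, |f x| := integral_nonneg fun x => abs_nonneg _
  unfold XX
  refine (norm_add_le _ _).trans ?_
  rw [norm_mul, norm_mul, Real.norm_eq_abs, Real.norm_eq_abs, Real.norm_eq_abs, Real.norm_eq_abs]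
  have h1 := mul_le_mul (TF_le (θ := 0) hf w) (TF_le (θ := 0) hv w) (abs_nonneg _) hF
  have h2 := mul_le_mul (TF_le (θ := -(π / 2)) hf w) (TF_le (θ := -(π / 2)) hv w) (abs_nonneg _) hF
  linarith

lemma TF_dil (θ : ℝ) (u : En n → ℝ) {μ : ℝ} (hμ : 0 < μ) (w : En n) :
    TF θ (fun x => μ ^ n * u (μ • x)) w = TF θ u (μ⁻¹ • w) := by
  unfold TF
  have h := Measure.integral_comp_smul (volume : Measure (En n)) (fun x => u x * Ps ((2 * π) • μ⁻¹ • w) θ x) μ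
  rw [finrank_euclideanSpace_fin, abs_of_pos (by positivity), smul_eq_mul] at h
  have h2 : ∫ x, u x * Ps ((2 * π) • μ⁻¹ • w) θ x = μ ^ n * ∫ x, u (μ • x) * Ps ((2 * π) • μ⁻¹ • w) θ (μ • x) := by
    rw [h]; field_simp
  rw [h2, ← integral_const_mul]
  congr 1; funext x
  have : Ps ((2 * π) • μ⁻¹ • w) θ (μ • x) = Ps ((2 * π) • w) θ x := by
    unfold Ps
    simp only [inner_smul_left, inner_smul_right, conj_trivial]
    congr 2
    field_simp
  rw [this]; ring

lemma gs_tendsto (w : En n) : Tendsto (fun c => gs c w) atTop (𝓝 1) := by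
  have h : Tendsto (fun c : ℝ => -c⁻¹ * ‖w‖ ^ 2) atTop (𝓝 0) := by
    have := (tendsto_inv_atTop_zero (𝕜 := ℝ)).neg.mul_const (‖w‖ ^ 2)
    simpa using this
  have h2 := (Real.continuous_exp.tendsto 0).comp h
  rw [Real.exp_zero] at h2
  exact h2

lemma mb_meas (s : ℝ) : Measurable (mb n s) := by
  unfold mb
  refine Measurable.const_mul ?_ _
  have : StronglyMeasurable (Function.uncurry fun (b y : En n) => (2 - 2 * Real.cos ⟪b, y⟫) / ‖y‖ ^ ((n : ℝ) + 2 * s)) := by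
    refine Measurable.stronglyMeasurable ?_
    unfold Function.uncurry
    have h1 : Measurable fun p : En n × En n => Real.cos ⟪p.1, p.2⟫ := by
      have : Continuous fun p : En n × En n => Real.cos ⟪p.1, p.2⟫ := by fun_prop
      exact this.measurable
    exact (measurable_const.sub (h1.const_mul 2)).div ((measurable_snd.norm).pow_const _)
  exact this.integral_prod_right.measurable

set_option maxHeartbeats 1000000 in
lemma Sol.hQ0 {D : Dom n} {s a lam : ℝ} {u : En n → ℝ} (h : Sol D s a lam u)
    (hl : ∀ ε : ℝ, 0 < ε → ∃ r : ℝ, 0 < r ∧ ∀ x, 0 < D.τ x → D.τ x < r → |u x| ≤ ε * D.τ x)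
    {H : En n → ℝ} (Hi : Integrable H) (H0 : ∀ z, 0 < D.τ z → H z = 0) :
    Tendsto (fun μ : ℝ => (∫ z, H z * (μ ^ n * u (μ • z))) / (μ - 1)) (𝓝[≠] 1) (𝓝 0) := by
  obtain ⟨C, hC1, hC⟩ := h.lipschitz
  have hR := D.hR
  have hK := D.hK
  have e : ∀ μ : ℝ, (∫ z, H z * (μ ^ n * u (μ • z))) / (μ - 1) = ∫ z, H z * (μ ^ n * (u (μ • z) / (μ - 1))) := fun μ => by
    rw [← integral_div]; congr 1; funext z; ring
  simp_rw [e]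
  rw [show (0:ℝ) = ∫ z : En n, (0:ℝ) by simp]
  have hnear : ∀ᶠ μ in 𝓝[≠] (1:ℝ), μ ∈ Ioo (1/2 : ℝ) 2 :=
    nhdsWithin_le_nhds (Ioo_mem_nhds (by norm_num) (by norm_num))
  refine tendsto_integral_filter_of_dominated_convergence (fun z => |H z| * (2 ^ n * (C * (2 * D.R)))) ?_ ?_
    (Hi.abs.mul_const _) (Eventually.of_forall fun z => ?_)
  · refine Eventually.of_forall fun μ => ?_
    have : Continuous fun z : En n => μ ^ n * (u (μ • z) / (μ - 1)) := by
      have := h.cont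
      fun_prop
    exact Hi.aestronglyMeasurable.mul this.aestronglyMeasurable
  · filter_upwards [hnear, self_mem_nhdsWithin] with μ hμ hμ1
    have hμ1 : μ ≠ 1 := hμ1
    have hμ0 : 0 < μ := by linarith [hμ.1]
    have ha : 0 < |μ - 1| := abs_pos.2 (sub_ne_zero.2 hμ1)
    refine Eventually.of_forall fun z => ?_
    by_cases hz : 0 < D.τ z
    · rw [H0 z hz]; simp
    push Not at hz
    rw [norm_mul, Real.norm_eq_abs]
    refine mul_le_mul_of_nonneg_left ?_ (abs_nonneg _)
    rw [norm_mul, Real.norm_of_nonneg (by positivity)]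
    refine mul_le_mul (pow_le_pow_left₀ hμ0.le hμ.2.le n) ?_ (norm_nonneg _) (by positivity)
    rw [norm_div, Real.norm_eq_abs, Real.norm_eq_abs, div_le_iff₀ ha]
    by_cases hb : D.R ≤ ‖μ • z‖
    · rw [h.zero_far hb]; rw [abs_zero]; positivity
    · push Not at hb
      rw [norm_smul, Real.norm_of_nonneg hμ0.le] at hb
      have hz2 : ‖z‖ ≤ 2 * D.R := by nlinarith [norm_nonneg z, hμ.1]
      have := hC (μ • z) z
      rw [h.zero z hz, sub_zero, show μ • z - z = (μ - 1) • z by rw [sub_smul, one_smul], norm_smul, Real.norm_eq_abs] at this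
      refine this.trans ?_
      rw [mul_assoc, mul_comm |μ - 1|]
      gcongr
  · by_cases hz : 0 < D.τ z
    · rw [H0 z hz]; simp
    push Not at hz
    have hs : Tendsto (fun μ : ℝ => u (μ • z) / (μ - 1)) (𝓝[≠] 1) (𝓝 0) := by
      rw [Metric.tendsto_nhds]
      intro δ hδ
      have hKz : 0 < D.K * ‖z‖ + 1 := by positivity
      obtain ⟨r, hr, hr2⟩ := hl (δ / (D.K * ‖z‖ + 1)) (by positivity)
      have hev : ∀ᶠ μ in 𝓝[≠] (1:ℝ), D.τ (μ • z) < r := by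
        have hc : Continuous fun μ : ℝ => D.τ (μ • z) := D.τ_cont.comp (by fun_prop)
        have := hc.tendsto 1
        rw [one_smul] at this
        exact nhdsWithin_le_nhds (this.eventually (gt_mem_nhds (by linarith)))
      filter_upwards [hev, self_mem_nhdsWithin] with μ hμ hμ1
      have hμ1 : μ ≠ 1 := hμ1
      have ha : 0 < |μ - 1| := abs_pos.2 (sub_ne_zero.2 hμ1)
      rw [dist_zero_right, norm_div, Real.norm_eq_abs, Real.norm_eq_abs, div_lt_iff₀ ha]
      by_cases hb : 0 < D.τ (μ • z)
      · have h1 := hr2 _ hb hμ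
        have h2 := D.lip (μ • z) z
        rw [max_eq_left hb.le, max_eq_right hz, sub_zero, abs_of_pos hb, 
          show μ • z - z = (μ - 1) • z by rw [sub_smul, one_smul], norm_smul, Real.norm_eq_abs] at h2
        refine h1.trans_lt ((mul_le_mul_of_nonneg_left h2 (by positivity)).trans_lt ?_)
        rw [div_mul_eq_mul_div, div_lt_iff₀ hKz]
        nlinarith [mul_pos hδ ha]
      · push Not at hb
        rw [h.zero _ hb, abs_zero]; positivity
    have h1 : Tendsto (fun μ : ℝ => μ ^ n) (𝓝[≠] 1) (𝓝 1) := by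
      have := (continuous_pow n : Continuous fun μ : ℝ => μ ^ n).tendsto 1
      rw [one_pow] at this
      exact this.mono_left nhdsWithin_le_nhds
    have := (h1.mul hs).const_mul (H z)
    simpa using this

set_option maxHeartbeats 1000000 in
lemma Sol.final {D : Dom n} {s a lam : ℝ} {u : En n → ℝ} (h : Sol D s a lam u)
    (hl : ∀ ε : ℝ, 0 < ε → ∃ r : ℝ, 0 < r ∧ ∀ x, 0 < D.τ x → D.τ x < r → |u x| ≤ ε * D.τ x) : ∀ x, u x = 0 := by
  obtain ⟨M, hM0, hM⟩ := h.bdd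
  have hs := h.hs
  have ui : Integrable u := h.cont.integrable_of_hasCompactSupport (D.hcs h.zero)
  set H : En n → ℝ := fun z => a * HH D s u z with hH
  have Hi : Integrable H := h.HH_int.const_mul a
  have H0 : ∀ z, 0 < D.τ z → H z = 0 := fun z hz => by simp only [hH]; rw [HH_zero hz, mul_zero]
  set A := TF 0 u with hA
  set B := TF (-(π / 2)) u with hB
  have Ac : Continuous A := TF_cont ui
  have Bc : Continuous B := TF_cont ui
  set N : En n → ℝ := fun w => ‖(2 * π) • w‖ ^ 2 with hN
  set m : En n → ℝ := fun w => a * mb n s ((2 * π) • w) with hm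
  have N0 : ∀ w, 0 ≤ N w := fun w => by positivity
  have m0 : ∀ w, 0 ≤ m w := fun w => mul_nonneg h.ha (mb_nonneg _ hs)
  have Nc : Continuous N := by simp only [hN]; fun_prop
  have mm : Measurable m := by
    have : Measurable fun w : En n => (2 * π) • w := by fun_prop
    exact ((mb_meas s).comp this).const_mul a
  have Nh : ∀ μ : ℝ, 0 < μ → ∀ w, N (μ • w) = μ ^ (2:ℝ) * N w := fun μ hμ w => by
    simp only [hN]
    rw [smul_comm, norm_smul, Real.norm_of_nonneg hμ.le, Real.rpow_two]; ring
  have mh : ∀ μ : ℝ, 0 < μ → ∀ w, m (μ • w) = μ ^ (2 * s) * m w := fun μ hμ w => by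
    simp only [hm]
    rw [smul_comm, mb_smul _ hμ]; ring
  have HT : ∀ θ w, TF θ H w = (N w + m w - lam) * TF θ u w := fun θ w => (h.TI2 hl _ _).symm
  have EX : ∀ w, XX u u w = A w ^ 2 + B w ^ 2 := fun w => by unfold XX; ring
  have HX : ∀ w, XX H u w = (N w + m w - lam) * (A w ^ 2 + B w ^ 2) := fun w => by
    unfold XX; rw [HT, HT]; ring
  have sq : Tendsto (fun k : ℕ => (k : ℝ) + 1) atTop atTop := tendsto_atTop_add_const_right _ _ tendsto_natCast_atTop_atTop
  have kp : ∀ k : ℕ, (0:ℝ) < (k : ℝ) + 1 := fun k => by positivity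
  have l1 := (lemG ui ui h.cont hM).comp sq
  have l2 := (lemG Hi ui h.cont hM).comp sq
  have hHu : ∫ x, H x * u x = 0 := by
    rw [show (fun x => H x * u x) = fun _ => 0 from ?_]; · simp
    funext x
    by_cases hx : 0 < D.τ x
    · rw [H0 x hx, zero_mul]
    · push Not at hx; rw [h.zero x hx, mul_zero]
  rw [hHu] at l2
  obtain ⟨Ei, -⟩ := fatou_real (F := fun k w => XX u u w * gs ((k : ℝ) + 1) w) (f := fun w => A w ^ 2 + B w ^ 2)
    (fun k w => by rw [EX]; exact mul_nonneg (by positivity) (gs_nonneg _ _))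
    (fun k => XX_gs_int ui ui (kp k))
    (fun w => by
      have := ((gs_tendsto w).comp sq).const_mul (XX u u w)
      rw [mul_one] at this
      rw [← EX]
      exact this) l1
  have Xe : ∀ c w, (N w + m w) * (A w ^ 2 + B w ^ 2) * gs c w = XX H u w * gs c w + lam * (XX u u w * gs c w) := fun c w => by
    rw [HX, EX]; ring
  obtain ⟨NmE, -⟩ := fatou_real (F := fun k w => (N w + m w) * (A w ^ 2 + B w ^ 2) * gs ((k : ℝ) + 1) w) 
    (f := fun w => (N w + m w) * (A w ^ 2 + B w ^ 2)) (L := 0 + lam * ∫ x, u x * u x)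
    (fun k w => mul_nonneg (mul_nonneg (add_nonneg (N0 w) (m0 w)) (by positivity)) (gs_nonneg _ _))
    (fun k => by
      simp_rw [Xe]
      exact (XX_gs_int Hi ui (kp k)).add ((XX_gs_int ui ui (kp k)).const_mul lam))
    (fun w => by
      have := ((gs_tendsto w).comp sq).const_mul ((N w + m w) * (A w ^ 2 + B w ^ 2))
      rwa [mul_one] at this)
    (by
      refine (l2.add (l1.const_mul lam)).congr fun k => ?_
      simp_rw [Xe]
      simp only [Function.comp]
      rw [← integral_const_mul]
      exact (integral_add (XX_gs_int Hi ui (kp k)) ((XX_gs_int ui ui (kp k)).const_mul lam)).symm)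
  have Em : Measurable fun w => A w ^ 2 + B w ^ 2 := by
    have : Continuous fun w => A w ^ 2 + B w ^ 2 := by fun_prop
    exact this.measurable
  have NE : Integrable fun w => N w * (A w ^ 2 + B w ^ 2) := by
    refine NmE.mono' (Nc.measurable.mul Em).aestronglyMeasurable (Eventually.of_forall fun w => ?_)
    rw [Real.norm_of_nonneg (mul_nonneg (N0 w) (by positivity))]
    exact mul_le_mul_of_nonneg_right (by linarith [m0 w]) (by positivity)
  have mE : Integrable fun w => m w * (A w ^ 2 + B w ^ 2) := by
    refine NmE.mono' (mm.mul Em).aestronglyMeasurable (Eventually.of_forall fun w => ?_)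
    rw [Real.norm_of_nonneg (mul_nonneg (m0 w) (by positivity))]
    exact mul_le_mul_of_nonneg_right (by linarith [N0 w]) (by positivity)
  have hQ : ∀ μ : ℝ, 0 < μ → ∫ w, (N w + m w - lam) * YY A B μ⁻¹ w = ∫ z, H z * (μ ^ n * u (μ • z)) := fun μ hμ => by
    have vi : Integrable fun x => μ ^ n * u (μ • x) := (ui.comp_smul hμ.ne').const_mul _
    have vc : Continuous fun x : En n => μ ^ n * u (μ • x) := by
      have := h.cont
      fun_prop
    have l3 := lemG Hi vi vc (B := μ ^ n * M) (fun x => by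
      rw [abs_mul, abs_of_pos (by positivity)]
      exact mul_le_mul_of_nonneg_left (hM _) (by positivity))
    have VX : ∀ w, XX H (fun x => μ ^ n * u (μ • x)) w = (N w + m w - lam) * YY A B μ⁻¹ w := fun w => by
      unfold XX YY; rw [HT, HT, TF_dil _ _ hμ, TF_dil _ _ hμ]; ring
    have hμi := inv_pos.2 hμ
    have i0 : Integrable (YY A B μ⁻¹) := by
      have := YY_int (μ := μ⁻¹) (g := fun _ => 1) (p := 0) Ac Bc measurable_const (fun _ => zero_le_one) (by simp) (by simpa using Ei) hμi
      simpa using this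
    have i3 : Integrable fun w => (N w + m w - lam) * YY A B μ⁻¹ w := by
      refine (((YY_int Ac Bc Nc.measurable N0 Nh NE hμi).add (YY_int Ac Bc mm m0 mh mE hμi)).sub (i0.const_mul lam)).congr
        (Eventually.of_forall fun w => ?_)
      simp only [Pi.add_apply, Pi.sub_apply]; ring
    refine tendsto_nhds_unique ?_ l3
    refine tendsto_integral_filter_of_dominated_convergence (fun w => |(N w + m w - lam) * YY A B μ⁻¹ w|) 
      ?_ ?_ i3.abs (Eventually.of_forall fun w => ?_)
    · filter_upwards [Ioi_mem_atTop 0] with c hc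
      exact (XX_gs_int Hi vi hc).aestronglyMeasurable
    · filter_upwards [Ioi_mem_atTop 0] with c hc
      refine Eventually.of_forall fun w => ?_
      rw [VX, norm_mul, Real.norm_eq_abs, Real.norm_of_nonneg (gs_nonneg _ _)]
      exact mul_le_of_le_one_right (abs_nonneg _) (gs_le hc w)
    · have := (gs_tendsto w).const_mul (XX H (fun x => μ ^ n * u (μ • x)) w)
      rw [mul_one] at this
      rw [← VX]
      exact this
  have key := spectral Ac Bc hs Nc.measurable N0 Nh mm m0 mh Ei NE mE hQ (h.hQ0 hl Hi H0)
  have NE0 : (fun w => N w * (A w ^ 2 + B w ^ 2)) = 0 := by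
    have hc : Continuous fun w => N w * (A w ^ 2 + B w ^ 2) := by fun_prop
    have h0 : 0 ≤ fun w => N w * (A w ^ 2 + B w ^ 2) := fun w => mul_nonneg (N0 w) (by positivity)
    have := (integral_eq_zero_iff_of_nonneg h0 NE).1 (le_antisymm key (integral_nonneg h0))
    exact (hc.ae_eq_iff_eq volume continuous_const).1 this
  have hne : Nonempty (Fin n) := ⟨⟨0, h.hn⟩⟩
  have hnt : Nontrivial (En n) := inferInstance
  have E0 : (fun w => A w ^ 2 + B w ^ 2) =ᵐ[volume] 0 := by
    filter_upwards [compl_mem_ae_iff.2 (measure_singleton (0 : En n))] with w hw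
    have hw : w ≠ 0 := hw
    have h1 := congrFun NE0 w
    simp only [Pi.zero_apply, hN] at h1
    rcases mul_eq_zero.1 h1 with h2 | h2
    · exfalso
      have : (2 * π) • w ≠ 0 := smul_ne_zero (by positivity) hw
      exact this (by simpa using h2)
    · exact h2
  have u2 : ∫ x, u x * u x = 0 := by
    refine tendsto_nhds_unique (lemG ui ui h.cont hM) (tendsto_const_nhds.congr fun c => ?_)
    symm
    refine integral_eq_zero_of_ae ?_
    filter_upwards [E0] with w hw
    rw [EX, show A w ^ 2 + B w ^ 2 = 0 from hw, zero_mul]; rfl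
  have uui : Integrable fun x => u x * u x := ui.mul_bdd (c := M) h.cont.aestronglyMeasurable (Eventually.of_forall hM)
  have h0 : 0 ≤ fun x => u x * u x := fun x => mul_self_nonneg _
  have := (integral_eq_zero_iff_of_nonneg h0 uui).1 u2
  have := ((h.cont.mul h.cont).ae_eq_iff_eq volume continuous_const).1 this
  intro x
  exact mul_self_eq_zero.1 (congrFun this x)

end

/-- Corollary 1.3, unique continuation for eigenfunctions: if
`-Δφ + a(-Δ)ˢφ = λφ` in `Ω`, `φ = 0` in `Ωᶜ`, and `∂φ/∂ν = 0` on all of `∂Ω`,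
then `φ ≡ 0` in `ℝⁿ`. -/
theorem unique_continuation_eigenfunction (n : ℕ) (hn : 1 ≤ n) (s a : ℝ)
    (hs : s ∈ Set.Ioo (0:ℝ) 1) (ha : 0 ≤ a) (D : C2Domain n) (lam : ℝ)
    (φ : En n → ℝ) (hφ2 : ContDiffOn ℝ 2 φ D.carrier) (hφc : Continuous φ)
    (heq : ∀ x ∈ D.carrier, -lap n φ x + a * fracLap n s φ x = lam * φ x)
    (hzero : ∀ x ∉ D.carrier, φ x = 0)
    (hnd : ∀ x ∈ frontier D.carrier, normalDeriv D φ x = 0) :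
    ∀ x, φ x = 0 := by
  obtain ⟨E, κ, hκ, hτ, hΩ⟩ := exists_dom D
  have hmem : ∀ x, 0 < E.τ x ↔ x ∈ D.carrier := fun x => by rw [← hΩ]; rfl
  have hop : IsOpen D.carrier := by
    rw [D.carrier_eq]; exact isOpen_lt D.phi_smooth.continuous continuous_const
  have h : Sol E s a lam φ :=
    { hn := hn
      hs := hs
      ha := ha
      cont := hφc
      c2 := fun x hx => hφ2.contDiffAt (hop.mem_nhds ((hmem x).1 hx))
      eq := fun x hx => heq x ((hmem x).1 hx)
      zero := fun x hx => hzero x fun hc => absurd ((hmem x).2 hc) (not_lt.2 hx) }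
  refine h.final (h.little_abs fun x0 hx0c hx0 => ?_)
  have hfr : x0 ∈ frontier D.carrier := by
    rw [frontier, hop.interior_eq, ← hΩ]
    exact ⟨hx0c, fun hc => by
      have : 0 < E.τ x0 := hc
      linarith⟩
  have hg := D.grad_ne x0 hfr
  have hgn : 0 < ‖gradient D.phi x0‖ := norm_pos_iff.2 hg
  have hd : DifferentiableAt ℝ D.phi x0 := D.phi_smooth.differentiable (by norm_num) x0
  have hv : 0 < fderiv ℝ E.τ x0 (-D.nu x0) := by
    rw [hτ, fderiv_const_mul hd]
    have h1 : fderiv ℝ D.phi x0 (gradient D.phi x0) = ‖gradient D.phi x0‖ ^ 2 := by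
      rw [← real_inner_self_eq_norm_sq, gradient, InnerProductSpace.toDual_symm_apply]
    have h2 : (-κ • fderiv ℝ D.phi x0) (-D.nu x0) = κ * (‖gradient D.phi x0‖⁻¹ * ‖gradient D.phi x0‖ ^ 2) := by
      unfold C2Domain.nu
      rw [← h1]
      simp
    rw [h2]
    positivity
  refine ⟨_, hv, fun L hL => ?_⟩
  rw [unique_path hx0 hx0c hv hL hL.differentiableWithinAt.hasFDerivWithinAt, map_neg, neg_eq_zero, hΩ]
  exact hnd x0 hfr
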